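/- Let φ: (R,m,k) → (S,n,ℓ) be a flat local ring homomorphism between commutative Noetherian local rings which is essentially of finite type with complete intersection closed fibre S/mS, let R → (R',m',k') ← Q be a quasi-deformation, set T = R' ⊗_R S, and let 𝔐 be a maximal ideal of T contracting to m' in R' and to n in S, with completed local ring (T̂_𝔐, 𝔐T̂_𝔐, E). Then the second André–Quillen homology D_2(T̂_𝔐 | R', E) vanishes, the natural flat local map β: R' → T̂_𝔐 is complete intersection at 𝔐T̂_𝔐, the composite Q → R' → T̂_𝔐 is complete intersection at 𝔐T̂_𝔐, and consequently there is a quasi-deformation S → T̂_𝔐 ← Q' in which Q' → T̂_𝔐 is surjective with kernel generated by a Q'-regular sequence. -/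

import Mathlib

/-!
Common definitions: André–Quillen homology via the standard (comonad/polynomial)
simplicial resolution, complete-intersection (flat) dimensions via quasi-deformations,
Cohen factorizations, Koszul homology `H₁`, and related notions.
-/

universe u

open TensorProduct IsLocalRing

noncomputable section

/-! ### Flat and projective dimension -/

/-- `FlatDimLE Q n N` : the `Q`-module `N` has flat dimension at most `n`,
i.e. it admits a flat resolution of length at most `n`. -/
def FlatDimLE (Q : Type u) [CommRing Q] : ℕ → (N : Type u) → [AddCommGroup N] → [Module Q N] → Prop
  | 0, N, _, _ => Module.Flat Q N
  | n+1, N, _, _ =>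
      ∃ (F : Type u) (_ : AddCommGroup F) (_ : Module Q F) (f : F →ₗ[Q] N),
        Module.Flat Q F ∧ Function.Surjective f ∧ FlatDimLE Q n (LinearMap.ker f)

/-- `ProjDimLE Q n N` : the `Q`-module `N` has projective dimension at most `n`. -/
def ProjDimLE (Q : Type u) [CommRing Q] : ℕ → (N : Type u) → [AddCommGroup N] → [Module Q N] → Prop
  | 0, N, _, _ => Module.Projective Q N
  | n+1, N, _, _ =>
      ∃ (F : Type u) (_ : AddCommGroup F) (_ : Module Q F) (f : F →ₗ[Q] N),
        Module.Projective Q F ∧ Function.Surjective f ∧ ProjDimLE Q n (LinearMap.ker f)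

/-- The flat dimension `fd_Q N` is finite. -/
def FlatDimFinite (Q : Type u) [CommRing Q] (N : Type u) [AddCommGroup N] [Module Q N] : Prop :=
  ∃ n : ℕ, FlatDimLE Q n N

/-- The projective dimension `pd_Q N` is finite. -/
def ProjDimFinite (Q : Type u) [CommRing Q] (N : Type u) [AddCommGroup N] [Module Q N] : Prop :=
  ∃ n : ℕ, ProjDimLE Q n N

/-! ### Regular sequences, regular local rings, complete intersection conditions -/

/-- The ideal `I` is generated by an `A`-regular sequence. -/
def GeneratedByRegularSequence (A : Type u) [CommRing A] (I : Ideal A) : Prop :=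
  ∃ rs : List A, RingTheory.Sequence.IsRegular A rs ∧ Ideal.span {x | x ∈ rs} = I

/-- A (Noetherian local) ring is regular iff its maximal ideal is generated by a
regular sequence. -/
def IsRegularLocal (A : Type u) [CommRing A] : Prop :=
  IsNoetherianRing A ∧
    ∃ h : IsLocalRing A, GeneratedByRegularSequence A (@IsLocalRing.maximalIdeal A _ h)

/-- A local homomorphism is weakly regular if it is flat with regular closed fibre. -/
def IsWeaklyRegularHom (A B : Type u) [CommRing A] [CommRing B] [IsLocalRing A]
    (f : A →+* B) : Prop :=
  IsLocalHom f ∧ (letI := f.toAlgebra; Module.Flat A B) ∧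
    IsRegularLocal (B ⧸ Ideal.map f (maximalIdeal A))

/-- `R'' → f → g` is a Cohen factorization of the semi-completion of `ψ : A → B`
with respect to the (maximal) ideal `J` of `B`:  `A → R'' → B̂` with `A → R''`
weakly regular, `R''` complete Noetherian local and `R'' → B̂` surjective local. -/
def IsCohenFactorizationAt (A B : Type u) [CommRing A] [CommRing B] [IsLocalRing A]
    (ψ : A →+* B) (J : Ideal B) (R'' : Type u) [CommRing R'']
    (f : A →+* R'') (g : R'' →+* AdicCompletion J B) : Prop :=
  g.comp f = (algebraMap B (AdicCompletion J B)).comp ψ ∧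
  IsNoetherianRing R'' ∧
  (∃ h : IsLocalRing R'', IsAdicComplete (@IsLocalRing.maximalIdeal R'' _ h) R'') ∧
  IsWeaklyRegularHom A R'' f ∧
  Function.Surjective g ∧ IsLocalHom g

/-- `ψ : A → B` is complete intersection (c.i.) at the ideal `J` (typically the
maximal ideal of `B`): in a Cohen factorization `A → R'' → B̂` of the
semi-completion of `ψ`, the kernel of `R'' → B̂` is generated by a regular sequence. -/
def IsCIAt (A B : Type u) [CommRing A] [CommRing B] [IsLocalRing A]
    (ψ : A →+* B) (J : Ideal B) : Prop :=
  ∃ (R'' : Type u) (_ : CommRing R'') (f : A →+* R'') (g : R'' →+* AdicCompletion J B),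
    IsCohenFactorizationAt A B ψ J R'' f g ∧ GeneratedByRegularSequence R'' (RingHom.ker g)

/-- A Noetherian local ring is a complete intersection if its completion is the
quotient of a complete regular local ring by an ideal generated by a regular sequence. -/
def IsCompleteIntersectionRing (A : Type u) [CommRing A] : Prop :=
  IsNoetherianRing A ∧
  ∃ h : IsLocalRing A,
    ∃ (Q : Type u) (_ : CommRing Q)
      (g : Q →+* AdicCompletion (@IsLocalRing.maximalIdeal A _ h) A),
      IsRegularLocal Q ∧ (∃ hq : IsLocalRing Q, IsAdicComplete (@IsLocalRing.maximalIdeal Q _ hq) Q) ∧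
      Function.Surjective g ∧ GeneratedByRegularSequence Q (RingHom.ker g)

/-! ### Complete intersection (flat) dimensions via quasi-deformations

`R → R' ← Q` is a quasi-deformation when `R → R'` is flat local and `Q → R'` is
surjective local with kernel generated by a `Q`-regular sequence (all rings
Noetherian local).  The various complete intersection (flat) dimensions
`CI-fd`, `CI-dim`, `CI*-fd`, `CI*-dim`, `cidim-fd`, `cidim` of a module `M` are
`inf { fd_Q(R' ⊗_R M) - pd_Q R' }` over (upper / complete intersection)
quasi-deformations; such a dimension is finite iff there is a quasi-deformation
of the appropriate kind for which both `fd_Q (R' ⊗_R M)` and `pd_Q R'` are finite. -/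

/-- The conditions on `R → R' ← Q` making it a quasi-deformation. -/
def IsQuasiDeformation (R R' Q : Type u) [CommRing R] [CommRing R'] [CommRing Q]
    (f : R →+* R') (g : Q →+* R') : Prop :=
  IsLocalRing R' ∧ IsLocalRing Q ∧ IsNoetherianRing R' ∧ IsNoetherianRing Q ∧
  IsLocalHom f ∧ IsLocalHom g ∧ (letI := f.toAlgebra; Module.Flat R R') ∧
  Function.Surjective g ∧ GeneratedByRegularSequence Q (RingHom.ker g)

/-- `CI-fd_R M < ∞` (equivalently, for finitely generated `M`, `CI-dim_R M < ∞`):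
there is a quasi-deformation `R → R' ← Q` with `fd_Q (R' ⊗_R M)` and `pd_Q R'` finite. -/
def HasFiniteCIDim (R : Type u) [CommRing R] (M : Type u) [AddCommGroup M] [Module R M] : Prop :=
  ∃ (R' Q : Type u) (_ : CommRing R') (_ : CommRing Q) (f : R →+* R') (g : Q →+* R'),
    IsQuasiDeformation R R' Q f g ∧
    (letI := f.toAlgebra;
     letI := g.toAlgebra;
     letI : Module Q (R' ⊗[R] M) := Module.compHom _ g;
     FlatDimFinite Q (R' ⊗[R] M) ∧ ProjDimFinite Q R')

/-- `CI*-fd_R M < ∞` (resp. `CI*-dim_R M < ∞`): as in `HasFiniteCIDim` but over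
upper quasi-deformations, i.e. `R → R'` is weakly regular. -/
def HasFiniteUpperCIDim (R : Type u) [CommRing R] [IsLocalRing R]
    (M : Type u) [AddCommGroup M] [Module R M] : Prop :=
  ∃ (R' Q : Type u) (_ : CommRing R') (_ : CommRing Q) (f : R →+* R') (g : Q →+* R'),
    IsQuasiDeformation R R' Q f g ∧ IsWeaklyRegularHom R R' f ∧
    (letI := f.toAlgebra;
     letI := g.toAlgebra;
     letI : Module Q (R' ⊗[R] M) := Module.compHom _ g;
     FlatDimFinite Q (R' ⊗[R] M) ∧ ProjDimFinite Q R')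

/-- `cidim-fd_R M < ∞` (resp. `cidim_R M < ∞`): as in `HasFiniteCIDim` but over
complete intersection quasi-deformations, i.e. `R → R'` is c.i. at the maximal
ideal of `R'`. -/
def HasFiniteCIQDDim (R : Type u) [CommRing R] [IsLocalRing R]
    (M : Type u) [AddCommGroup M] [Module R M] : Prop :=
  ∃ (R' Q : Type u) (_ : CommRing R') (_ : CommRing Q) (hR' : IsLocalRing R')
    (f : R →+* R') (g : Q →+* R'),
    IsQuasiDeformation R R' Q f g ∧
    IsCIAt R R' f (@IsLocalRing.maximalIdeal R' _ hR') ∧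
    (letI := f.toAlgebra;
     letI := g.toAlgebra;
     letI : Module Q (R' ⊗[R] M) := Module.compHom _ g;
     FlatDimFinite Q (R' ⊗[R] M) ∧ ProjDimFinite Q R')

/-! ### André–Quillen homology

`D_n(S|R, M)` is defined as the `n`-th homology of `L ⊗_S M`, where `L` is the
cotangent complex of the `R`-algebra `S`: the complex associated to the standard
simplicial resolution `X` of `S` by polynomial `R`-algebras (the comonad
resolution `X_n = G^{n+1} S`, `G A = R[A]`), with `L_n = S ⊗_{X_n} Ω_{X_n/R}`
the free `S`-module on the variables of `X_n` and differentials the alternating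
sums of the maps induced by the face maps. -/

/-- `AQV R S n` is, for `n ≥ 1`, the `n`-th ring in the standard simplicial
polynomial resolution of `S` over `R` (and `AQV R S 0 = S` as an index set). -/
def AQV (R S : Type u) [CommRing R] : ℕ → Type u
  | 0 => S
  | n+1 => MvPolynomial (AQV R S n) R

noncomputable instance (R S : Type u) [CommRing R] (n : ℕ) : CommRing (AQV R S (n+1)) :=
  inferInstanceAs (CommRing (MvPolynomial (AQV R S n) R))

noncomputable instance (R S : Type u) [CommRing R] (n : ℕ) : Algebra R (AQV R S (n+1)) :=
  inferInstanceAs (Algebra R (MvPolynomial (AQV R S n) R))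

/-- The augmentations `X_n → S` of the standard resolution. -/
def AQaug (R S : Type u) [CommRing R] [CommRing S] [Algebra R S] :
    (n : ℕ) → (AQV R S (n+1) →ₐ[R] S)
  | 0 => MvPolynomial.aeval (id : S → S)
  | n+1 => MvPolynomial.aeval (fun v : AQV R S (n+1) => AQaug R S n v)

/-- The face maps `dᵢ : X_{n+1} → X_n` of the standard resolution: `d₀` is the
counit and `d_{i+1} = G(dᵢ)`. -/
def AQface (R S : Type u) [CommRing R] [CommRing S] [Algebra R S] :
    (n : ℕ) → (i : ℕ) → (AQV R S (n+2) →ₐ[R] AQV R S (n+1))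
  | n, 0 => MvPolynomial.aeval (id : AQV R S (n+1) → AQV R S (n+1))
  | 0, _+1 => MvPolynomial.rename ⇑(AQaug R S 0)
  | n+1, i+1 => MvPolynomial.rename ⇑(AQface R S n i)

variable (R S : Type u) [CommRing R] [CommRing S] [Algebra R S]
variable (M : Type u) [AddCommGroup M] [Module S M]

/-- The map `L_{n+1} ⊗ M → L_n ⊗ M` induced by an `R`-algebra map
`f : X_{n+1} → X_n` on the (base-changed) Kähler differentials: the free module
on the variables `v` of `X_{n+1}` maps by `e_v ↦ ∑_w aug(∂(f Xᵥ)/∂w) • e_w`. -/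
def AQind (n : ℕ) (f : AQV R S (n+2) →ₐ[R] AQV R S (n+1)) :
    (AQV R S (n+1) →₀ M) →ₗ[S] (AQV R S n →₀ M) :=
  Finsupp.lsum S fun v : AQV R S (n+1) =>
    letI : DecidableEq (AQV R S n) := Classical.decEq _
    let P : MvPolynomial (AQV R S n) R := f (MvPolynomial.X v)
    ∑ w ∈ P.vars,
      (Finsupp.lsingle w).comp
        ((AQaug R S n ((MvPolynomial.pderiv w) P) : S) • (LinearMap.id : M →ₗ[S] M))

/-- The differential `L_{n+1} ⊗ M → L_n ⊗ M` of the cotangent complex: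
the alternating sum of the maps induced by the face maps. -/
def AQdiff (n : ℕ) : (AQV R S (n+1) →₀ M) →ₗ[S] (AQV R S n →₀ M) :=
  ∑ i ∈ Finset.range (n+2), ((-1 : ℤ)^i) • AQind R S M n (AQface R S n i)

/-- Cycles of the cotangent complex with coefficients in `M`. -/
def AQcycles : (n : ℕ) → Submodule S (AQV R S n →₀ M)
  | 0 => ⊤
  | n+1 => LinearMap.ker (AQdiff R S M n)

/-- André–Quillen homology `D_n(S|R, M)`. -/
def AQH (n : ℕ) : Type u :=
  AQcycles R S M n ⧸
    (LinearMap.range (AQdiff R S M n)).comap (AQcycles R S M n).subtype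

noncomputable instance (n : ℕ) : AddCommGroup (AQH R S M n) :=
  inferInstanceAs (AddCommGroup (AQcycles R S M n ⧸
    (LinearMap.range (AQdiff R S M n)).comap (AQcycles R S M n).subtype))

/-- `AQdimLE R S d`: the André–Quillen dimension of the `R`-algebra `S` is at
most `d`, i.e. `D_n(S|R, -) = 0` for all `n > d`. -/
def AQdimLE (d : ℕ) : Prop :=
  ∀ n : ℕ, d < n → ∀ (N : Type u) (iN : AddCommGroup N) (mN : Module S N),
    Subsingleton (@AQH R S _ _ _ N iN mN n)

/-- `AQ-dim_R S < ∞`. -/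
def AQdimFinite : Prop := ∃ d : ℕ, AQdimLE R S d

/-! ### Koszul homology `H₁` -/

/-- First differential of the Koszul complex on `x : Fin c → A`. -/
def koszulD1 (A : Type u) [CommRing A] {c : ℕ} (x : Fin c → A) : (Fin c → A) →ₗ[A] A :=
  ∑ i, x i • (LinearMap.proj i : ((Fin c → A)) →ₗ[A] A)

/-- One-cycles of the Koszul complex on `x`. -/
def koszulZ1 (A : Type u) [CommRing A] {c : ℕ} (x : Fin c → A) : Submodule A (Fin c → A) :=
  LinearMap.ker (koszulD1 A x)

/-- One-boundaries of the Koszul complex on `x` (the image of the second Koszul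
differential, spanned by the elements `xᵢ eⱼ - xⱼ eᵢ`). -/
def koszulB1 (A : Type u) [CommRing A] {c : ℕ} (x : Fin c → A) : Submodule A (Fin c → A) :=
  Submodule.span A
    {v : Fin c → A | ∃ i j, v =
      x i • (Pi.single j (1 : A) : Fin c → A) - x j • (Pi.single i (1 : A) : Fin c → A)}

/-- First Koszul homology of the sequence `x : Fin c → A`. -/
def KoszulH1 (A : Type u) [CommRing A] {c : ℕ} (x : Fin c → A) : Type u :=
  koszulZ1 A x ⧸ (koszulB1 A x).comap (koszulZ1 A x).subtype

noncomputable instance (A : Type u) [CommRing A] {c : ℕ} (x : Fin c → A) :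
    AddCommGroup (KoszulH1 A x) :=
  inferInstanceAs (AddCommGroup (koszulZ1 A x ⧸ (koszulB1 A x).comap (koszulZ1 A x).subtype))

noncomputable instance (A : Type u) [CommRing A] {c : ℕ} (x : Fin c → A) :
    Module A (KoszulH1 A x) :=
  inferInstanceAs (Module A (koszulZ1 A x ⧸ (koszulB1 A x).comap (koszulZ1 A x).subtype))

/-- `H₁(K(σ))` is a free `T̂`-module:  for any Cohen factorization
`S → S'' → T̂` of the semi-completion of `σ` and any finite generating set `x` of
`ker (S'' → T̂)`, the first Koszul homology of `x`, base-changed to `T̂`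
(it is killed by `ker (S'' → T̂)`), is a free `T̂`-module. -/
def KoszulH1FreeHom (S T : Type u) [CommRing S] [CommRing T] [IsLocalRing S] [IsLocalRing T]
    (σ : S →+* T) : Prop :=
  ∀ (S'' : Type u) (_ : CommRing S'') (f : S →+* S'')
    (g : S'' →+* AdicCompletion (maximalIdeal T) T),
    IsCohenFactorizationAt S T σ (maximalIdeal T) S'' f g →
    ∀ (c : ℕ) (x : Fin c → S''), Ideal.span (Set.range x) = RingHom.ker g →
      (letI := g.toAlgebra;
       Module.Free (AdicCompletion (maximalIdeal T) T)
         ((AdicCompletion (maximalIdeal T) T) ⊗[S''] (KoszulH1 S'' x)))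

/-! ### Separability (MacLane) -/

/-- A field extension `ℓ/k` is separable (in the sense of MacLane, allowing
non-algebraic extensions) iff `K ⊗_k ℓ` is reduced for every field extension `K/k`. -/
def IsSeparableFieldExtension (k ℓ : Type u) [Field k] [Field ℓ] [Algebra k ℓ] : Prop :=
  ∀ (K : Type u) (_ : Field K) (_ : Algebra k K), IsReduced (K ⊗[k] ℓ)

end


section
open TensorProduct IsLocalRing

/-- Splitting property of crossed modules over an ideal, with coefficients in `E`. -/
def XSplit {P : Type u} [CommRing P] {E : Type u} [Field E] (J : Ideal P) (ε : P →+* E) : Prop :=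
  ∀ (M : Type u) (_ : AddCommGroup M) (_ : Module P M) (d : M →ₗ[P] P),
    LinearMap.range d = J → (∀ x y, d x • y = d y • x) →
    ∀ ν : LinearMap.ker d →ₛₗ[ε] E, ∃ h : M →ₛₗ[ε] E, ∀ x : LinearMap.ker d, h x = ν x

theorem XSplit.retract {P P' : Type u} [CommRing P] [CommRing P'] {E : Type u} [Field E]
    {J : Ideal P} {J' : Ideal P'} {ε : P →+* E} {ε' : P' →+* E} (ι : P →+* P') (θ : P' →+* P)
    (hθ : θ.comp ι = RingHom.id P) (hJ : J' = J.comap θ) (hε : ε' = ε.comp θ)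
    (H : XSplit J' ε') : XSplit J ε := by
  intro M _ _ d hd hp ν
  have hθι : ∀ p, θ (ι p) = p := fun p => congrArg (fun f => f p) hθ
  let _ : Module P' M := Module.compHom M θ
  have hsm : ∀ (p : P') (m : M), p • m = θ p • m := fun _ _ => rfl
  let M' : Submodule P' (M × P') :=
    { carrier := {x | d x.1 = θ x.2}
      add_mem' := by
        intro a b ha hb
        simp only [Set.mem_ofPred_eq, Prod.fst_add, Prod.snd_add, map_add] at *
        rw [ha, hb]
      zero_mem' := by simp
      smul_mem' := by
        intro c x hx
        simp only [Set.mem_ofPred_eq, Prod.smul_fst, Prod.smul_snd, smul_eq_mul, map_mul, hsm,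
          map_smul] at *
        rw [hx] }
  let d' : M' →ₗ[P'] P' := (LinearMap.snd P' M P').comp M'.subtype
  have hd' : ∀ x : M', d' x = x.1.2 := fun _ => rfl
  have hmem : ∀ x : M', d x.1.1 = θ x.1.2 := fun x => x.2
  let ν' : LinearMap.ker d' →ₛₗ[ε'] E :=
    { toFun := fun x => ν ⟨x.1.1.1, by
        have h1 := hmem x.1
        have h2 : x.1.1.2 = 0 := x.2
        rw [h2, map_zero] at h1
        exact h1⟩
      map_add' := by
        intro x y
        rw [← map_add]; rfl
      map_smul' := by
        intro c x
        subst hε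
        rw [RingHom.comp_apply, ← map_smulₛₗ]; rfl }
  obtain ⟨h', hh'⟩ := H M' _ _ d' (by
      subst hJ
      ext y
      constructor
      · rintro ⟨x, rfl⟩
        rw [Ideal.mem_comap, hd', ← hmem, ← hd]
        exact ⟨_, rfl⟩
      · intro hy
        rw [Ideal.mem_comap, ← hd] at hy
        obtain ⟨m, hm⟩ := hy
        exact ⟨⟨(m, y), hm⟩, rfl⟩) (by
      intro x y
      apply Subtype.ext
      apply Prod.ext
      · change d' x • y.1.1 = d' y • x.1.1
        rw [hsm, hsm, hd', hd', ← hmem, ← hmem, hp]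
      · change d' x • y.1.2 = d' y • x.1.2
        rw [hd', hd', smul_eq_mul, smul_eq_mul, mul_comm]) ν'
  refine ⟨{ toFun := fun m => h' ⟨(m, ι (d m)), (hθι _).symm⟩
            map_add' := ?_
            map_smul' := ?_ }, ?_⟩
  · intro x y
    rw [← map_add]
    congr 1
    apply Subtype.ext
    apply Prod.ext
    · rfl
    · change ι (d (x + y)) = ι (d x) + ι (d y)
      simp
  · intro c x
    have : ε c = ε' (ι c) := by rw [hε, RingHom.comp_apply, hθι]
    rw [this, ← map_smulₛₗ]
    congr 1
    apply Subtype.ext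
    apply Prod.ext
    · change c • x = ι c • x
      rw [hsm, hθι]
    · change ι (d (c • x)) = ι c * ι (d x)
      simp
  · intro x
    have hx : d x.1 = 0 := x.2
    change h' ⟨(x.1, ι (d x)), _⟩ = _
    have : (⟨(x.1, ι (d x)), (hθι _).symm⟩ : M') = ⟨(x.1, 0), by
        change d x.1 = θ 0
        rw [hx, map_zero]⟩ := by
      apply Subtype.ext; apply Prod.ext
      · rfl
      · change ι (d x.1) = 0
        rw [hx, map_zero]
    rw [this]
    exact hh' ⟨⟨(x.1, 0), by
        change d x.1 = θ 0
        rw [hx, map_zero]⟩, rfl⟩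

theorem XSplit.of_ringEquiv {P P' : Type u} [CommRing P] [CommRing P'] {E : Type u} [Field E]
    {J : Ideal P} {J' : Ideal P'} {ε : P →+* E} {ε' : P' →+* E} (e : P' ≃+* P)
    (hJ : J' = J.comap e.toRingHom) (hε : ε' = ε.comp e.toRingHom)
    (H : XSplit J' ε') : XSplit J ε :=
  XSplit.retract e.symm.toRingHom e.toRingHom (by ext; simp) hJ hε H

theorem XSplit.comp_quot {P : Type u} [CommRing P] {E : Type u} [Field E]
    {K J : Ideal P} {J1 : Ideal (P ⧸ K)} {ε0 : P ⧸ K →+* E}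
    (hJ : J = J1.comap (Ideal.Quotient.mk K)) (hε : ∀ x ∈ J1, ε0 x = 0)
    (H1 : XSplit K (ε0.comp (Ideal.Quotient.mk K))) (H2 : XSplit J1 ε0) :
    XSplit J (ε0.comp (Ideal.Quotient.mk K)) := by
  set ε := ε0.comp (Ideal.Quotient.mk K) with hεdef
  intro M _ _ d hd hp ν
  have hKJ : K ≤ J := by
    intro x hx
    rw [hJ, Ideal.mem_comap, Ideal.Quotient.eq_zero_iff_mem.mpr hx]
    exact J1.zero_mem
  have hεJ : ∀ x, ε (d x) = 0 := by
    intro x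
    apply hε
    have : d x ∈ J := hd ▸ ⟨x, rfl⟩
    rw [hJ] at this
    exact this
  let MK : Submodule P M := Submodule.comap d K
  have hMK : ∀ m : M, m ∈ MK ↔ d m ∈ K := fun _ => Iff.rfl
  let dK : MK →ₗ[P] P := d.comp MK.subtype
  let νK : LinearMap.ker dK →ₛₗ[ε] E :=
    { toFun := fun x => ν ⟨x.1.1, x.2⟩
      map_add' := fun x y => by rw [← map_add]; rfl
      map_smul' := fun c x => by rw [← map_smulₛₗ]; rfl }
  obtain ⟨h, hh⟩ := H1 MK _ _ dK (by
    ext y; constructor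
    · rintro ⟨x, rfl⟩; exact x.2
    · intro hy
      have := hKJ hy
      rw [← hd] at this
      obtain ⟨m, rfl⟩ := this
      exact ⟨⟨m, hy⟩, rfl⟩) (fun x y => Subtype.ext (hp x y)) νK
  let L : Submodule P M := (LinearMap.ker h).map MK.subtype
  have hL : ∀ m (hm : m ∈ MK), m ∈ L ↔ h ⟨m, hm⟩ = 0 := by
    intro m hm
    constructor
    · rintro ⟨x, hx, rfl⟩; exact hx
    · intro h0; exact ⟨⟨m, hm⟩, h0, rfl⟩
  have hL' : ∀ m : MK, m.1 ∈ L → h m = 0 := fun m hm => (hL m.1 m.2).1 hm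
  have hLMK : L ≤ MK := by rintro _ ⟨x, hx, rfl⟩; exact x.2
  have htors : Module.IsTorsionBySet P (M ⧸ L) (K : Set P) := by
    intro x ⟨k, hk⟩
    obtain ⟨m, rfl⟩ := Submodule.Quotient.mk_surjective L x
    change Submodule.Quotient.mk (k • m) = _
    rw [Submodule.Quotient.mk_eq_zero]
    have := hKJ hk
    rw [← hd] at this
    obtain ⟨x, rfl⟩ := this
    rw [hp]
    have hxK : x ∈ MK := hk
    rw [hL _ (MK.smul_mem _ hxK)]
    change h (d m • ⟨x, hxK⟩) = 0
    rw [map_smulₛₗ, hεJ, zero_smul]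
  let _ : Module (P ⧸ K) (M ⧸ L) := htors.module
  have hsm : ∀ (p : P) (m : M), (Ideal.Quotient.mk K p) • (Submodule.Quotient.mk m : M ⧸ L)
    = Submodule.Quotient.mk (p • m) := fun p m => rfl
  let d0 : M ⧸ L →ₗ[P] P ⧸ K := L.liftQ ((Ideal.Quotient.mkₐ P K).toLinearMap.comp d) (by
    intro m hm
    exact Ideal.Quotient.eq_zero_iff_mem.mpr (hLMK hm))
  have hd0 : ∀ m : M, d0 (Submodule.Quotient.mk m) = Ideal.Quotient.mk K (d m) := fun _ => rfl
  let d1 : M ⧸ L →ₗ[P ⧸ K] P ⧸ K :=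
    { toFun := d0
      map_add' := map_add d0
      map_smul' := by
        intro c x
        obtain ⟨c, rfl⟩ := Ideal.Quotient.mk_surjective c
        obtain ⟨m, rfl⟩ := Submodule.Quotient.mk_surjective L x
        rw [hsm, hd0, hd0, map_smul]
        simp }
  have hd1 : ∀ m : M, d1 (Submodule.Quotient.mk m) = Ideal.Quotient.mk K (d m) := fun _ => rfl
  let hq : (MK.map L.mkQ) →ₛₗ[ε] E :=
    { toFun := fun x => h ⟨x.2.choose, x.2.choose_spec.1⟩
      map_add' := by
        intro x y
        rw [← map_add, ← sub_eq_zero, ← map_sub]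
        refine hL' _ ?_
        rw [← Submodule.Quotient.mk_eq_zero L]
        have h1 := (x + y).2.choose_spec.2
        have h2 := x.2.choose_spec.2
        have h3 := y.2.choose_spec.2
        change L.mkQ (_ - (_ + _)) = 0
        rw [map_sub, map_add, h1, h2, h3]
        simp
      map_smul' := by
        intro c x
        rw [← map_smulₛₗ, ← sub_eq_zero, ← map_sub]
        refine hL' _ ?_
        rw [← Submodule.Quotient.mk_eq_zero L]
        have h1 := (c • x).2.choose_spec.2
        have h2 := x.2.choose_spec.2
        change L.mkQ (_ - c • _) = 0
        rw [map_sub, map_smul, h1, h2]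
        simp }
  have hqh : ∀ m (hm : m ∈ MK), hq ⟨L.mkQ m, m, hm, rfl⟩ = h ⟨m, hm⟩ := by
    intro m hm
    rw [← sub_eq_zero]
    change h _ - h _ = 0
    rw [← map_sub]
    refine hL' _ ?_
    rw [← Submodule.Quotient.mk_eq_zero L]
    have h1 := (⟨L.mkQ m, m, hm, rfl⟩ : MK.map L.mkQ).2.choose_spec.2
    change L.mkQ (_ - _) = 0
    rw [map_sub, h1, sub_self]
  have hker : ∀ x : M ⧸ L, d1 x = 0 → x ∈ MK.map L.mkQ := by
    intro x hx
    obtain ⟨m, rfl⟩ := Submodule.Quotient.mk_surjective L x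
    rw [hd1, Ideal.Quotient.eq_zero_iff_mem] at hx
    exact ⟨m, hx, rfl⟩
  let ν1 : LinearMap.ker d1 →ₛₗ[ε0] E :=
    { toFun := fun x => hq ⟨x.1, hker x.1 x.2⟩
      map_add' := fun x y => by rw [← map_add]; rfl
      map_smul' := by
        intro c x
        obtain ⟨c, rfl⟩ := Ideal.Quotient.mk_surjective c
        change _ = ε c • _
        rw [← map_smulₛₗ]; rfl }
  obtain ⟨g, hg⟩ := H2 (M ⧸ L) _ _ d1 (by
    subst hJ
    ext y; constructor
    · rintro ⟨x, rfl⟩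
      obtain ⟨m, rfl⟩ := Submodule.Quotient.mk_surjective L x
      rw [hd1]
      have : d m ∈ J1.comap (Ideal.Quotient.mk K) := hd ▸ ⟨m, rfl⟩
      exact this
    · intro hy
      obtain ⟨y, rfl⟩ := Ideal.Quotient.mk_surjective y
      have : y ∈ J1.comap (Ideal.Quotient.mk K) := hy
      rw [← hd] at this
      obtain ⟨m, rfl⟩ := this
      exact ⟨Submodule.Quotient.mk m, hd1 m⟩) (by
    intro x y
    obtain ⟨x, rfl⟩ := Submodule.Quotient.mk_surjective L x
    obtain ⟨y, rfl⟩ := Submodule.Quotient.mk_surjective L y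
    rw [hd1, hd1, hsm, hsm, hp]) ν1
  refine ⟨{ toFun := fun m => g (Submodule.Quotient.mk m)
            map_add' := fun x y => by rw [← map_add]; rfl
            map_smul' := fun c x => by
              rw [← hsm, map_smulₛₗ]; rfl }, ?_⟩
  intro x
  have hx : d x.1 = 0 := x.2
  have hxK : x.1 ∈ MK := by rw [hMK, hx]; exact K.zero_mem
  have h2 : d1 (Submodule.Quotient.mk x.1) = 0 := by rw [hd1, hx, map_zero]
  have := hg ⟨Submodule.Quotient.mk x.1, h2⟩
  refine this.trans ?_
  refine (hqh x.1 hxK).trans ?_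
  exact hh ⟨⟨x.1, hxK⟩, hx⟩

/-- General composition. -/
theorem XSplit.comp {P B : Type u} [CommRing P] [CommRing B] {E : Type u} [Field E]
    (π : P →+* B) (hπ : Function.Surjective π) {J1 : Ideal B} {ε0 : B →+* E}
    (hε : ∀ x ∈ J1, ε0 x = 0)
    (H1 : XSplit (RingHom.ker π) (ε0.comp π)) (H2 : XSplit J1 ε0) :
    XSplit (J1.comap π) (ε0.comp π) := by
  let e : P ⧸ RingHom.ker π ≃+* B := RingHom.quotientKerEquivOfSurjective hπ
  have he : e.toRingHom.comp (Ideal.Quotient.mk (RingHom.ker π)) = π := by ext; rfl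
  have key := XSplit.comp_quot (K := RingHom.ker π) (J := J1.comap π)
    (J1 := J1.comap e.toRingHom) (ε0 := ε0.comp e.toRingHom)
    (by rw [Ideal.comap_comap, he]) (fun x hx => hε _ hx)
    (by rw [RingHom.comp_assoc, he]; exact H1)
    (XSplit.of_ringEquiv e.symm (by
        rw [Ideal.comap_comap]
        have : e.toRingHom.comp e.symm.toRingHom = RingHom.id B := by ext; simp
        rw [this]; rfl) (by
        rw [RingHom.comp_assoc]
        have : e.toRingHom.comp e.symm.toRingHom = RingHom.id B := by ext; simp
        rw [this]; rfl) H2)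
  rw [RingHom.comp_assoc, he] at key
  exact key

end

section
open TensorProduct IsLocalRing

theorem peiffer_syz {P : Type*} [CommRing P] {M : Type*} [AddCommGroup M] [Module P M]
    (d : M →ₗ[P] P) (hp : ∀ x y, d x • y = d y • x) (x : ℕ → M) (n : ℕ)
    (hreg : ∀ i < n, ∀ a : P, a * d (x i) ∈ Ideal.span ((fun j => d (x j)) '' Set.Iio i) →
      a ∈ Ideal.span ((fun j => d (x j)) '' Set.Iio i)) (a : ℕ → P)
    (h : ∑ i ∈ Finset.range n, a i * d (x i) = 0) :
    ∑ i ∈ Finset.range n, a i • x i = 0 := by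
  induction n generalizing a with
  | zero => simp
  | succ n ih =>
    rw [Finset.sum_range_succ] at h ⊢
    have h1 : a n ∈ Ideal.span ((fun j => d (x j)) '' Set.Iio n) := by
      apply hreg n (Nat.lt_succ_self n)
      rw [eq_neg_of_add_eq_zero_right h]
      apply neg_mem
      apply Ideal.sum_mem
      intro i hi
      apply Ideal.mul_mem_left
      exact Ideal.subset_span ⟨i, Finset.mem_range.1 hi, rfl⟩
    have h2 : ∃ b : ℕ → P, a n = ∑ i ∈ Finset.range n, b i * d (x i) := by
      have : ((fun j => d (x j)) '' Set.Iio n) = ((fun j => d (x j)) '' (Finset.range n : Set ℕ)) := by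
        congr 1; ext; simp
      rw [this] at h1
      obtain ⟨b, hb⟩ := (Submodule.mem_span_image_finset_iff_exists_fun P).1 h1
      refine ⟨fun i => if h : i ∈ Finset.range n then b ⟨i, h⟩ else 0, ?_⟩
      rw [← hb, ← Finset.sum_attach (Finset.range n)]
      apply Finset.sum_congr rfl
      intro i _
      simp only [smul_eq_mul]
      rw [dif_pos i.2]
    obtain ⟨b, hb⟩ := h2
    have h3 := ih (fun i hi => hreg i (Nat.lt_succ_of_lt hi)) (fun i => a i + b i * d (x n)) (by
      rw [← h, hb, Finset.sum_mul, ← Finset.sum_add_distrib]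
      apply Finset.sum_congr rfl
      intros; ring)
    rw [← h3, hb, Finset.sum_smul, ← Finset.sum_add_distrib]
    apply Finset.sum_congr rfl
    intro i _
    rw [add_smul, mul_smul, mul_smul, hp]

/-- If relations lift trivially, the crossed module splits. -/
theorem XSplit.of_syz {P : Type u} [CommRing P] {E : Type u} [Field E] {J : Ideal P}
    (ε : P →+* E) {ι : Type*} (y : ι → P) (hy : Ideal.span (Set.range y) = J)
    (H : ∀ (M : Type u) (_ : AddCommGroup M) (_ : Module P M) (d : M →ₗ[P] P)
      (_ : ∀ x y, d x • y = d y • x) (x : ι → M) (_ : ∀ i, d (x i) = y i) (a : ι →₀ P),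
      Finsupp.linearCombination P y a = 0 → Finsupp.linearCombination P x a = 0) :
    XSplit J ε := by
  intro M _ _ d hd hp ν
  have hx : ∀ i, ∃ x, d x = y i := by
    intro i
    have : y i ∈ J := hy ▸ Ideal.subset_span ⟨i, rfl⟩
    rw [← hd] at this
    exact this
  choose x hx using hx
  have hdx : ∀ a : ι →₀ P, d (Finsupp.linearCombination P x a) = Finsupp.linearCombination P y a := by
    intro a
    rw [Finsupp.apply_linearCombination]
    congr 2
    funext i
    exact hx i
  let X : Submodule P M := Submodule.span P (Set.range x)
  have hX : ∀ m ∈ X, ∃ a : ι →₀ P, Finsupp.linearCombination P x a = m := fun m hm =>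
    (Finsupp.mem_span_range_iff_exists_finsupp (R := P)).1 hm
  have hc : IsCompl (LinearMap.ker d) X := by
    constructor
    · rw [Submodule.disjoint_def]
      intro m hm hmX
      obtain ⟨a, rfl⟩ := hX m hmX
      apply H M _ _ d hp x hx
      rw [← hdx]; exact hm
    · rw [codisjoint_iff, eq_top_iff]
      intro m _
      have : d m ∈ Ideal.span (Set.range y) := by rw [hy, ← hd]; exact ⟨m, rfl⟩
      obtain ⟨a, ha⟩ := (Finsupp.mem_span_range_iff_exists_finsupp (R := P)).1 this
      have h2 : m = (m - Finsupp.linearCombination P x a) + Finsupp.linearCombination P x a := by simp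
      rw [h2]
      apply Submodule.add_mem_sup
      · rw [LinearMap.mem_ker, map_sub, hdx, sub_eq_zero, ← ha]; rfl
      · exact (Finsupp.mem_span_range_iff_exists_finsupp (R := P)).2 ⟨a, rfl⟩
  let pr := Submodule.projectionOnto _ _ hc
  refine ⟨{ toFun := fun m => ν (pr m)
            map_add' := fun a b => by rw [map_add, map_add]
            map_smul' := fun c a => by rw [map_smul, map_smulₛₗ] }, ?_⟩
  intro m
  change ν (pr m) = ν m
  congr 1
  exact Submodule.projectionOnto_apply_left hc m

open RingTheory.Sequence in
/-- Regular sequences give the successive regularity condition. -/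
theorem isWeaklyRegular_succ_mem {P : Type*} [CommRing P] {rs : List P}
    (h : IsWeaklyRegular P rs) (i : ℕ) (hi : i < rs.length) (a : P)
    (ha : a * rs.getD i 0 ∈ Ideal.span ((fun j => rs.getD j 0) '' Set.Iio i)) :
    a ∈ Ideal.span ((fun j => rs.getD j 0) '' Set.Iio i) := by
  have hE : Ideal.span ((fun j => rs.getD j 0) '' Set.Iio i) = Ideal.ofList (rs.take i) := by
    unfold Ideal.ofList
    congr 1
    ext z
    simp only [Set.mem_image, Set.mem_Iio, List.mem_take_iff_getElem]
    constructor
    · rintro ⟨j, hj, rfl⟩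
      exact ⟨j, by omega, by rw [List.getD_eq_getElem _ _ (by omega)]⟩
    · rintro ⟨j, hj, rfl⟩
      exact ⟨j, by omega, by rw [List.getD_eq_getElem _ _ (by omega)]⟩
  rw [hE] at ha ⊢
  have h1 := h.regular_mod_prev i hi
  have h2 : ((Ideal.ofList (rs.take i)) • (⊤ : Submodule P P)) = Ideal.ofList (rs.take i) := by
    simp
  have := @h1 (Submodule.Quotient.mk a) (Submodule.Quotient.mk 0) (by
    simp only [← Submodule.Quotient.mk_smul]
    rw [Submodule.Quotient.eq, h2]
    rw [List.getD_eq_getElem _ _ hi] at ha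
    simpa [mul_comm] using ha)
  rw [Submodule.Quotient.eq, h2] at this
  simpa using this

open RingTheory.Sequence in
theorem peiffer_syz_list {P : Type*} [CommRing P] {M : Type*} [AddCommGroup M] [Module P M]
    (d : M →ₗ[P] P) (hp : ∀ x y, d x • y = d y • x) (rs : List P) (hrs : IsWeaklyRegular P rs)
    (x : Fin rs.length → M) (hx : ∀ i, d (x i) = rs.get i) (a : Fin rs.length → P)
    (h : ∑ i, a i * rs.get i = 0) : ∑ i, a i • x i = 0 := by
  let x' : ℕ → M := fun i => if h : i < rs.length then x ⟨i, h⟩ else 0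
  let a' : ℕ → P := fun i => if h : i < rs.length then a ⟨i, h⟩ else 0
  have hx' : ∀ j, d (x' j) = rs.getD j 0 := by
    intro j
    by_cases hj : j < rs.length
    · simp only [x', hj, dif_pos, hx, List.getD_eq_getElem _ _ hj]; rfl
    · simp only [x', hj, dif_neg, not_false_iff, map_zero]
      rw [List.getD_eq_default _ _ (by omega)]
  have key := peiffer_syz d hp x' rs.length (by
    intro i hi a ha
    simp only [hx'] at ha ⊢
    exact isWeaklyRegular_succ_mem hrs i hi a ha) a' (by
    rw [Finset.sum_range, ← h]
    apply Finset.sum_congr rfl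
    intro i _
    rw [hx']
    simp [a'])
  rw [Finset.sum_range] at key
  rw [← key]
  apply Finset.sum_congr rfl
  intro i _
  simp [a', x']

open RingTheory.Sequence in
theorem XSplit.of_regular {P : Type u} [CommRing P] {E : Type u} [Field E] {J : Ideal P}
    (ε : P →+* E) (hJ : GeneratedByRegularSequence P J) : XSplit J ε := by
  obtain ⟨rs, hrs, hs⟩ := hJ
  refine XSplit.of_syz ε (rs.get) (by rw [← hs]; congr 1; ext z; simp [List.mem_iff_get]) ?_
  intro M _ _ d hp x hx a h
  rw [Finsupp.linearCombination_apply, Finsupp.sum_fintype _ _ (by simp)] at h ⊢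
  exact peiffer_syz_list d hp rs hrs.toIsWeaklyRegular x hx a (by simpa using h)

theorem XSplit.of_X {A : Type u} [CommRing A] {Y : Type u} {E : Type u} [Field E]
    (ε : MvPolynomial Y A →+* E) : XSplit (Ideal.span (Set.range (MvPolynomial.X (R := A) (σ := Y)))) ε := by
  classical
  refine XSplit.of_syz ε (MvPolynomial.X (R := A) (σ := Y)) rfl ?_
  intro M _ _ d hp x hx a h
  let l := a.support.toList
  by_cases hE : IsEmpty Y
  · have : a = 0 := Subsingleton.elim _ _
    rw [this, map_zero]
  obtain ⟨y0⟩ := not_isEmpty_iff.1 hE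
  have hnd : l.Nodup := Finset.nodup_toList _
  have hsum : ∀ {N : Type u} [AddCommGroup N] [Module (MvPolynomial Y A) N] (v : Y → N),
      Finsupp.linearCombination (MvPolynomial Y A) v a =
      ∑ i ∈ Finset.range l.length, a (l.getD i y0) • v (l.getD i y0) := by
    intro N _ _ v
    rw [Finsupp.linearCombination_apply, Finsupp.sum, ← Finset.sum_map_toList,
      Finset.sum_range, ← List.sum_ofFn]
    congr 1
    apply List.ext_getElem
    · simp [l]
    · intro n h1 h2
      simp [l] at h1 h2 ⊢

  rw [hsum] at h ⊢
  refine peiffer_syz d hp (fun i => x (l.getD i y0)) l.length ?_ (fun i => a (l.getD i y0)) (by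
    simpa [hx] using h)
  intro i hi b hb
  simp only [hx] at hb ⊢
  have : (fun j => MvPolynomial.X (l.getD j y0)) '' Set.Iio i =
      (MvPolynomial.X (R := A)) '' ((fun j => l.getD j y0) '' Set.Iio i) := by
    rw [Set.image_image]
  rw [this] at hb ⊢
  rw [MvPolynomial.mem_ideal_span_X_image] at hb ⊢
  intro m hm
  obtain ⟨k, hk, hk2⟩ := hb (m + Finsupp.single (l.getD i y0) 1) (by
    rw [MvPolynomial.mem_support_iff, MvPolynomial.coeff_mul_X]
    rwa [MvPolynomial.mem_support_iff] at hm)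
  refine ⟨k, hk, ?_⟩
  obtain ⟨j, hj, rfl⟩ := hk
  have hji : l.getD j y0 ≠ l.getD i y0 := by
    have hj' : j < i := hj
    rw [List.getD_eq_getElem _ _ hi, List.getD_eq_getElem _ _ (hj'.trans hi)]
    intro hh
    have := (hnd.getElem_inj_iff).1 hh
    omega
  rw [Finsupp.add_apply, Finsupp.single_apply, if_neg hji.symm, add_zero] at hk2
  exact hk2

theorem XSplit.of_aeval {A : Type u} [CommRing A] {Y : Type u} {E : Type u} [Field E]
    (p : Y → A) (ε : A →+* E) :
    XSplit (RingHom.ker (MvPolynomial.aeval p : MvPolynomial Y A →ₐ[A] A).toRingHom)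
      (ε.comp (MvPolynomial.aeval p : MvPolynomial Y A →ₐ[A] A).toRingHom) := by
  let e : MvPolynomial Y A ≃ₐ[A] MvPolynomial Y A := AlgEquiv.ofAlgHom
    (MvPolynomial.aeval fun y => MvPolynomial.X y - MvPolynomial.C (p y))
    (MvPolynomial.aeval fun y => MvPolynomial.X y + MvPolynomial.C (p y))
    (by ext y; simp [MvPolynomial.algebraMap_eq]) (by ext y; simp [MvPolynomial.algebraMap_eq])
  refine XSplit.of_ringEquiv e.toRingEquiv (J' := Ideal.span (Set.range (MvPolynomial.X (R := A) (σ := Y))))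
    ?_ rfl (XSplit.of_X _)
  have : Ideal.span (Set.range (MvPolynomial.X (R := A) (σ := Y))) =
      RingHom.ker (MvPolynomial.constantCoeff (R := A) (σ := Y)) := by
    ext q
    rw [← Set.image_univ, MvPolynomial.mem_ideal_span_X_image, RingHom.mem_ker,
      MvPolynomial.constantCoeff_eq]
    constructor
    · intro h
      by_contra hc
      obtain ⟨i, -, hi⟩ := h 0 (MvPolynomial.mem_support_iff.2 hc)
      simp at hi
    · intro h m hm
      by_contra hc
      push Not at hc
      have : m = 0 := by ext i; simpa using hc i
      rw [this, MvPolynomial.mem_support_iff] at hm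
      exact hm h
  rw [this]
  ext q
  rw [Ideal.mem_comap, RingHom.mem_ker, RingHom.mem_ker]
  have h2 : (MvPolynomial.aeval p : MvPolynomial Y A →ₐ[A] A).comp e.toAlgHom =
    MvPolynomial.aeval (fun _ => 0) := by
    ext y
    simp [e]
  have h3 := congrArg (fun f => f q) h2
  simp only [MvPolynomial.aeval_zero', AlgHom.comp_apply] at h3
  change _ ↔ (MvPolynomial.aeval p) (e q) = 0
  rw [show (MvPolynomial.aeval p) (e q) = _ from h3]
  rfl

end

section
open TensorProduct IsLocalRing

theorem lTensor_inj_of_rTensor_inj {A0 P E X Y : Type*} [CommRing A0] [CommRing P] [Algebra A0 P]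
    [CommRing E] [Algebra A0 E]
    [AddCommGroup X] [Module P X] [Module A0 X] [IsScalarTower A0 P X]
    [AddCommGroup Y] [Module P Y] [Module A0 Y] [IsScalarTower A0 P Y] (f : X →ₗ[P] Y)
    (h : Function.Injective ((f.restrictScalars A0).lTensor E)) :
    Function.Injective (f.lTensor (P ⊗[A0] E)) := by
  let eX := (TensorProduct.comm P (P ⊗[A0] E) X).trans
    (TensorProduct.AlgebraTensorModule.cancelBaseChange A0 P P X E)
  let eY := (TensorProduct.comm P (P ⊗[A0] E) Y).trans
    (TensorProduct.AlgebraTensorModule.cancelBaseChange A0 P P Y E)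
  have h' : Function.Injective ((f.restrictScalars A0).rTensor E) := by
    rwa [LinearMap.lTensor_inj_iff_rTensor_inj] at h
  have hsq : ∀ z, eY (f.lTensor (P ⊗[A0] E) z) = (f.restrictScalars A0).rTensor E (eX z) := by
    intro z
    induction z with
    | zero => simp
    | add a b ha hb => simp only [map_add, ha, hb]
    | tmul a x =>
      induction a with
      | zero => simp
      | add a b ha hb => simp only [TensorProduct.add_tmul, map_add, ha, hb]
      | tmul p e =>
        simp [eX, eY]
  intro a b hab
  apply eX.injective
  apply h'
  rw [← hsq, ← hsq, hab]

theorem flat_of_exact {A0 N1 N2 N3 : Type u} [CommRing A0] [AddCommGroup N1] [Module A0 N1]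
    [AddCommGroup N2] [Module A0 N2] [AddCommGroup N3] [Module A0 N3] [Module.Flat A0 N2]
    [Module.Flat A0 N3] (f : N1 →ₗ[A0] N2) (g : N2 →ₗ[A0] N3) (hf : Function.Injective f)
    (hg : Function.Surjective g) (H : Function.Exact f g) : Module.Flat A0 N1 := by
  rw [Module.Flat.iff_rTensor_preserves_injective_linearMap]
  intro U V _ _ _ _ j hj
  have h1 : Function.Injective (f.lTensor U) :=
    LinearMap.lTensor_injective_of_exact_of_flat g hg f hf H U
  have h2 : Function.Injective (j.rTensor N2) :=
    Module.Flat.rTensor_preserves_injective_linearMap j hj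
  have h3 : (f.lTensor V) ∘ₗ (j.rTensor N1) = (j.rTensor N2) ∘ₗ (f.lTensor U) := by
    rw [LinearMap.lTensor_comp_rTensor, LinearMap.rTensor_comp_lTensor]
  have h4 : Function.Injective ((f.lTensor V) ∘ₗ (j.rTensor N1)) := by
    rw [h3]; exact h2.comp h1
  exact Function.Injective.of_comp h4

theorem XSplit.flat_base_change {A0 P E : Type u} [CommRing A0] [CommRing P] [Algebra A0 P]
    [Field E] [Algebra A0 E] [Module.Flat A0 P] (J : Ideal P) [Module.Flat A0 (P ⧸ J)]
    (ε : P →+* E) (ε' : P ⊗[A0] E →+* E) (hε : ε = ε'.comp (algebraMap P (P ⊗[A0] E)))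
    (H : XSplit (J.map (algebraMap P (P ⊗[A0] E))) ε') : XSplit J ε := by
  have hε' : ∀ r, ε' (algebraMap P (P ⊗[A0] E) r) = ε r := fun r => by rw [hε]; rfl
  intro M _ _ d hd hp ν
  let _ : Module A0 M := Module.compHom M (algebraMap A0 P)
  have _ : IsScalarTower A0 P M := IsScalarTower.of_algebraMap_smul fun _ _ => rfl
  let P' := P ⊗[A0] E
  let d' : P' ⊗[P] M →ₗ[P'] P' :=
    (TensorProduct.AlgebraTensorModule.rid P P' P').toLinearMap.comp (LinearMap.baseChange P' d)
  have hd' : ∀ (a : P') (m : M), d' (a ⊗ₜ m) = d m • a := fun a m => by simp [d']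
  let K := LinearMap.ker d
  let dJ : M →ₗ[P] J := d.codRestrict J (fun m => hd ▸ ⟨m, rfl⟩)
  have hdJs : Function.Surjective dJ := by
    rintro ⟨y, hy⟩
    rw [← hd] at hy
    obtain ⟨m, hm⟩ := hy
    exact ⟨m, Subtype.ext hm⟩
  have hex : Function.Exact K.subtype dJ := by
    intro m
    simp [K, dJ, Subtype.ext_iff]
  have hJf : Module.Flat A0 J :=
    flat_of_exact (J.subtype.restrictScalars A0) ((Ideal.Quotient.mkₐ A0 J).toLinearMap)
      J.injective_subtype Ideal.Quotient.mk_surjective (by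
        intro x
        simp [Ideal.Quotient.eq_zero_iff_mem])
  have hinjJ : Function.Injective ((J.subtype : J →ₗ[P] P).lTensor P') := by
    apply lTensor_inj_of_rTensor_inj
    exact LinearMap.lTensor_injective_of_exact_of_flat ((Ideal.Quotient.mkₐ A0 J).toLinearMap)
      Ideal.Quotient.mk_surjective _ J.injective_subtype (by
        intro x
        simp [Ideal.Quotient.eq_zero_iff_mem]) E
  have hinjK : Function.Injective (K.subtype.lTensor P') := by
    apply lTensor_inj_of_rTensor_inj
    exact LinearMap.lTensor_injective_of_exact_of_flat (dJ.restrictScalars A0)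
      hdJs _ K.injective_subtype (by exact hex) E
  have hexT := lTensor_exact P' hex hdJs
  have hker : ∀ z, d' z = 0 → z ∈ Set.range (K.subtype.lTensor P') := by
    intro z hz
    rw [← hexT]
    apply hinjJ
    rw [map_zero, ← LinearMap.comp_apply, ← LinearMap.lTensor_comp]
    have : J.subtype ∘ₗ dJ = d := rfl
    rw [this]
    apply (TensorProduct.AlgebraTensorModule.rid P P' P').injective
    rw [map_zero]
    exact hz
  have hker2 : ∀ z, d' (K.subtype.lTensor P' z) = 0 := by
    intro z
    induction z with
    | zero => simp
    | add a b ha hb => simp only [map_add, ha, hb, add_zero]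
    | tmul a k =>
      rw [LinearMap.lTensor_tmul, hd']
      have : d (K.subtype k) = 0 := k.2
      rw [this, zero_smul]
  let ν0 : P' ⊗[P] K →+ E := TensorProduct.liftAddHom
    { toFun := fun a =>
        { toFun := fun k => ε' a * ν k
          map_zero' := by simp
          map_add' := by intros; simp [mul_add] }
      map_zero' := by ext; simp
      map_add' := by intros; ext; simp [add_mul] } (by
      intro r a k
      change ε' (r • a) * ν k = ε' a * ν (r • k)
      have e1 : ν (r • k) = ε r * ν k := map_smulₛₗ ν r k
      rw [e1, Algebra.smul_def, map_mul, hε', ← mul_assoc, mul_comm (ε r)])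
  have hν0 : ∀ (a : P') (k : K), ν0 (a ⊗ₜ k) = ε' a * ν k := fun a k => rfl
  have hν0s : ∀ (c : P') z, ν0 (c • z) = ε' c * ν0 z := by
    intro c z
    induction z with
    | zero => simp
    | add a b ha hb => simp only [smul_add, map_add, ha, hb, mul_add]
    | tmul a k => rw [TensorProduct.smul_tmul', hν0, hν0, smul_eq_mul, map_mul, mul_assoc]
  have hsub : ∀ (c : P') z, K.subtype.lTensor P' (c • z) = c • K.subtype.lTensor P' z := by
    intro c z
    exact map_smul (LinearMap.baseChange P' K.subtype) c z
  let ν' : LinearMap.ker d' →ₛₗ[ε'] E :=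
    { toFun := fun z => ν0 (hker z.1 z.2).choose
      map_add' := by
        intro x y
        rw [← map_add]
        congr 1
        apply hinjK
        rw [map_add, (hker x.1 x.2).choose_spec, (hker y.1 y.2).choose_spec,
          (hker (x + y).1 (x + y).2).choose_spec]
        rfl
      map_smul' := by
        intro c x
        rw [smul_eq_mul, ← hν0s]
        congr 1
        apply hinjK
        rw [hsub, (hker x.1 x.2).choose_spec,
          (hker (c • x).1 (c • x).2).choose_spec]
        rfl }
  obtain ⟨h, hh⟩ := H (P' ⊗[P] M) _ _ d' (by
    apply le_antisymm
    · rintro _ ⟨z, rfl⟩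
      induction z with
      | zero => simp
      | add a b ha hb => rw [map_add]; exact add_mem ha hb
      | tmul a m =>
        rw [hd', Algebra.smul_def]
        exact Ideal.mul_mem_right _ _ (Ideal.mem_map_of_mem _ (hd ▸ ⟨m, rfl⟩))
    · change Submodule.span _ _ ≤ _
      rw [Submodule.span_le]
      rintro _ ⟨y, hy, rfl⟩
      rw [SetLike.mem_coe, ← hd] at hy
      obtain ⟨m, rfl⟩ := hy
      exact ⟨1 ⊗ₜ m, by rw [hd', Algebra.smul_def, mul_one]⟩) (by
    intro x y
    induction x with
    | zero => simp
    | add a b ha hb => simp only [smul_add, map_add, ha, hb, add_smul]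
    | tmul a m =>
      induction y with
      | zero => simp
      | add a b ha hb => simp only [smul_add, map_add, ha, hb, add_smul]
      | tmul b n =>
        rw [hd', hd', TensorProduct.smul_tmul', TensorProduct.smul_tmul', smul_eq_mul, smul_eq_mul,
          smul_mul_assoc, smul_mul_assoc, TensorProduct.smul_tmul, TensorProduct.smul_tmul, hp,
          mul_comm]) ν'
  refine ⟨{ toFun := fun m => h (1 ⊗ₜ m)
            map_add' := fun x y => by rw [TensorProduct.tmul_add, map_add]
            map_smul' := fun c x => by
              have : (1 : P') ⊗ₜ[P] (c • x) = (algebraMap P P' c) • ((1 : P') ⊗ₜ[P] x) := by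
                rw [TensorProduct.tmul_smul, algebraMap_smul]
              rw [this, map_smulₛₗ, hε'] }, ?_⟩
  intro k
  have hz : d' (1 ⊗ₜ k.1) = 0 := hker2 (1 ⊗ₜ k)
  refine (hh ⟨1 ⊗ₜ k.1, hz⟩).trans ?_
  change ν0 _ = _
  have : (hker _ hz).choose = 1 ⊗ₜ k := by
    apply hinjK
    rw [(hker _ hz).choose_spec]
    rfl
  rw [this, hν0, map_one, one_mul]

end

section
open TensorProduct IsLocalRing
set_option linter.all false

section derE
variable {A E V : Type*} [CommRing A] [Field E]

open MvPolynomial in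
/-- Derivation with prescribed values on variables. -/
noncomputable def derE (η : MvPolynomial V A →+* E) (s : V → E) (p : MvPolynomial V A) : E :=
  ∑ w ∈ p.vars, η (pderiv w p) * s w

open MvPolynomial in
theorem derE_eq (η : MvPolynomial V A →+* E) (s : V → E) (p : MvPolynomial V A) (T : Finset V)
    (hT : p.vars ⊆ T) : derE η s p = ∑ w ∈ T, η (pderiv w p) * s w := by
  unfold derE
  refine Finset.sum_subset hT ?_
  intro w _ hw
  rw [pderiv_eq_zero_of_notMem_vars hw, map_zero, zero_mul]

open MvPolynomial in
theorem derE_C (η : MvPolynomial V A →+* E) (s : V → E) (a : A) : derE η s (C a) = 0 := by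
  simp [derE]

open MvPolynomial in
theorem derE_X (η : MvPolynomial V A →+* E) (s : V → E) (v : V) : derE η s (X v) = s v := by
  classical
  rcases subsingleton_or_nontrivial A with hA | hA
  · exact absurd ((Subsingleton.elim (1 : MvPolynomial V A) 0) ▸ map_one η) (by simp)
  rw [derE_eq η s (X v) {v} (by rw [vars_X])]
  simp [pderiv_X]

open MvPolynomial in
theorem derE_add (η : MvPolynomial V A →+* E) (s : V → E) (p q : MvPolynomial V A) :
    derE η s (p + q) = derE η s p + derE η s q := by
  classical
  rw [derE_eq η s (p + q) (p.vars ∪ q.vars) (vars_add_subset _ _),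
    derE_eq η s p (p.vars ∪ q.vars) Finset.subset_union_left,
    derE_eq η s q (p.vars ∪ q.vars) Finset.subset_union_right, ← Finset.sum_add_distrib]
  apply Finset.sum_congr rfl
  intro w _
  rw [map_add, map_add, add_mul]

open MvPolynomial in
theorem derE_mul (η : MvPolynomial V A →+* E) (s : V → E) (p q : MvPolynomial V A) :
    derE η s (p * q) = η p * derE η s q + η q * derE η s p := by
  classical
  rw [derE_eq η s (p * q) (p.vars ∪ q.vars) (vars_mul _ _),
    derE_eq η s p (p.vars ∪ q.vars) Finset.subset_union_left,
    derE_eq η s q (p.vars ∪ q.vars) Finset.subset_union_right, Finset.mul_sum, Finset.mul_sum,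
    ← Finset.sum_add_distrib]
  apply Finset.sum_congr rfl
  intro w _
  rw [pderiv_mul, map_add, map_mul, map_mul]
  ring

open MvPolynomial in
theorem derE_unique (η : MvPolynomial V A →+* E) (s : V → E) (f : MvPolynomial V A → E)
    (hC : ∀ a, f (C a) = 0) (hadd : ∀ p q, f (p + q) = f p + f q)
    (hmul : ∀ p v, f (p * X v) = η p * s v + η (X v) * f p) (p) :
    f p = derE η s p := by
  induction p using MvPolynomial.induction_on with
  | C a => rw [hC, derE_C]
  | add p q hp hq => rw [hadd, derE_add, hp, hq]
  | mul_X p v h => rw [hmul, derE_mul, derE_X, h]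

open MvPolynomial in
theorem derE_sub_fun (η : MvPolynomial V A →+* E) (s t : V → E) (p : MvPolynomial V A) :
    derE η (fun v => s v - t v) p = derE η s p - derE η t p := by
  simp only [derE, mul_sub, Finset.sum_sub_distrib]

open MvPolynomial in
theorem derE_zero (η : MvPolynomial V A →+* E) (s : V → E) : derE η s 0 = 0 := by
  simp [derE]

open MvPolynomial in
theorem derE_neg (η : MvPolynomial V A →+* E) (s : V → E) (p : MvPolynomial V A) :
    derE η s (-p) = - derE η s p := by
  have := derE_add η s p (-p)
  rw [add_neg_cancel, derE_zero] at this
  rw [eq_neg_iff_add_eq_zero, add_comm]; exact this.symm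

open MvPolynomial in
theorem derE_sub (η : MvPolynomial V A →+* E) (s : V → E) (p q : MvPolynomial V A) :
    derE η s (p - q) = derE η s p - derE η s q := by
  rw [sub_eq_add_neg, derE_add, derE_neg, ← sub_eq_add_neg]

end derE

section cocycle
open MvPolynomial
variable (A B : Type u) [CommRing A] [CommRing B] [Algebra A B] {E : Type u} [Field E]
  (ε : B →+* E)

/-- augmentations and faces -/
noncomputable abbrev q0 : MvPolynomial B A →ₐ[A] B := aeval (id : B → B)
noncomputable abbrev q1 : MvPolynomial (MvPolynomial B A) A →ₐ[A] B := aeval (fun v => q0 A B v)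
noncomputable abbrev q2 : MvPolynomial (MvPolynomial (MvPolynomial B A) A) A →ₐ[A] B :=
  aeval (fun v => q1 A B v)
noncomputable abbrev fev : MvPolynomial (MvPolynomial B A) A →ₐ[A] MvPolynomial B A := aeval id
noncomputable abbrev fren : MvPolynomial (MvPolynomial B A) A →ₐ[A] MvPolynomial B A :=
  rename (q0 A B)
noncomputable abbrev fev' : MvPolynomial (MvPolynomial (MvPolynomial B A) A) A →ₐ[A]
  MvPolynomial (MvPolynomial B A) A := aeval id
noncomputable abbrev gev : MvPolynomial (MvPolynomial (MvPolynomial B A) A) A →ₐ[A]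
  MvPolynomial (MvPolynomial B A) A := rename (fev A B)
noncomputable abbrev gren : MvPolynomial (MvPolynomial (MvPolynomial B A) A) A →ₐ[A]
  MvPolynomial (MvPolynomial B A) A := rename (fren A B)
noncomputable abbrev sdeg : MvPolynomial B A →ₐ[A] MvPolynomial (MvPolynomial B A) A :=
  rename X

noncomputable abbrev η1 : MvPolynomial (MvPolynomial B A) A →+* E := ε.comp (q1 A B).toRingHom
noncomputable abbrev η2 : MvPolynomial (MvPolynomial (MvPolynomial B A) A) A →+* E :=
  ε.comp (q2 A B).toRingHom

def IsCocyc (D : MvPolynomial (MvPolynomial B A) A → E) : Prop :=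
  ∀ z, derE (η2 A B ε) D z = D (fev' A B z) - D (gev A B z) + D (gren A B z)

noncomputable def cobd (ψ : MvPolynomial B A → E) (v : MvPolynomial (MvPolynomial B A) A) : E :=
  derE (η1 A B ε) ψ v - ψ (fev A B v) + ψ (fren A B v)

variable {A B}

theorem q0_fev (v) : q0 A B (fev A B v) = q1 A B v := by
  have : (q0 A B).comp (fev A B) = q1 A B := by
    apply MvPolynomial.algHom_ext
    intro v
    simp only [AlgHom.comp_apply, aeval_X, rename_X, id]
  exact congrArg (fun f => f v) this
theorem q0_fren (v) : q0 A B (fren A B v) = q1 A B v := by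
  have : (q0 A B).comp (fren A B) = q1 A B := by
    apply MvPolynomial.algHom_ext
    intro v
    simp only [AlgHom.comp_apply, aeval_X, rename_X, id]
  exact congrArg (fun f => f v) this
theorem fev_fev' (z) : fev A B (fev' A B z) = fev A B (gev A B z) := by
  have : (fev A B).comp (fev' A B) = (fev A B).comp (gev A B) := by
    apply MvPolynomial.algHom_ext
    intro v
    simp only [AlgHom.comp_apply, aeval_X, rename_X, id]
  exact congrArg (fun f => f z) this
theorem fren_fev' (z) : fren A B (fev' A B z) = fev A B (gren A B z) := by
  have : (fren A B).comp (fev' A B) = (fev A B).comp (gren A B) := by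
    apply MvPolynomial.algHom_ext
    intro v
    simp only [AlgHom.comp_apply, aeval_X, rename_X, id]
  exact congrArg (fun f => f z) this
theorem fren_gev (z) : fren A B (gev A B z) = fren A B (gren A B z) := by
  have : (fren A B).comp (gev A B) = (fren A B).comp (gren A B) := by
    apply MvPolynomial.algHom_ext
    intro v
    simp only [AlgHom.comp_apply, rename_X, q0_fev, q0_fren]
  exact congrArg (fun f => f z) this
theorem q1_fev' (z) : q1 A B (fev' A B z) = q2 A B z := by
  have : (q1 A B).comp (fev' A B) = q2 A B := by
    apply MvPolynomial.algHom_ext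
    intro v
    simp only [AlgHom.comp_apply, aeval_X, id]
  exact congrArg (fun f => f z) this
theorem q1_gev (z) : q1 A B (gev A B z) = q2 A B z := by
  have : (q1 A B).comp (gev A B) = q2 A B := by
    apply MvPolynomial.algHom_ext
    intro v
    simp only [AlgHom.comp_apply, aeval_X, rename_X, q0_fev]
  exact congrArg (fun f => f z) this
theorem q1_gren (z) : q1 A B (gren A B z) = q2 A B z := by
  have : (q1 A B).comp (gren A B) = q2 A B := by
    apply MvPolynomial.algHom_ext
    intro v
    simp only [AlgHom.comp_apply, aeval_X, rename_X, q0_fren]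
  exact congrArg (fun f => f z) this
theorem fev_sdeg (p) : fev A B (sdeg A B p) = p := by
  have : (fev A B).comp (sdeg A B) = AlgHom.id A _ := by
    apply MvPolynomial.algHom_ext
    intro v
    simp only [AlgHom.comp_apply, AlgHom.id_apply, aeval_X, rename_X, id]
  exact congrArg (fun f => f p) this
theorem fren_sdeg (p) : fren A B (sdeg A B p) = p := by
  have : (fren A B).comp (sdeg A B) = AlgHom.id A _ := by
    apply MvPolynomial.algHom_ext
    intro v
    simp only [AlgHom.comp_apply, AlgHom.id_apply, aeval_X, rename_X, id]
  exact congrArg (fun f => f p) this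

theorem cobd_isCocyc (ψ : MvPolynomial B A → E) : IsCocyc A B ε (cobd A B ε ψ) := by
  intro z
  have h1 : derE (η2 A B ε) (fun v => derE (η1 A B ε) ψ v) z =
      derE (η1 A B ε) ψ (fev' A B z) := by
    symm
    apply derE_unique _ _ (fun z => derE (η1 A B ε) ψ (fev' A B z))
    · intro a; simp only [algHom_C, algebraMap_eq, derE_C]
    · intro p q; simp only [map_add, derE_add]
    · intro p v
      simp only [map_mul, derE_mul, aeval_X, id]
      congr 2
      · exact congrArg ε (q1_fev' p)
      · simp [-aeval_id_eq_join₁]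
  have h2 : derE (η2 A B ε) (fun v => ψ (fev A B v)) z = derE (η1 A B ε) ψ (gev A B z) := by
    symm
    apply derE_unique _ _ (fun z => derE (η1 A B ε) ψ (gev A B z))
    · intro a; simp only [algHom_C, algebraMap_eq, derE_C]
    · intro p q; simp only [map_add, derE_add]
    · intro p v
      simp only [map_mul, derE_mul, rename_X, derE_X]
      congr 2
      · exact congrArg ε (q1_gev p)
      · show ε (q1 A B (X (fev A B v))) = ε (q2 A B (X v))
        rw [aeval_X, aeval_X, q0_fev]
  have h3 : derE (η2 A B ε) (fun v => ψ (fren A B v)) z = derE (η1 A B ε) ψ (gren A B z) := by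
    symm
    apply derE_unique _ _ (fun z => derE (η1 A B ε) ψ (gren A B z))
    · intro a; simp only [algHom_C, algebraMap_eq, derE_C]
    · intro p q; simp only [map_add, derE_add]
    · intro p v
      simp only [map_mul, derE_mul, rename_X, derE_X]
      congr 2
      · exact congrArg ε (q1_gren p)
      · simp [-aeval_id_eq_join₁, q0_fren]
  have h4 : cobd A B ε ψ = fun v => (derE (η1 A B ε) ψ v - ψ (fev A B v)) -
     (0 - ψ (fren A B v)) := by funext v; simp [-aeval_id_eq_join₁, cobd]
  have h5 : derE (η2 A B ε) (fun _ => (0 : E)) z = 0 := by simp [-aeval_id_eq_join₁, derE]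
  rw [h4, derE_sub_fun, derE_sub_fun, derE_sub_fun, h1, h2, h3, h5]
  beta_reduce
  rw [fev_fev', fren_fev', fren_gev]
  ring

theorem IsCocyc.sub {D D' : MvPolynomial (MvPolynomial B A) A → E} (h : IsCocyc A B ε D)
    (h' : IsCocyc A B ε D') : IsCocyc A B ε (fun v => D v - D' v) := by
  intro z
  rw [derE_sub_fun, h, h']; ring

variable {ε}
section
variable {D : MvPolynomial (MvPolynomial B A) A → E} (h : IsCocyc A B ε D)
include h

theorem IsCocyc.C (a : A) : D (C a) = 0 := by
  have := h (MvPolynomial.C a)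
  simp only [derE_C, algHom_C, algebraMap_eq] at this
  linear_combination -this

theorem IsCocyc.zero : D 0 = 0 := by
  have := h.C 0; simpa using this

theorem IsCocyc.X_eq (p) : D (X p) = D (X (X (q0 A B p))) := by
  have := h (X (X p))
  simp only [derE_X, aeval_X, id, rename_X] at this
  linear_combination this

theorem IsCocyc.mul (v w) : ε (q1 A B v) * D w + ε (q1 A B w) * D v =
    D (v * w) - D (X (fev A B v) * X (fev A B w)) + D (X (fren A B v) * X (fren A B w)) := by
  have := h (X v * X w)
  rw [derE_mul, derE_X, derE_X] at this
  simp only [map_mul, aeval_X, id, rename_X] at this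
  rw [← this]
  simp [-aeval_id_eq_join₁]

theorem IsCocyc.add (v w) : D v + D w =
    D (v + w) - D (X (fev A B v) + X (fev A B w)) + D (X (fren A B v) + X (fren A B w)) := by
  have := h (X v + X w)
  rw [derE_add, derE_X, derE_X] at this
  simpa only [map_add, aeval_X, id, rename_X] using this

variable (hn : ∀ p, D (X p) = 0)
include hn

theorem IsCocyc.addX (p) : D (X 0 + X p) = D (X 0 + X (X (q0 A B p))) := by
  have := h.add 0 (X p)
  simp only [map_zero, aeval_X, id, rename_X, h.zero, zero_add, hn] at this
  linear_combination this

theorem IsCocyc.mulX (p) : D (X 0 * X p) = D (X 0 * X (X (q0 A B p))) := by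
  have := h.mul 0 (X p)
  simp only [map_zero, aeval_X, id, rename_X, h.zero, zero_add, hn, zero_mul, mul_zero] at this
  linear_combination this

theorem IsCocyc.add' (v w) (hv : fev A B v = 0) (hv' : fren A B v = 0) : D (v + w) = D v + D w := by
  rw [h.add, hv, hv', h.addX hn (fev A B w), h.addX hn (fren A B w), q0_fev, q0_fren]
  ring

theorem IsCocyc.mul' (v w) (hv : fev A B v = 0) (hv' : fren A B v = 0) :
    D (w * v) = ε (q1 A B w) * D v := by
  have := h.mul v w
  rw [hv, hv', h.mulX hn (fev A B w), h.mulX hn (fren A B w), q0_fev, q0_fren, ← q0_fev v, hv,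
    map_zero, map_zero] at this
  rw [mul_comm w]
  linear_combination -this

theorem IsCocyc.mul'' (v w) (hv : fev A B v = 0) (hw : fren A B w = 0) :
    D (v * w) = 0 := by
  have := h.mul v w
  rw [hv, hw, mul_comm (X (fren A B v)), h.mulX hn (fev A B w), h.mulX hn (fren A B v), q0_fev,
    q0_fren, ← q0_fev v, hv, ← q0_fren w, hw, map_zero, map_zero] at this
  linear_combination -this

theorem IsCocyc.sdeg (p) : D (sdeg A B p) = 0 := by
  have := h (rename (fun b => X (X b)) p)
  have e1 : (fev' A B).comp (rename (fun b => X (X b))) = (rename X : MvPolynomial B A →ₐ[A] _) := by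
    apply MvPolynomial.algHom_ext; intro v; simp only [AlgHom.comp_apply, AlgHom.id_apply, aeval_X, rename_X, id]
  have e2 : (gev A B).comp (rename (fun b => X (X b))) = (rename X : MvPolynomial B A →ₐ[A] _) := by
    apply MvPolynomial.algHom_ext; intro v; simp only [AlgHom.comp_apply, AlgHom.id_apply, aeval_X, rename_X, id]
  have e3 : (gren A B).comp (rename (fun b => X (X b))) = (rename X : MvPolynomial B A →ₐ[A] _) := by
    apply MvPolynomial.algHom_ext; intro v; simp only [AlgHom.comp_apply, AlgHom.id_apply, aeval_X, rename_X, id]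
  have e4 : ∀ p : MvPolynomial B A, derE (η2 A B ε) D (rename (fun b => X (X b)) p) = 0 := by
    intro p
    induction p using MvPolynomial.induction_on with
    | C a => simp [-aeval_id_eq_join₁, derE_C]
    | add p q hp hq => rw [map_add, derE_add, hp, hq, add_zero]
    | mul_X p v hh => rw [map_mul, derE_mul, hh, rename_X, derE_X, hn]; ring
  have e1' : fev' A B (rename (fun b => X (X b)) p) = rename X p := congrArg (fun f => f p) e1
  have e2' : gev A B (rename (fun b => X (X b)) p) = rename X p := congrArg (fun f => f p) e2
  have e3' : gren A B (rename (fun b => X (X b)) p) = rename X p := congrArg (fun f => f p) e3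
  rw [e4, e1', e2', e3'] at this
  linear_combination -this

theorem IsCocyc.eq_zero (h2 : ∀ v, fev A B v = 0 → fren A B v = 0 → D v = 0) (v) : D v = 0 := by
  have hcong : ∀ v w, fev A B v = fev A B w → fren A B v = fren A B w → D v = D w := by
    intro v w e1 e2
    have := h.add' hn (v - w) w (by rw [map_sub, e1, sub_self]) (by rw [map_sub, e2, sub_self])
    rw [sub_add_cancel, h2 (v - w) (by rw [map_sub, e1, sub_self]) (by rw [map_sub, e2, sub_self]),
      zero_add] at this
    exact this
  set p0 := fev A B v with hp0
  set p1 := fren A B v with hp1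
  set b := q1 A B v with hb
  have hb0 : q0 A B p0 = b := q0_fev v
  have hb1 : q0 A B p1 = b := q0_fren v
  let z : MvPolynomial (MvPolynomial (MvPolynomial B A) A) A :=
    X (X (p0 - p1 + X b)) + X (_root_.sdeg A B p1) - X (X (X b))
  have hz1 : fev' A B z = X (p0 - p1 + X b) + _root_.sdeg A B p1 - X (X b) := by
    simp only [z, map_add, map_sub, aeval_X, id]
  have hz2 : gev A B z = X (p0 - p1 + X b) + X p1 - X (X b) := by
    simp only [z, map_add, map_sub, rename_X, fev_sdeg, aeval_X, id]
  have hqq : q0 A B (p0 - p1 + X b) = b := by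
    rw [map_add, map_sub, hb0, hb1]; simp only [map_add, map_sub, aeval_X, rename_X, id, hb0, hb1, sub_add_cancel, add_sub_cancel_left, add_sub_cancel_right, sub_self, zero_add]
  have hz3 : gren A B z = X (X b) + X p1 - X (X b) := by
    simp only [z, map_add, map_sub, rename_X, fren_sdeg]
    rw [← map_sub, ← map_add, hqq]; simp only [map_add, map_sub, aeval_X, rename_X, id, hqq, hb0, hb1, sub_add_cancel, add_sub_cancel_left, add_sub_cancel_right, sub_self, zero_add]
  have key := h z
  have hD : derE (η2 A B ε) D z = 0 := by
    simp only [z, derE_sub, derE_add, derE_X, hn, h.sdeg hn]; ring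
  rw [hD, hcong (fev' A B z) v, hcong (gev A B z) (X p0), hcong (gren A B z) (X p1), hn, hn] at key
  · linear_combination -key
  · rw [hz3]; simp only [map_add, map_sub, aeval_X, rename_X, id, hqq, hb0, hb1, sub_add_cancel, add_sub_cancel_left, add_sub_cancel_right, sub_self, zero_add]
  · rw [hz3]; simp only [map_add, map_sub, aeval_X, rename_X, id, hqq, hb0, hb1, sub_add_cancel, add_sub_cancel_left, add_sub_cancel_right, sub_self, zero_add]
  · rw [hz2]; simp only [map_add, map_sub, aeval_X, rename_X, id, hqq, hb0, hb1, sub_add_cancel, add_sub_cancel_left, add_sub_cancel_right, sub_self, zero_add]; ring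
  · rw [hz2, map_sub, map_add, rename_X, rename_X, rename_X, rename_X, hqq, hb1, hb0]; simp only [map_add, map_sub, aeval_X, rename_X, id, hqq, hb0, hb1, sub_add_cancel, add_sub_cancel_left, add_sub_cancel_right, sub_self, zero_add]
  · rw [hz1, map_sub, map_add, fev_sdeg, ← hp0]; simp only [map_add, map_sub, aeval_X, rename_X, id, hqq, hb0, hb1, sub_add_cancel, add_sub_cancel_left, add_sub_cancel_right, sub_self, zero_add]; ring
  · rw [hz1, map_sub, map_add, fren_sdeg, ← hp1, rename_X, rename_X, hqq]; simp only [map_add, map_sub, aeval_X, rename_X, id, hqq, hb0, hb1, sub_add_cancel, add_sub_cancel_left, add_sub_cancel_right, sub_self, zero_add]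

end
end cocycle

end

section
open TensorProduct IsLocalRing

theorem XSplit.extend {P X1 : Type u} [CommRing P] [CommRing X1] {E : Type u} [Field E]
    {J : Ideal P} {ε : P →+* E} (HX : XSplit J ε) (s : P →+* X1) (ev ren : X1 →+* P)
    (hes : ∀ p, ev (s p) = p) (hrs : ∀ p, ren (s p) = p)
    (hJ : ∀ p, p ∈ J ↔ ∃ v, ren v = 0 ∧ ev v = p)
    (D : X1 → E)
    (hadd : ∀ v w, ev v = 0 → ren v = 0 → ev w = 0 → ren w = 0 → D (v + w) = D v + D w)
    (hmul : ∀ v w, ev v = 0 → ren v = 0 → D (w * v) = ε (ev w) * D v)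
    (hz : ∀ v w, ev v = 0 → ren w = 0 → D (v * w) = 0) :
    ∃ H : RingHom.ker ren → E, (∀ v w, H (v + w) = H v + H w) ∧
      (∀ (a : X1) v, H (a • v) = ε (ev a) * H v) ∧ ∀ v, ev v.1 = 0 → H v = D v.1 := by
  let K := RingHom.ker ren
  let _ : Module P K := Module.compHom K s
  have hsm : ∀ (p : P) (k : K), ((p • k : K) : X1) = s p * k := fun _ _ => rfl
  let N : Submodule P K :=
    { carrier := {x | x.1 ∈ RingHom.ker ev * RingHom.ker ren}
      add_mem' := fun ha hb => (RingHom.ker ev * RingHom.ker ren).add_mem ha hb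
      zero_mem' := (RingHom.ker ev * RingHom.ker ren).zero_mem
      smul_mem' := fun c x hx => by
        show s c * x.1 ∈ RingHom.ker ev * RingHom.ker ren
        exact Ideal.mul_mem_left _ (s c) hx }
  have hN : ∀ x : K, x ∈ N ↔ x.1 ∈ RingHom.ker ev * RingHom.ker ren := fun _ => Iff.rfl
  let dK : K →ₗ[P] P :=
    { toFun := fun x => ev x.1
      map_add' := fun x y => map_add ev _ _
      map_smul' := by
        intro p x
        rw [hsm, map_mul, hes]; rfl }
  have hdK : ∀ x, dK x = ev x.1 := fun _ => rfl
  have hNd : N ≤ LinearMap.ker dK := by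
    intro x hx
    rw [hN] at hx
    exact (Ideal.mul_le_left (I := RingHom.ker ev) hx : x.1 ∈ RingHom.ker ev)
  let d := N.liftQ dK hNd
  have hd : ∀ x : K, d (N.mkQ x) = ev x.1 := fun _ => rfl
  have hrange : LinearMap.range d = J := by
    ext p
    rw [hJ]
    constructor
    · rintro ⟨m, rfl⟩
      obtain ⟨x, rfl⟩ := N.mkQ_surjective m
      exact ⟨x.1, x.2, rfl⟩
    · rintro ⟨v, hv, rfl⟩
      exact ⟨N.mkQ ⟨v, hv⟩, rfl⟩
  have hpf : ∀ x y, d x • y = d y • x := by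
    have key : ∀ x y : K, N.mkQ (ev x.1 • y) = N.mkQ (x.1 • y) := by
      intro x y
      rw [← sub_eq_zero, ← map_sub, Submodule.mkQ_apply, Submodule.Quotient.mk_eq_zero, hN]
      have : ((ev x.1 • y - x.1 • y : K) : X1) = (s (ev x.1) - x.1) * y.1 := by
        rw [sub_mul]; rfl
      rw [this]
      refine Ideal.mul_mem_mul ?_ y.2
      rw [RingHom.mem_ker, map_sub, hes, sub_self]
    intro x y
    obtain ⟨x, rfl⟩ := N.mkQ_surjective x
    obtain ⟨y, rfl⟩ := N.mkQ_surjective y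
    rw [hd, hd, ← map_smul, ← map_smul, key, key]
    congr 1
    exact Subtype.ext (mul_comm _ _)
  have hD0 : D 0 = 0 := by simpa using hz 0 0 (map_zero _) (map_zero _)
  have hDN : ∀ x ∈ RingHom.ker ev * RingHom.ker ren, D x = 0 ∧ ev x = 0 ∧ ren x = 0 := by
    intro x hx
    induction hx using Submodule.mul_induction_on' with
    | mem_mul_mem m hm n hn =>
      refine ⟨hz m n hm hn, ?_, ?_⟩
      · rw [map_mul, show ev m = 0 from hm, zero_mul]
      · rw [map_mul, show ren n = 0 from hn, mul_zero]
    | add x _ y _ hx hy =>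
      refine ⟨?_, ?_, ?_⟩
      · rw [hadd _ _ hx.2.1 hx.2.2 hy.2.1 hy.2.2, hx.1, hy.1, add_zero]
      · rw [map_add, hx.2.1, hy.2.1, add_zero]
      · rw [map_add, hx.2.2, hy.2.2, add_zero]
  have hwd : ∀ x y : K, ev x.1 = 0 → N.mkQ x = N.mkQ y → D x.1 = D y.1 := by
    intro x y hx hxy
    rw [← sub_eq_zero, ← map_sub, Submodule.mkQ_apply, Submodule.Quotient.mk_eq_zero, hN] at hxy
    obtain ⟨h1, h2, h3⟩ := hDN _ hxy
    have h2' : ev y.1 = 0 := by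
      have : ((x - y : K) : X1) = x.1 - y.1 := rfl
      rw [this, map_sub, hx, zero_sub, neg_eq_zero] at h2
      exact h2
    have : x.1 = ((x - y : K) : X1) + y.1 := by
      show x.1 = x.1 - y.1 + y.1
      ring
    rw [this, hadd _ _ h2 h3 h2' y.2, h1, zero_add]
  let lft : (K ⧸ N) → K := Function.surjInv N.mkQ_surjective
  have hl : ∀ m, N.mkQ (lft m) = m := Function.surjInv_eq N.mkQ_surjective
  have hev : ∀ x : LinearMap.ker d, ev (lft x.1).1 = 0 := by
    intro x
    have := x.2
    rw [LinearMap.mem_ker, ← hl x.1, hd] at this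
    exact this
  let ν : LinearMap.ker d →ₛₗ[ε] E :=
    { toFun := fun x => D (lft x.1).1
      map_add' := by
        intro x y
        rw [← hadd _ _ (hev x) (lft x.1).2 (hev y) (lft y.1).2]
        apply hwd _ (lft x.1 + lft y.1) (hev _)
        rw [map_add, hl, hl, hl]; rfl
      map_smul' := by
        intro p x
        have h1 := hmul (lft x.1).1 (s p) (hev x) (lft x.1).2
        rw [hes] at h1
        show _ = ε p * _
        rw [← h1]
        apply hwd _ (p • lft x.1) (hev _)
        rw [map_smul, hl, hl]; rfl }
  obtain ⟨h, hh⟩ := HX (K ⧸ N) _ _ d hrange hpf ν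
  refine ⟨fun v => h (N.mkQ v), fun v w => by
    show h (N.mkQ (v + w)) = _
    rw [map_add, map_add], ?_, ?_⟩
  · intro a v
    have h1 : N.mkQ (a • v) = ev a • N.mkQ v := by
      rw [← map_smul, ← sub_eq_zero, ← map_sub, Submodule.mkQ_apply, Submodule.Quotient.mk_eq_zero,
        hN]
      have : ((a • v - ev a • v : K) : X1) = (a - s (ev a)) * v.1 := by
        rw [sub_mul]; rfl
      rw [this]
      refine Ideal.mul_mem_mul ?_ v.2
      rw [RingHom.mem_ker, map_sub, hes, sub_self]
    show h (N.mkQ (a • v)) = _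
    rw [h1, h.map_smulₛₗ]; rfl
  · intro v hv
    have := hh ⟨N.mkQ v, by rw [LinearMap.mem_ker, hd, hv]⟩
    refine this.trans ?_
    exact hwd _ v (hev ⟨N.mkQ v, _⟩) (hl _)

section
open MvPolynomial
variable {A B : Type u} [CommRing A] [CommRing B] [Algebra A B] {E : Type u} [Field E]
  {ε : B →+* E}

theorem isCocyc_exists_normal (D : MvPolynomial (MvPolynomial B A) A → E) (h : IsCocyc A B ε D)
    (hn : ∀ p, D (X p) = 0)
    (HX : XSplit (RingHom.ker (q0 A B).toRingHom) (ε.comp (q0 A B).toRingHom)) :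
    ∃ ψ, ∀ v, D v = cobd A B ε ψ v := by
  have hq1 : ∀ v, ε.comp (q0 A B).toRingHom ((fev A B).toRingHom v) = η1 A B ε v :=
    fun v => congrArg ε (q0_fev v)
  obtain ⟨H, Ha, Hm, HD⟩ := HX.extend (sdeg A B).toRingHom (fev A B).toRingHom (fren A B).toRingHom
    (fun p => fev_sdeg p) (fun p => fren_sdeg p) (by
      intro p
      constructor
      · intro hp
        have hp' : q0 A B p = 0 := hp
        refine ⟨X p - X 0, ?_, ?_⟩
        · show fren A B (X p - X 0) = 0
          rw [map_sub, rename_X, rename_X, hp', map_zero, sub_self]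
        · show fev A B (X p - X 0) = p
          rw [map_sub, aeval_X, aeval_X, id, id, sub_zero]
      · rintro ⟨v, hv, rfl⟩
        show q0 A B (fev A B v) = 0
        have hv' : fren A B v = 0 := hv
        rw [q0_fev, ← q0_fren, hv', map_zero]) D
    (fun v w h1 h2 _ _ => h.add' hn v w h1 h2)
    (fun v w h1 h2 => by rw [hq1]; exact h.mul' hn v w h1 h2)
    (fun v w h1 h2 => h.mul'' hn v w h1 h2)
  have hk : ∀ v, v - sdeg A B (fren A B v) ∈ RingHom.ker (fren A B).toRingHom := by
    intro v
    show fren A B (v - sdeg A B (fren A B v)) = 0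
    rw [map_sub, fren_sdeg, sub_self]
  let hh : MvPolynomial (MvPolynomial B A) A → E := fun v => H ⟨_, hk v⟩
  have H0 : H 0 = 0 := by
    have := Ha 0 0
    rw [add_zero] at this
    exact left_eq_add.mp this
  have hder : ∀ v, hh v = derE (η1 A B ε) (fun p => hh (X p)) v := by
    apply derE_unique
    · intro a
      have : (⟨_, hk (C a)⟩ : RingHom.ker (fren A B).toRingHom) = 0 := by
        apply Subtype.ext
        show C a - sdeg A B (fren A B (C a)) = 0
        simp only [algHom_C, algebraMap_eq, sub_self]
      show H _ = 0
      rw [this, H0]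
    · intro p q
      show H _ = H _ + H _
      rw [← Ha]
      congr 1
      apply Subtype.ext
      show p + q - sdeg A B (fren A B (p + q)) = (p - sdeg A B (fren A B p)) +
        (q - sdeg A B (fren A B q))
      simp only [map_add]; ring
    · intro p v
      have e : (⟨_, hk (p * X v)⟩ : RingHom.ker (fren A B).toRingHom) =
        p • (⟨_, hk (X v)⟩ : RingHom.ker (fren A B).toRingHom) +
          (sdeg A B (fren A B (X v))) • (⟨_, hk p⟩ : RingHom.ker (fren A B).toRingHom) := by
        apply Subtype.ext
        show p * X v - sdeg A B (fren A B (p * X v)) = p * (X v - sdeg A B (fren A B (X v))) +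
          sdeg A B (fren A B (X v)) * (p - sdeg A B (fren A B p))
        simp only [map_mul]; ring
      show H _ = η1 A B ε p * H _ + η1 A B ε (X v) * H _
      rw [e, Ha, Hm, Hm, hq1, hq1]
      congr 2
      show ε (q1 A B (sdeg A B (fren A B (X v)))) = ε (q1 A B (X v))
      rw [← q0_fev, fev_sdeg, q0_fren]
  refine ⟨fun p => hh (X p), ?_⟩
  have hhX : ∀ b : B, hh (X (X b)) = 0 := by
    intro b
    have : (⟨_, hk (X (X b))⟩ : RingHom.ker (fren A B).toRingHom) = 0 := by
      apply Subtype.ext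
      show X (X b) - sdeg A B (fren A B (X (X b))) = 0
      simp only [rename_X, aeval_X, id, sub_self]
    show H _ = 0
    rw [this, H0]
  have hc := h.sub ε (cobd_isCocyc ε (fun p => hh (X p)))
  have := hc.eq_zero (by
    intro p
    simp only [hn, cobd, derE_X, aeval_X, id, rename_X, hhX]; ring) (by
    intro v h1 h2
    simp only [cobd, h1, h2, ← hder]
    have e : (⟨_, hk v⟩ : RingHom.ker (fren A B).toRingHom) = ⟨v, h2⟩ := by
      apply Subtype.ext
      show v - sdeg A B (fren A B v) = v
      rw [h2, map_zero, sub_zero]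
    have : hh v = D v := by
      show H _ = D v
      rw [e]
      exact HD ⟨v, h2⟩ h1
    rw [this]; ring)
  intro v
  exact sub_eq_zero.mp (this v)

theorem isCocyc_exists_cobd (D : MvPolynomial (MvPolynomial B A) A → E) (h : IsCocyc A B ε D)
    (HX : XSplit (RingHom.ker (q0 A B).toRingHom) (ε.comp (q0 A B).toRingHom)) :
    ∃ ψ, ∀ v, D v = cobd A B ε ψ v := by
  obtain ⟨ψ, hψ⟩ := isCocyc_exists_normal _
    (h.sub ε (cobd_isCocyc ε (fun p => D (X (X (q0 A B p)))))) (by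
      intro p
      rw [h.X_eq]
      simp only [cobd, derE_X, aeval_X, id, rename_X]
      ring) HX
  refine ⟨fun p => ψ p + D (X (X (q0 A B p))), ?_⟩
  intro v
  have := hψ v
  have e : derE (η1 A B ε) (fun p => ψ p + D (X (X (q0 A B p)))) v = derE (η1 A B ε) ψ v +
      derE (η1 A B ε) (fun p => D (X (X (q0 A B p)))) v := by
    simp only [derE, mul_add, Finset.sum_add_distrib]
  simp only [cobd] at this ⊢
  rw [e]
  linear_combination this
end

end

section
open TensorProduct IsLocalRing

section
open MvPolynomial
variable {A B : Type u} [CommRing A] [CommRing B] [Algebra A B] (I : Ideal B)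


theorem AQH_two_subsingleton (hI : I.IsMaximal)
    (HX : letI := Ideal.Quotient.field I; XSplit (RingHom.ker (q0 A B).toRingHom)
      ((Ideal.Quotient.mk I).comp (q0 A B).toRingHom)) :
    Subsingleton (AQH A B (B ⧸ I) 2) := by
  let _ : Field (B ⧸ I) := Ideal.Quotient.field I
  have key : ∀ (n : ℕ) (φ : (AQV A B n →₀ (B ⧸ I)) →ₗ[B ⧸ I] (B ⧸ I))
      (f : AQV A B (n+2) →ₐ[A] AQV A B (n+1)) (v : AQV A B (n+1)),
      φ (AQind A B (B ⧸ I) n f (Finsupp.single v 1)) =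
        derE (A := A) (V := AQV A B n) ((Ideal.Quotient.mk I).comp (AQaug A B n).toRingHom)
         (fun w => φ (Finsupp.single w 1)) (f (X (R := A) v)) := by
    intro n φ f v
    rw [AQind, Finsupp.lsum_single, LinearMap.sum_apply, map_sum]
    apply Finset.sum_congr rfl
    intro w _
    rw [LinearMap.comp_apply, LinearMap.smul_apply, LinearMap.id_apply, Finsupp.lsingle_apply]
    have : (AQaug A B n ((pderiv w) (f (X (R := A) v))) : B) • (1 : B ⧸ I) =
      (Ideal.Quotient.mk I (AQaug A B n ((pderiv w) (f (X (R := A) v))))) • (1 : B ⧸ I) := rfl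
    erw [this]
    rw [← Finsupp.smul_single, map_smul, smul_eq_mul]
    rfl
  have hsub : ∀ c, c ∈ AQcycles A B (B ⧸ I) 2 → c ∈ LinearMap.range (AQdiff A B (B ⧸ I) 2) := by
    intro c hc
    by_contra hcn
    let N : Submodule (B ⧸ I) (AQV A B 2 →₀ (B ⧸ I)) :=
      { carrier := LinearMap.range (AQdiff A B (B ⧸ I) 2)
        add_mem' := fun ha hb => (LinearMap.range (AQdiff A B (B ⧸ I) 2)).add_mem ha hb
        zero_mem' := (LinearMap.range (AQdiff A B (B ⧸ I) 2)).zero_mem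
        smul_mem' := by
          intro e x hx
          obtain ⟨b, rfl⟩ := Ideal.Quotient.mk_surjective e
          exact (LinearMap.range (AQdiff A B (B ⧸ I) 2)).smul_mem b hx }
    have hcN : c ∉ N := hcn
    obtain ⟨φ, hφc, hφN⟩ := Submodule.exists_le_ker_of_notMem hcN
    have h0 : ∀ x, φ (AQdiff A B (B ⧸ I) 2 x) = 0 := fun x => hφN ⟨x, rfl⟩
    let D : MvPolynomial (MvPolynomial B A) A → B ⧸ I :=
      fun v => φ (Finsupp.single (show AQV A B 2 from v) 1)
    have hD : IsCocyc A B (Ideal.Quotient.mk I) D := by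
      intro z
      have hex : ∀ x, φ (AQdiff A B (B ⧸ I) 2 x) = φ (AQind A B (B ⧸ I) 2 (AQface A B 2 0) x) -
          φ (AQind A B (B ⧸ I) 2 (AQface A B 2 1) x) + φ (AQind A B (B ⧸ I) 2 (AQface A B 2 2) x) -
          φ (AQind A B (B ⧸ I) 2 (AQface A B 2 3) x) := by
        intro x
        simp only [AQdiff, Finset.sum_range_succ, Finset.sum_range_zero, LinearMap.add_apply,
          LinearMap.smul_apply, LinearMap.zero_apply, map_add, zero_add, map_zsmul, pow_succ,
          pow_zero, one_mul, neg_mul, mul_neg, neg_neg, neg_smul, one_smul, LinearMap.neg_apply, map_neg]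
        ring
      have := (hex _).symm.trans (h0 (Finsupp.single (show AQV A B 3 from z) 1))
      have e0 : AQface A B 2 0 (X (R := A) (show AQV A B 3 from z)) = z := aeval_X _ _
      have e1 : AQface A B 2 1 (X (R := A) (show AQV A B 3 from z)) = X (R := A) (fev' A B z) :=
        rename_X _ _
      have e2 : AQface A B 2 2 (X (R := A) (show AQV A B 3 from z)) = X (R := A) (gev A B z) :=
        rename_X _ _
      have e3 : AQface A B 2 3 (X (R := A) (show AQV A B 3 from z)) = X (R := A) (gren A B z) :=
        rename_X _ _
      have k0 := (key 2 φ (AQface A B 2 0) z).trans (congrArg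
        (derE (A := A) (V := AQV A B 2) (η2 A B (Ideal.Quotient.mk I)) D) e0)
      have k1 := (key 2 φ (AQface A B 2 1) z).trans ((congrArg
        (derE (A := A) (V := AQV A B 2) (η2 A B (Ideal.Quotient.mk I)) D) e1).trans (derE_X _ _ _))
      have k2 := (key 2 φ (AQface A B 2 2) z).trans ((congrArg
        (derE (A := A) (V := AQV A B 2) (η2 A B (Ideal.Quotient.mk I)) D) e2).trans (derE_X _ _ _))
      have k3 := (key 2 φ (AQface A B 2 3) z).trans ((congrArg
        (derE (A := A) (V := AQV A B 2) (η2 A B (Ideal.Quotient.mk I)) D) e3).trans (derE_X _ _ _))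
      have t := (congrArg₂ (· - ·) (congrArg₂ (· + ·) (congrArg₂ (· - ·) k0 k1) k2) k3).symm.trans this
      change derE (η2 A B (Ideal.Quotient.mk I)) D z - D (fev' A B z) + D (gev A B z) -
        D (gren A B z) = 0 at t
      linear_combination t
    obtain ⟨ψ, hψ⟩ := isCocyc_exists_cobd D hD HX
    let Ψ : (AQV A B 1 →₀ (B ⧸ I)) →ₗ[B ⧸ I] (B ⧸ I) := Finsupp.linearCombination (B ⧸ I) ψ
    have hΨ : ∀ w : MvPolynomial B A, Ψ (Finsupp.single (show AQV A B 1 from w) 1) = ψ w := by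
      intro w
      refine (Finsupp.linearCombination_single _ _ _).trans ?_
      rw [one_smul]
    have h1 : ∀ v : AQV A B 2, Ψ (AQdiff A B (B ⧸ I) 1 (Finsupp.single v 1)) =
        φ (Finsupp.single v 1) := by
      intro v
      have hex : ∀ x, Ψ (AQdiff A B (B ⧸ I) 1 x) = Ψ (AQind A B (B ⧸ I) 1 (AQface A B 1 0) x) -
          Ψ (AQind A B (B ⧸ I) 1 (AQface A B 1 1) x) +
          Ψ (AQind A B (B ⧸ I) 1 (AQface A B 1 2) x) := by
        intro x
        simp only [AQdiff, Finset.sum_range_succ, Finset.sum_range_zero, LinearMap.add_apply,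
          LinearMap.smul_apply, LinearMap.zero_apply, map_add, zero_add, map_zsmul, pow_succ,
          pow_zero, one_mul, neg_mul, mul_neg, neg_neg, neg_smul, one_smul, LinearMap.neg_apply, map_neg]
        ring
      have e0 : AQface A B 1 0 (X (R := A) v) = v := aeval_X _ _
      have e1 : AQface A B 1 1 (X (R := A) v) = X (R := A) (fev A B v) := rename_X _ _
      have e2 : AQface A B 1 2 (X (R := A) v) = X (R := A) (fren A B v) := rename_X _ _
      have hs : (fun w : AQV A B 1 => Ψ (Finsupp.single w 1)) = ψ := funext hΨ
      have k := fun f => (key 1 Ψ f v).trans (congrArg (fun s => derE (A := A) (V := AQV A B 1)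
        (η1 A B (Ideal.Quotient.mk I)) s (f (X (R := A) v))) hs)
      have k0 := (k (AQface A B 1 0)).trans (congrArg
        (derE (A := A) (V := AQV A B 1) (η1 A B (Ideal.Quotient.mk I)) ψ) e0)
      have k1 := (k (AQface A B 1 1)).trans ((congrArg
        (derE (A := A) (V := AQV A B 1) (η1 A B (Ideal.Quotient.mk I)) ψ) e1).trans (derE_X _ _ _))
      have k2 := (k (AQface A B 1 2)).trans ((congrArg
        (derE (A := A) (V := AQV A B 1) (η1 A B (Ideal.Quotient.mk I)) ψ) e2).trans (derE_X _ _ _))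
      have t := (hex _).trans (congrArg₂ (· + ·) (congrArg₂ (· - ·) k0 k1) k2)
      exact t.trans (hψ v).symm
    have h2 : ∀ x, Ψ (AQdiff A B (B ⧸ I) 1 x) = φ x := by
      intro x
      induction x using Finsupp.induction_linear with
      | zero => simp
      | add f g hf hg => rw [map_add, map_add, map_add, hf, hg]
      | single v e =>
        obtain ⟨b, rfl⟩ := Ideal.Quotient.mk_surjective e
        have e1 : Finsupp.single v (Ideal.Quotient.mk I b) =
            b • (Finsupp.single v 1 : AQV A B 2 →₀ (B ⧸ I)) := by
          rw [Finsupp.smul_single]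
          congr 1
          rw [Algebra.smul_def, mul_one]; rfl
        have e2 : ∀ (n) (y : AQV A B n →₀ (B ⧸ I)), b • y = (Ideal.Quotient.mk I b) • y :=
          fun _ _ => rfl
        rw [e1, map_smul, e2, map_smul, e2, map_smul, h1]
    apply hφc
    rw [← h2]
    have : AQdiff A B (B ⧸ I) 1 c = 0 := hc
    rw [this, map_zero]
  constructor
  intro a b
  obtain ⟨a, rfl⟩ := Submodule.mkQ_surjective _ a
  obtain ⟨b, rfl⟩ := Submodule.mkQ_surjective _ b
  erw [Submodule.mkQ_apply, Submodule.mkQ_apply, Submodule.Quotient.eq]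
  exact hsub _ (a - b).2
end

end

section
open TensorProduct IsLocalRing

theorem XSplit.of_residue {A0 R'' E : Type u} [CommRing A0] [CommRing R''] [Algebra A0 R'']
    [Module.Flat A0 R''] [Field E] (ε : R'' →+* E)
    (h1 : ∀ e : E, ∃ a s : A0, ε (algebraMap A0 R'' s) ≠ 0 ∧
      e * ε (algebraMap A0 R'' s) = ε (algebraMap A0 R'' a))
    (h2 : ∀ s : A0, ε (algebraMap A0 R'' s) ≠ 0 → IsUnit (algebraMap A0 R'' s))
    (h3 : RingHom.ker ε ≤ (RingHom.ker (ε.comp (algebraMap A0 R''))).map (algebraMap A0 R'')) :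
    XSplit (RingHom.ker (MvPolynomial.aeval (id : R'' → R'') : MvPolynomial R'' A0 →ₐ[A0] R'').toRingHom)
      (ε.comp (MvPolynomial.aeval (id : R'' → R'') : MvPolynomial R'' A0 →ₐ[A0] R'').toRingHom) := by
  let _ : Algebra A0 E := (ε.comp (algebraMap A0 R'')).toAlgebra
  have halg : ∀ a, algebraMap A0 E a = ε (algebraMap A0 R'' a) := fun _ => rfl
  let εA : R'' →ₐ[A0] E := { ε with commutes' := fun a => rfl }
  have hεA : ∀ r, εA r = ε r := fun _ => rfl
  let μ : R'' ⊗[A0] E →ₐ[A0] E := Algebra.TensorProduct.lift εA (AlgHom.id A0 E)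
    (fun _ _ => Commute.all _ _)
  have hμ : ∀ r e, μ (r ⊗ₜ e) = ε r * e := fun r e => by
    simp only [μ, Algebra.TensorProduct.lift_tmul, hεA, AlgHom.id_apply]
  have hrep : ∀ x : R'' ⊗[A0] E, ∃ r : R'', x = r ⊗ₜ 1 := by
    intro x
    induction x using TensorProduct.induction_on with
    | zero => exact ⟨0, by rw [TensorProduct.zero_tmul]⟩
    | add x y hx hy =>
      obtain ⟨r, rfl⟩ := hx
      obtain ⟨r', rfl⟩ := hy
      exact ⟨r + r', by rw [TensorProduct.add_tmul]⟩
    | tmul r e =>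
      obtain ⟨a, s, hs, hes⟩ := h1 e
      obtain ⟨u, hu⟩ := h2 s hs
      refine ⟨a • ((u⁻¹ : R''ˣ) : R'') * r, ?_⟩
      have e1 : r = s • (((u⁻¹ : R''ˣ) : R'') * r) := by
        rw [Algebra.smul_def, ← hu, ← mul_assoc, Units.mul_inv, one_mul]
      have e2 : s • e = a • (1 : E) := by
        rw [Algebra.smul_def, Algebra.smul_def, halg, halg, mul_comm, hes, mul_one]
      calc r ⊗ₜ[A0] e = (s • (((u⁻¹ : R''ˣ) : R'') * r)) ⊗ₜ[A0] e := by rw [← e1]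
        _ = (((u⁻¹ : R''ˣ) : R'') * r) ⊗ₜ[A0] (a • (1 : E)) := by
          rw [TensorProduct.smul_tmul, e2]
        _ = _ := by rw [← TensorProduct.smul_tmul, smul_mul_assoc]
  have hinj : Function.Injective μ := by
    rw [injective_iff_map_eq_zero]
    intro x hx
    obtain ⟨r, rfl⟩ := hrep x
    rw [hμ, mul_one] at hx
    have hr := h3 (show r ∈ RingHom.ker ε from hx)
    have : ∀ y ∈ (RingHom.ker (ε.comp (algebraMap A0 R''))).map (algebraMap A0 R''),
        y ⊗ₜ[A0] (1 : E) = 0 := by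
      intro y hy
      rw [Ideal.map] at hy
      induction hy using Submodule.span_induction with
      | mem y hy =>
        obtain ⟨a, ha, rfl⟩ := hy
        rw [Algebra.algebraMap_eq_smul_one, TensorProduct.smul_tmul, Algebra.smul_def, halg,
          show ε (algebraMap A0 R'' a) = 0 from ha, zero_mul, TensorProduct.tmul_zero]
      | zero => rw [TensorProduct.zero_tmul]
      | add y z _ _ hy hz => rw [TensorProduct.add_tmul, hy, hz, add_zero]
      | smul c y _ hy =>
        have := congrArg (fun z => (c ⊗ₜ[A0] (1 : E)) * z) hy
        simpa using this
    exact this r hr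
  let P := MvPolynomial R'' A0
  let π : P →ₐ[A0] R'' := MvPolynomial.aeval (id : R'' → R'')
  have hπ : Function.Surjective π := fun r => ⟨MvPolynomial.X r, MvPolynomial.aeval_X _ _⟩
  have _ : Module.Flat A0 (P ⧸ RingHom.ker π.toRingHom) :=
    Module.Flat.of_linearEquiv (Ideal.quotientKerAlgEquivOfSurjective hπ).toLinearEquiv
  let mp : P ⊗[A0] E →ₐ[A0] R'' ⊗[A0] E := Algebra.TensorProduct.map π (AlgHom.id A0 E)
  let ε' : P ⊗[A0] E →+* E := μ.toRingHom.comp mp.toRingHom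
  have hε' : ∀ p e, ε' (p ⊗ₜ e) = ε (π p) * e := fun p e => by
    show μ (mp (p ⊗ₜ e)) = _
    rw [Algebra.TensorProduct.map_tmul, hμ]; rfl
  have hker : (RingHom.ker π.toRingHom).map (algebraMap P (P ⊗[A0] E)) = RingHom.ker ε' := by
    have e1 : RingHom.ker ε' = RingHom.ker mp := by
      ext x
      exact map_eq_zero_iff μ hinj
    rw [e1, Algebra.TensorProduct.rTensor_ker π hπ]
    rfl
  refine XSplit.flat_base_change (A0 := A0) (P := P) (E := E) _ _ ε' ?_ ?_
  · ext x
    · show ε (π _) = ε' (_ ⊗ₜ 1)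
      rw [hε', mul_one]; rfl
    · show ε (π _) = ε' (_ ⊗ₜ 1)
      rw [hε', mul_one]; rfl
  · rw [hker]
    let e : MvPolynomial R'' E ≃ₐ[A0] P ⊗[A0] E :=
      ((MvPolynomial.algebraTensorAlgEquiv (σ := R'') A0 E).symm.restrictScalars A0).trans
        (Algebra.TensorProduct.comm A0 E P)
    have hcomp : ε'.comp e.toRingEquiv.toRingHom =
        (MvPolynomial.aeval (ε : R'' → E) : MvPolynomial R'' E →ₐ[E] E).toRingHom := by
      apply MvPolynomial.ringHom_ext
      · intro a
        have : e (MvPolynomial.C a) = 1 ⊗ₜ a := by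
          simp only [e, AlgEquiv.trans_apply, AlgEquiv.restrictScalars_apply, MvPolynomial.C_apply,
            MvPolynomial.algebraTensorAlgEquiv_symm_monomial, Algebra.TensorProduct.comm_tmul]
          simp
        show ε' (e _) = MvPolynomial.aeval _ _
        rw [this, hε']; simp
      · intro r
        have : e (MvPolynomial.X r) = (MvPolynomial.X r) ⊗ₜ 1 := by
          simp only [e, AlgEquiv.trans_apply, AlgEquiv.restrictScalars_apply,
            MvPolynomial.algebraTensorAlgEquiv_symm_X, Algebra.TensorProduct.comm_tmul]
        show ε' (e _) = MvPolynomial.aeval _ _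
        rw [this, hε', mul_one, MvPolynomial.aeval_X, MvPolynomial.aeval_X, id]
    refine XSplit.of_ringEquiv (J' := RingHom.ker
      (MvPolynomial.aeval (ε : R'' → E) : MvPolynomial R'' E →ₐ[E] E).toRingHom) e.toRingEquiv
      ?_ ?_ (XSplit.of_aeval (ε : R'' → E) (RingHom.id E))
    · rw [← hcomp, RingHom.comap_ker]
    · rw [RingHom.id_comp, hcomp]

theorem XSplit.enlarge {Λ P' B E : Type u} [CommRing Λ] [CommRing P'] [CommRing B] [Algebra Λ B]
    [Field E] (εB : B →+* E) (σ : P' →+* B) (hσ : Function.Surjective σ)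
    (θ1 : P' →+* MvPolynomial B Λ) (ι0 : Λ →+* P') (hθι : θ1.comp ι0 = MvPolynomial.C)
    (hθ : σ = (q0 Λ B).toRingHom.comp θ1) (H : XSplit (RingHom.ker σ) (εB.comp σ)) :
    XSplit (RingHom.ker (q0 Λ B).toRingHom) (εB.comp (q0 Λ B).toRingHom) := by
  let l : B → P' := Function.surjInv hσ
  have hl : ∀ b, σ (l b) = b := Function.surjInv_eq hσ
  let ρ : MvPolynomial B P' →ₐ[P'] P' := MvPolynomial.aeval l
  have X4 : XSplit (RingHom.ker ρ.toRingHom) ((εB.comp σ).comp ρ.toRingHom) :=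
    XSplit.of_aeval (Y := B) l (εB.comp σ)
  have hρ : Function.Surjective ρ := fun p => ⟨MvPolynomial.C p, by simp [ρ]⟩
  have X5 := XSplit.comp (J1 := RingHom.ker σ) (ε0 := εB.comp σ) ρ.toRingHom hρ (by
    intro x hx
    show εB (σ x) = 0
    rw [show σ x = 0 from hx, map_zero]) X4 H
  let θ : MvPolynomial B P' →+* MvPolynomial B Λ := MvPolynomial.eval₂Hom θ1 MvPolynomial.X
  have hall : σ.comp ρ.toRingHom = (q0 Λ B).toRingHom.comp θ := by
    apply MvPolynomial.ringHom_ext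
    · intro a
      show σ (ρ (MvPolynomial.C a)) = q0 Λ B (θ (MvPolynomial.C a))
      simp only [θ, MvPolynomial.coe_eval₂Hom, MvPolynomial.eval₂_C, ρ, MvPolynomial.algHom_C]
      exact congrArg (fun f => f a) hθ
    · intro b
      show σ (ρ (MvPolynomial.X b)) = q0 Λ B (θ (MvPolynomial.X b))
      simp only [ρ, θ, MvPolynomial.coe_eval₂Hom, MvPolynomial.eval₂_X, MvPolynomial.aeval_X, id, hl]
  refine XSplit.retract (MvPolynomial.map ι0) θ ?_ ?_ ?_ X5
  · apply MvPolynomial.ringHom_ext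
    · intro a
      simp only [RingHom.comp_apply, MvPolynomial.map_C, θ, MvPolynomial.coe_eval₂Hom,
        MvPolynomial.eval₂_C, RingHom.id_apply]
      exact congrArg (fun f => f a) hθι
    · intro b
      simp [θ]
  · rw [RingHom.comap_ker, RingHom.comap_ker, ← hall]
  · rw [RingHom.comp_assoc, RingHom.comp_assoc, ← hall]

theorem AQ_main {Λ R'' B : Type u} [CommRing Λ] [CommRing R''] [CommRing B] [Algebra Λ B] (n : ℕ)
    [Algebra (MvPolynomial (Fin n) Λ) R''] [Module.Flat (MvPolynomial (Fin n) Λ) R'']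
    (g : R'' →+* B) (hg : Function.Surjective g)
    (hgΛ : ∀ a, g (algebraMap (MvPolynomial (Fin n) Λ) R'' (MvPolynomial.C a)) = algebraMap Λ B a)
    (hker : GeneratedByRegularSequence R'' (RingHom.ker g)) (I : Ideal B) (hI : I.IsMaximal)
    (h1 : ∀ b : B, ∃ a s : MvPolynomial (Fin n) Λ, g (algebraMap _ R'' s) ∉ I ∧
      b * g (algebraMap _ R'' s) - g (algebraMap _ R'' a) ∈ I)
    (h2 : ∀ s : MvPolynomial (Fin n) Λ, g (algebraMap _ R'' s) ∉ I → IsUnit (algebraMap _ R'' s))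
    (h3 : I.comap g ≤ ((I.comap g).comap (algebraMap (MvPolynomial (Fin n) Λ) R'')).map
      (algebraMap (MvPolynomial (Fin n) Λ) R'')) :
    Subsingleton (AQH Λ B (B ⧸ I) 2) := by
  apply AQH_two_subsingleton I hI
  let _ : Field (B ⧸ I) := Ideal.Quotient.field I
  let A0 := MvPolynomial (Fin n) Λ
  let εB := Ideal.Quotient.mk I
  have hz : ∀ b, εB b = 0 ↔ b ∈ I := fun b => Ideal.Quotient.eq_zero_iff_mem
  let ε : R'' →+* B ⧸ I := εB.comp g
  have hεz : ∀ r, ε r = 0 ↔ g r ∈ I := fun r => hz _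
  have X1 := XSplit.of_residue (A0 := A0) ε (by
    intro e
    obtain ⟨b, rfl⟩ := Ideal.Quotient.mk_surjective e
    obtain ⟨a, s, hs, has⟩ := h1 b
    refine ⟨a, s, ?_, ?_⟩
    · rw [Ne, hεz]; exact hs
    · rw [← hz, map_sub, map_mul, sub_eq_zero] at has
      exact has) (by
    intro s hs
    rw [Ne, hεz] at hs
    exact h2 s hs) (by
    have e1 : RingHom.ker ε = I.comap g := by
      ext r; exact hεz r
    have e2 : RingHom.ker (ε.comp (algebraMap A0 R'')) = (I.comap g).comap (algebraMap A0 R'') := by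
      ext r; exact hεz _
    rw [e1, e2]
    exact h3)
  let π : MvPolynomial R'' A0 →ₐ[A0] R'' := MvPolynomial.aeval (id : R'' → R'')
  have hπ : Function.Surjective π := fun r => ⟨MvPolynomial.X r, MvPolynomial.aeval_X _ _⟩
  have X2 : XSplit (RingHom.ker g) ε := XSplit.of_regular ε hker
  have X3 := XSplit.comp (J1 := RingHom.ker g) (ε0 := ε) π.toRingHom hπ (by
    intro x hx
    show εB (g x) = 0
    rw [show g x = 0 from hx, map_zero]) X1 X2
  let P' := MvPolynomial R'' A0
  let σ : P' →+* B := g.comp π.toRingHom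
  have hσ : Function.Surjective σ := hg.comp hπ
  have X3' : XSplit (RingHom.ker σ) (εB.comp σ) := X3
  let θ0 : A0 →+* MvPolynomial B Λ := MvPolynomial.eval₂Hom MvPolynomial.C
    (fun i => MvPolynomial.X (g (algebraMap A0 R'' (MvPolynomial.X i))))
  let θ1 : P' →+* MvPolynomial B Λ := MvPolynomial.eval₂Hom θ0 (fun r => MvPolynomial.X (g r))
  let ι0 : Λ →+* P' := MvPolynomial.C.comp MvPolynomial.C
  have t1 : ∀ a : A0, θ1 (MvPolynomial.C a) = θ0 a := fun a => MvPolynomial.eval₂_C _ _ _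
  have t2 : ∀ r, θ1 (MvPolynomial.X r) = MvPolynomial.X (g r) := fun r => MvPolynomial.eval₂_X _ _ _
  have t3 : ∀ a, θ0 (MvPolynomial.C a) = MvPolynomial.C a := fun a => MvPolynomial.eval₂_C _ _ _
  have t4 : ∀ i, θ0 (MvPolynomial.X i) =
      MvPolynomial.X (g (algebraMap A0 R'' (MvPolynomial.X i))) := fun i => MvPolynomial.eval₂_X _ _ _
  have t5 : ∀ a : A0, π (MvPolynomial.C a) = algebraMap A0 R'' a :=
    fun a => MvPolynomial.algHom_C _ _
  have t6 : ∀ b : B, q0 Λ B (MvPolynomial.X b) = b := fun b => MvPolynomial.aeval_X _ _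
  have t7 : ∀ a : Λ, q0 Λ B (MvPolynomial.C a) = algebraMap Λ B a :=
    fun b => MvPolynomial.algHom_C _ _
  refine XSplit.enlarge εB σ hσ θ1 ι0 ?_ ?_ X3'
  · apply RingHom.ext
    intro a
    exact (t1 _).trans (t3 _)
  · apply MvPolynomial.ringHom_ext'
    · apply MvPolynomial.ringHom_ext'
      · apply RingHom.ext
        intro a
        exact ((congrArg g (t5 _)).trans (hgΛ a)).trans
          ((congrArg (q0 Λ B) ((t1 _).trans (t3 _))).trans (t7 a)).symm
      · intro i
        exact (congrArg g (t5 _)).trans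
          ((congrArg (q0 Λ B) ((t1 _).trans (t4 _))).trans (t6 _)).symm
    · intro r
      exact (congrArg g (MvPolynomial.aeval_X _ _)).trans
          ((congrArg (q0 Λ B) (t2 _)).trans (t6 _)).symm

end

section
open TensorProduct IsLocalRing

theorem compMap_aux {P C : Type*} [CommRing P] [CommRing C] (J : Ideal P) (I : Ideal C) (φ : P →+* C)
    (h : J.map φ ≤ I) (n : ℕ) : J ^ n ≤ (I ^ n).comap φ := by
  rw [← Ideal.map_le_iff_le_comap, Ideal.map_pow]
  exact Ideal.pow_right_mono h n

theorem compMap_aux2 {P C : Type*} [CommRing P] [CommRing C] (J : Ideal P) (I : Ideal C) (φ : P →+* C)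
    (h : J.map φ ≤ I) {m n : ℕ} (hle : m ≤ n) : (Ideal.Quotient.factorPow I hle).comp
      ((Ideal.quotientMap (I ^ n) φ (compMap_aux J I φ h n)).comp (AdicCompletion.evalₐ J n).toRingHom) =
      (Ideal.quotientMap (I ^ m) φ (compMap_aux J I φ h m)).comp (AdicCompletion.evalₐ J m).toRingHom := by
  apply RingHom.ext
  intro x
  induction x using AdicCompletion.induction_on with
  | _ r =>
  simp only [RingHom.comp_apply, AlgHom.toRingHom_eq_coe, RingHom.coe_coe, AdicCompletion.evalₐ_mk]
  rw [← AdicCompletion.Ideal.mk_eq_mk J hle r]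
  rfl

noncomputable def compMap {P C : Type*} [CommRing P] [CommRing C] (J : Ideal P) (I : Ideal C) (φ : P →+* C)
    (h : J.map φ ≤ I) : AdicCompletion J P →+* AdicCompletion I C :=
  AdicCompletion.liftRingHom I (fun n => (Ideal.quotientMap (I ^ n) φ (compMap_aux J I φ h n)).comp
    (AdicCompletion.evalₐ J n).toRingHom) (compMap_aux2 J I φ h)

theorem compMap_eval {P C : Type*} [CommRing P] [CommRing C] (J : Ideal P) (I : Ideal C) (φ : P →+* C)
    (h : J.map φ ≤ I) (n : ℕ) (x : AdicCompletion J P) (y : P)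
    (hy : AdicCompletion.evalₐ J n x = Ideal.Quotient.mk _ y) :
    AdicCompletion.evalₐ I n (compMap J I φ h x) = Ideal.Quotient.mk _ (φ y) := by
  rw [compMap, AdicCompletion.evalₐ_liftRingHom I _ (compMap_aux2 J I φ h)]
  rw [RingHom.comp_apply]
  refine (congrArg _ hy).trans ?_
  simp

theorem compMap_algebraMap {P C : Type*} [CommRing P] [CommRing C] (J : Ideal P) (I : Ideal C) (φ : P →+* C)
    (h : J.map φ ≤ I) (y : P) :
    compMap J I φ h (algebraMap P _ y) = algebraMap C _ (φ y) := by
  apply AdicCompletion.ext_evalₐ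
  intro n
  rw [compMap_eval J I φ h n _ y]
  · simp [AlgHom.commutes]
  · simp [AlgHom.commutes]

theorem compMap_surj {P C : Type*} [CommRing P] [CommRing C] (J : Ideal P) (I : Ideal C) (φ : P →+* C)
    (hJ : J.FG) (hmod : Function.Surjective ((Ideal.Quotient.mk I).comp φ)) (hI : J.map φ = I) :
    Function.Surjective (compMap J I φ hI.le) := by
  have hIfg : I.FG := hI ▸ hJ.map φ
  have h1 : IsAdicComplete (J.map (algebraMap P (AdicCompletion J P))) (AdicCompletion J P) :=
    AdicCompletion.isAdicComplete_self _ hJ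
  have h2 : IsAdicComplete (I.map (algebraMap C (AdicCompletion I C))) (AdicCompletion I C) :=
    AdicCompletion.isAdicComplete_self _ hIfg
  have h3 : (J.map (algebraMap P (AdicCompletion J P))).map (compMap J I φ hI.le) =
      I.map (algebraMap C (AdicCompletion I C)) := by
    rw [Ideal.map_map]
    have e : I.map (algebraMap C (AdicCompletion I C)) = (J.map φ).map (algebraMap C (AdicCompletion I C)) :=
      congrArg _ hI.symm
    rw [e, Ideal.map_map]
    congr 1
  have h4 : IsHausdorff ((J.map (algebraMap P (AdicCompletion J P))).map (compMap J I φ hI.le))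
    (AdicCompletion I C) := by rw [h3]; infer_instance
  apply surjective_of_mk_map_comp_surjective (I := J.map (algebraMap P (AdicCompletion J P)))
  intro z
  obtain ⟨w, rfl⟩ := Ideal.Quotient.mk_surjective z
  obtain ⟨y, hy⟩ := hmod (AdicCompletion.evalOneₐ I w)
  refine ⟨algebraMap P _ y, ?_⟩
  show Ideal.Quotient.mk _ (compMap J I φ hI.le (algebraMap P _ y)) = _
  rw [Ideal.Quotient.eq, h3, ← AdicCompletion.ker_evalOneₐ_eq_map (I := I) hIfg, compMap_algebraMap]
  show AdicCompletion.evalOneₐ I _ = 0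
  rw [map_sub, sub_eq_zero, ← hy, AlgHom.commutes]
  rfl

instance adicCompletion_noeth {P : Type*} [CommRing P] [IsNoetherianRing P] (J : Ideal P) :
    IsNoetherianRing (AdicCompletion J P) := by
  obtain ⟨n, a, ha⟩ : ∃ (n : ℕ) (a : Fin n → P), Ideal.span (Set.range a) = J := by
    obtain ⟨s, hs⟩ := (IsNoetherian.noetherian J)
    refine ⟨s.card, fun i => (s.equivFin.symm i : P), ?_⟩
    rw [← hs, Set.range_comp' (fun x : s => (x : P)) s.equivFin.symm,
      s.equivFin.symm.surjective.range_eq, Set.image_univ]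
    simp [Ideal.span]
  let φ : MvPolynomial (Fin n) P →+* P := (MvPolynomial.aeval a).toRingHom
  have hφ : (MvPolynomial.idealOfVars (Fin n) P).map φ = J := by
    rw [MvPolynomial.idealOfVars, Ideal.map_span, ← ha, ← Set.range_comp]
    congr 2
    ext i
    simp [φ]
  have hs : Function.Surjective (compMap (MvPolynomial.idealOfVars (Fin n) P) J φ hφ.le) := by
    apply compMap_surj
    · exact MvPolynomial.idealOfVars_fg _ _
    · intro z
      obtain ⟨w, rfl⟩ := Ideal.Quotient.mk_surjective z
      exact ⟨MvPolynomial.C w, by simp [φ]⟩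
    · exact hφ
  have h0 : IsNoetherianRing (AdicCompletion (MvPolynomial.idealOfVars (Fin n) P) (MvPolynomial (Fin n) P)) :=
    isNoetherianRing_of_ringEquiv (MvPowerSeries (Fin n) P)
      (MvPowerSeries.toAdicCompletionAlgEquiv (Fin n) P).toRingEquiv
  exact isNoetherianRing_of_surjective _ _ _ hs

theorem compMap_ker {P C : Type*} [CommRing P] [CommRing C] [IsNoetherianRing P] [IsLocalRing P]
     (I : Ideal C) (φ : P →+* C)
    (hφ : Function.Surjective φ) (hI : (maximalIdeal P).map φ = I) :
    RingHom.ker (compMap (maximalIdeal P) I φ hI.le) =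
      (RingHom.ker φ).map (algebraMap P (AdicCompletion (maximalIdeal P) P)) := by
  set J := maximalIdeal P
  have hJ : J.FG := IsNoetherian.noetherian J
  let K := (RingHom.ker φ).map (algebraMap P (AdicCompletion J P))
  apply le_antisymm
  · intro x hx
    have key : ∀ n, x ∈ K ⊔ (maximalIdeal (AdicCompletion J P)) ^ n := by
      intro n
      obtain ⟨y, hy⟩ := Ideal.Quotient.mk_surjective (AdicCompletion.evalₐ J n x)
      have h1 := compMap_eval J I φ hI.le n x y hy.symm
      rw [show compMap J I φ hI.le x = 0 from hx, map_zero, eq_comm, Ideal.Quotient.eq_zero_iff_mem,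
        ← hI, ← Ideal.map_pow, Ideal.mem_map_iff_of_surjective _ hφ] at h1
      obtain ⟨z, hz, hzy⟩ := h1
      have h2 : x = algebraMap P _ (y - z) + ((x - algebraMap P _ y) + algebraMap P _ z) := by
        rw [map_sub]; ring
      rw [h2]
      refine Submodule.add_mem_sup ?_ ?_
      · apply Ideal.mem_map_of_mem
        rw [RingHom.mem_ker, map_sub, hzy, sub_self]
      · rw [AdicCompletion.maximalIdeal_eq_map, ← Ideal.map_pow]
        refine Ideal.add_mem _ ?_ (Ideal.mem_map_of_mem _ hz)
        have h3 := AdicCompletion.pow_smul_top_eq_ker_eval (I := J) (M := P) (n := n) hJ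
        have h4 : AdicCompletion.eval J P n (x - algebraMap P _ y) = 0 := by
          rw [← AdicCompletion.factor_evalₐ_eq_eval (I := J) (h := by simp)]
          rw [map_sub, ← hy]
          rw [AlgHom.commutes]
          simp
        have h5 : x - algebraMap P _ y ∈ (AdicCompletion.eval J P n).ker := h4
        rw [← h3, Ideal.smul_top_eq_map] at h5
        exact h5
    have hK : IsHausdorff (maximalIdeal (AdicCompletion J P)) (AdicCompletion J P ⧸ K) := inferInstance
    rw [← Ideal.Quotient.eq_zero_iff_mem]
    apply hK.haus
    intro n
    rw [SModEq.zero]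
    obtain ⟨a, ha, b, hb, hab⟩ := Submodule.mem_sup.1 (key n)
    rw [← hab, map_add, Ideal.Quotient.eq_zero_iff_mem.2 ha, zero_add]
    have : (Ideal.Quotient.mk K b) = b • (1 : AdicCompletion J P ⧸ K) := by
      rw [Algebra.smul_def, mul_one]; rfl
    rw [this]
    exact Submodule.smul_mem_smul hb trivial
  · rw [Ideal.map_le_iff_le_comap]
    intro y hy
    show compMap J I φ hI.le (algebraMap P _ y) = 0
    rw [compMap_algebraMap, show φ y = 0 from hy, map_zero]

end

section
open TensorProduct IsLocalRing
open RingTheory.Sequence Pointwise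

section lift
variable {R A N : Type u} [CommRing R] [CommRing A] [Algebra R A] [AddCommGroup N] [Module A N]
  [Module R N] [IsScalarTower R A N]

theorem smulReg_devissage [Module.Flat R N] {V : Type u} [AddCommGroup V] [Module R V]
    (W : Submodule R V) (f : A)
    (h1 : IsSMulRegular (N ⊗[R] W) f) (h2 : IsSMulRegular (N ⊗[R] (V ⧸ W)) f) :
    IsSMulRegular (N ⊗[R] V) f := by
  rw [isSMulRegular_iff_right_eq_zero_of_smul] at *
  intro u hu
  let j := TensorProduct.AlgebraTensorModule.lTensor A N W.subtype
  let q := TensorProduct.AlgebraTensorModule.lTensor A N W.mkQ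
  have hj : Function.Injective j := Module.Flat.lTensor_preserves_injective_linearMap W.subtype
    W.injective_subtype
  have hex : Function.Exact j q := lTensor_exact N (LinearMap.exact_subtype_mkQ W) W.mkQ_surjective
  have h3 : q u = 0 := h2 _ (by rw [← map_smul, hu, map_zero])
  obtain ⟨w, rfl⟩ := (hex u).1 h3
  have h4 : w = 0 := h1 _ (hj (by rw [map_smul, hu, map_zero]))
  rw [h4, map_zero]

theorem smulReg_finiteLength [IsLocalRing R] [Module.Flat R N] (f : A)
    (hf : IsSMulRegular (N ⊗[R] (R ⧸ maximalIdeal R)) f) {V : Type u} [AddCommGroup V] [Module R V]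
    (hV : IsFiniteLength R V) : IsSMulRegular (N ⊗[R] V) f := by
  induction hV with
  | of_subsingleton =>
    intro a b _
    exact Subsingleton.elim _ _
  | @of_simple_quotient M _ _ W hs hl ih =>
    refine smulReg_devissage W f ih ?_
    obtain ⟨I, hI, ⟨e⟩⟩ := isSimpleModule_iff_quot_maximal.1 hs
    have := IsLocalRing.eq_maximalIdeal hI
    subst this
    let e' := TensorProduct.AlgebraTensorModule.congr (LinearEquiv.refl A N) e
    exact (e'.isSMulRegular_congr f).2 hf

theorem smulReg_finite [IsLocalRing R] [IsNoetherianRing R] [IsLocalRing A] [IsNoetherianRing A]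
    [IsLocalHom (algebraMap R A)] [Module.Finite A N] [Module.Flat R N] (f : A)
    (hf : IsSMulRegular (N ⊗[R] (R ⧸ maximalIdeal R)) f) {V : Type u} [AddCommGroup V] [Module R V]
    [Module.Finite R V] : IsSMulRegular (N ⊗[R] V) f := by
  have hfin : Module.Finite A (N ⊗[R] V) :=
    Module.Finite.equiv (TensorProduct.AlgebraTensorModule.cancelBaseChange R A A N V)
  rw [isSMulRegular_iff_right_eq_zero_of_smul]
  intro u hu
  have haus : IsHausdorff (maximalIdeal A) (N ⊗[R] V) := inferInstance
  apply haus.haus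
  intro n
  rw [SModEq.zero]
  let W : Submodule R V := (maximalIdeal R) ^ n • ⊤
  have hlen : IsFiniteLength R (V ⧸ W) := by
    have h1 : IsNoetherian R (V ⧸ W) := inferInstance
    have h2 : IsArtinian R (V ⧸ W) := by
      let _ : Module (R ⧸ (maximalIdeal R) ^ n) (V ⧸ W) := inferInstance
      have h3 : IsArtinianRing (R ⧸ (maximalIdeal R) ^ n) := by
        rw [isArtinianRing_iff_isNoetherianRing_krullDimLE_zero]
        refine ⟨inferInstance, ?_⟩
        rw [Ring.krullDimLE_zero_iff]
        intro P hP
        have hc : (P.comap (Ideal.Quotient.mk ((maximalIdeal R) ^ n))) = maximalIdeal R := by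
          have hcp : (P.comap (Ideal.Quotient.mk ((maximalIdeal R) ^ n))).IsPrime := inferInstance
          apply le_antisymm (le_maximalIdeal hcp.ne_top)
          apply Ideal.IsPrime.le_of_pow_le (n := n)
          intro x hx
          rw [Ideal.mem_comap, Ideal.Quotient.eq_zero_iff_mem.2 hx]
          exact zero_mem _
        have : (P.comap (Ideal.Quotient.mk ((maximalIdeal R) ^ n))).IsMaximal := by
          rw [hc]; infer_instance
        rw [← Ideal.map_comap_of_surjective _ Ideal.Quotient.mk_surjective P]
        refine (Ideal.map_eq_top_or_isMaximal_of_surjective _ Ideal.Quotient.mk_surjective this).resolve_left ?_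
        rw [Ideal.map_comap_of_surjective _ Ideal.Quotient.mk_surjective P]
        exact hP.ne_top
      have h4 : Module.Finite (R ⧸ (maximalIdeal R) ^ n) (V ⧸ W) :=
        Module.Finite.of_restrictScalars_finite R _ _
      have h5 : IsArtinian (R ⧸ (maximalIdeal R) ^ n) (V ⧸ W) := inferInstance
      exact isArtinian_of_surjective_algebraMap (S := R) (R := R ⧸ (maximalIdeal R) ^ n)
        Ideal.Quotient.mk_surjective
    exact isFiniteLength_iff_isNoetherian_isArtinian.2 ⟨h1, h2⟩
  have hr := smulReg_finiteLength (N := N) f hf hlen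
  rw [isSMulRegular_iff_right_eq_zero_of_smul] at hr
  let j := TensorProduct.AlgebraTensorModule.lTensor A N W.subtype
  let q := TensorProduct.AlgebraTensorModule.lTensor A N W.mkQ
  have hex : Function.Exact j q := lTensor_exact N (LinearMap.exact_subtype_mkQ W) W.mkQ_surjective
  have h3 : q u = 0 := hr _ (by rw [← map_smul, hu, map_zero])
  obtain ⟨w, rfl⟩ := (hex u).1 h3
  clear h3 hu
  have hle : ∀ r ∈ (maximalIdeal R) ^ n, algebraMap R A r ∈ (maximalIdeal A) ^ n := by
    intro r hr
    have h6 := Ideal.mem_map_of_mem (algebraMap R A) hr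
    rw [Ideal.map_pow] at h6
    exact Ideal.pow_right_mono (((IsLocalRing.local_hom_TFAE (algebraMap R A)).out 0 2).1 (inferInstance : IsLocalHom (algebraMap R A))) n h6
  induction w with
  | zero => rw [map_zero]; exact zero_mem _
  | add x y hx hy => rw [map_add]; exact Submodule.add_mem _ hx hy
  | tmul x y =>
    obtain ⟨y, hy⟩ := y
    show x ⊗ₜ[R] y ∈ _
    induction hy using Submodule.smul_induction_on' with
    | smul r hr v hv =>
      rw [TensorProduct.tmul_smul, ← algebraMap_smul A r]
      exact Submodule.smul_mem_smul (hle r hr) trivial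
    | add a _ b _ ha hb => rw [TensorProduct.tmul_add]; exact Submodule.add_mem _ ha hb

theorem flat_quot [Module.Flat R N] (f : A)
    (h : ∀ I : Ideal R, IsSMulRegular (N ⊗[R] (R ⧸ I)) f) :
    Module.Flat R (QuotSMulTop f N) := by
  rw [Module.Flat.iff_lTensor_injective']
  intro I
  rw [← LinearMap.ker_eq_bot, LinearMap.ker_eq_bot']
  intro z hz
  let π : N →ₗ[A] QuotSMulTop f N := Submodule.mkQ _
  have hπ : Function.Surjective π := Submodule.mkQ_surjective _
  let μ : N →ₗ[R] N := (LinearMap.lsmul A N f).restrictScalars R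
  have hex : Function.Exact μ (π.restrictScalars R) := by
    intro x
    show π x = 0 ↔ _
    rw [Submodule.mkQ_apply, Submodule.Quotient.mk_eq_zero, Submodule.mem_smul_pointwise_iff_exists]
    simp [μ]
  obtain ⟨w, rfl⟩ := LinearMap.rTensor_surjective I (g := π.restrictScalars R) hπ z
  have hcomm : ∀ w : N ⊗[R] I, I.subtype.lTensor _ ((π.restrictScalars R).rTensor I w) =
      (π.restrictScalars R).rTensor R (I.subtype.lTensor _ w) := by
    intro w
    rw [← LinearMap.comp_apply, ← LinearMap.comp_apply, LinearMap.lTensor_comp_rTensor,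
      LinearMap.rTensor_comp_lTensor]
  have hμ : ∀ {V : Type u} [AddCommGroup V] [Module R V] (x : N ⊗[R] V), μ.rTensor V x = f • x := by
    intro V _ _ x
    induction x with
    | zero => simp
    | add x y hx hy => rw [map_add, hx, hy, smul_add]
    | tmul x y => rfl
  rw [hcomm] at hz
  obtain ⟨v, hv⟩ := (rTensor_exact R hex hπ _).1 hz
  rw [hμ] at hv
  let q := TensorProduct.AlgebraTensorModule.lTensor A N (Submodule.mkQ I)
  let j := TensorProduct.AlgebraTensorModule.lTensor A N (I.subtype)
  have hjq : Function.Exact j q := lTensor_exact N (LinearMap.exact_subtype_mkQ I) I.mkQ_surjective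
  have hj : Function.Injective j := Module.Flat.lTensor_preserves_injective_linearMap I.subtype
    I.injective_subtype
  have hqv : q v = 0 := by
    apply (isSMulRegular_iff_right_eq_zero_of_smul.1 (h I))
    rw [← map_smul, hv]
    exact (hjq _).2 ⟨w, rfl⟩
  obtain ⟨v1, rfl⟩ := (hjq _).1 hqv
  have : f • v1 = w := by
    apply hj
    rw [map_smul, hv]
    rfl
  rw [← this, ← hμ]
  exact (rTensor_exact I hex hπ _).2 ⟨v1, rfl⟩

theorem quotSMulTop_tensor (f : A) (V : Type u) [AddCommGroup V] [Module R V] :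
    Nonempty (QuotSMulTop f (N ⊗[R] V) ≃ₗ[A] (QuotSMulTop f N) ⊗[R] V) := by
  let π : N →ₗ[A] QuotSMulTop f N := Submodule.mkQ _
  have hπ : Function.Surjective π := Submodule.mkQ_surjective _
  let μ : N →ₗ[R] N := (LinearMap.lsmul A N f).restrictScalars R
  have hex : Function.Exact μ (π.restrictScalars R) := by
    intro x
    show π x = 0 ↔ _
    rw [Submodule.mkQ_apply, Submodule.Quotient.mk_eq_zero, Submodule.mem_smul_pointwise_iff_exists]
    simp [μ]
  have hμ : ∀ {V : Type u} [AddCommGroup V] [Module R V] (x : N ⊗[R] V), μ.rTensor V x = f • x := by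
    intro V _ _ x
    induction x with
    | zero => simp
    | add x y hx hy => rw [map_add, hx, hy, smul_add]
    | tmul x y => rfl
  let q := TensorProduct.AlgebraTensorModule.map π (LinearMap.id : V →ₗ[R] V)
  have hq : Function.Surjective q := LinearMap.rTensor_surjective V (g := π.restrictScalars R) hπ
  have hk : f • (⊤ : Submodule A (N ⊗[R] V)) = LinearMap.ker q := by
    ext x
    rw [LinearMap.mem_ker, Submodule.mem_smul_pointwise_iff_exists]
    refine Iff.trans ?_ (rTensor_exact V hex hπ x).symm
    simp [hμ]
  exact ⟨(Submodule.quotEquivOfEq _ _ hk).trans (q.quotKerEquivOfSurjective hq)⟩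

end lift

theorem wreg_lift {R A : Type u} [CommRing R] [CommRing A] [Algebra R A] [IsLocalRing R]
    [IsNoetherianRing R] [IsLocalRing A] [IsNoetherianRing A] [IsLocalHom (algebraMap R A)]
    (rs : List A) (hm : ∀ r ∈ rs, r ∈ maximalIdeal A) :
    ∀ {N : Type u} [AddCommGroup N] [Module A N] [Module R N] [IsScalarTower R A N]
      [Module.Finite A N] [Module.Flat R N],
      IsWeaklyRegular (N ⊗[R] (R ⧸ maximalIdeal R)) rs → IsWeaklyRegular N rs := by
  induction rs with
  | nil => intros; exact IsWeaklyRegular.nil _ _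
  | cons f rs ih =>
    intro N _ _ _ _ _ _ h
    rw [isWeaklyRegular_cons_iff] at h ⊢
    have h1 : ∀ {V : Type u} [AddCommGroup V] [Module R V] [Module.Finite R V],
      IsSMulRegular (N ⊗[R] V) f := by
      intro V _ _ _; exact smulReg_finite f h.1
    have h2 : IsSMulRegular N f := by
      let e : N ⊗[R] R ≃ₗ[A] N := TensorProduct.AlgebraTensorModule.rid R A N
      exact (e.isSMulRegular_congr f).1 h1
    refine ⟨h2, ?_⟩
    have h3 := flat_quot (N := N) f (fun I => h1)
    obtain ⟨e⟩ := quotSMulTop_tensor (R := R) (N := N) f (R ⧸ maximalIdeal R)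
    exact ih (fun r hr => hm r (List.mem_cons_of_mem _ hr)) ((e.isWeaklyRegular_congr rs).1 h.2)

end

section
open TensorProduct IsLocalRing
open RingTheory.Sequence Pointwise

theorem wr_iff {A : Type u} [CommRing A] (rs : List A) :
    IsWeaklyRegular A rs ↔ ∀ i (h : i < rs.length) (a : A),
      rs[i] * a ∈ Ideal.ofList (rs.take i) → a ∈ Ideal.ofList (rs.take i) := by
  rw [isWeaklyRegular_iff]
  refine forall_congr' fun i => forall_congr' fun h => ?_
  have hE : (Ideal.ofList (rs.take i) • ⊤ : Submodule A A) = Ideal.ofList (rs.take i) := by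
    rw [smul_eq_mul, Ideal.mul_top]
  rw [hE, isSMulRegular_iff_right_eq_zero_of_smul]
  constructor
  · intro H a ha
    have := H (Submodule.Quotient.mk a)
    rw [← Submodule.Quotient.mk_smul, Submodule.Quotient.mk_eq_zero,
      Submodule.Quotient.mk_eq_zero] at this
    exact this ha
  · intro H x
    obtain ⟨a, rfl⟩ := Submodule.Quotient.mk_surjective _ x
    rw [← Submodule.Quotient.mk_smul, Submodule.Quotient.mk_eq_zero,
      Submodule.Quotient.mk_eq_zero]
    exact H a

theorem wr_flat {A B : Type u} [CommRing A] [CommRing B] (φ : A →+* B) (hφ : φ.Flat)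
    (rs : List A) (h : IsWeaklyRegular A rs) : IsWeaklyRegular B (rs.map φ) := by
  let _ := φ.toAlgebra
  have : Module.Flat A B := hφ
  exact IsWeaklyRegular.of_flat (S := B) h

theorem wr_descend {A B : Type u} [CommRing A] [CommRing B] (φ : A →+* B) (hφ : φ.FaithfullyFlat)
    (rs : List A) (h : IsWeaklyRegular B (rs.map φ)) : IsWeaklyRegular A rs := by
  let _ := φ.toAlgebra
  have : Module.FaithfullyFlat A B := hφ
  rw [wr_iff] at *
  intro i hi a ha
  have h1 := h i (by simpa using hi) (φ a)
  rw [← List.map_take, ← Ideal.map_ofList] at h1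
  have h2 : ∀ (I : Ideal A) b, φ b ∈ I.map φ → b ∈ I := by
    intro I b hb
    have := Ideal.comap_map_eq_self_of_faithfullyFlat (B := B) I
    rw [← this]; exact hb
  apply h2
  apply h1
  have := Ideal.mem_map_of_mem φ ha
  simpa using this

theorem GRS_of {A : Type u} [CommRing A] [IsLocalRing A] (rs : List A) (h : IsWeaklyRegular A rs)
    (hm : ∀ r ∈ rs, r ∈ maximalIdeal A) (I : Ideal A) (hI : Ideal.span {x | x ∈ rs} = I) :
    GeneratedByRegularSequence A I :=
  ⟨rs, (IsLocalRing.isRegular_iff_isWeaklyRegular_of_subset_maximalIdeal hm).2 h, hI⟩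

theorem GRS_mem {A : Type u} [CommRing A] [IsLocalRing A] (rs : List A) (h : IsRegular A rs) :
    ∀ r ∈ rs, r ∈ maximalIdeal A := by
  intro r hr
  by_contra hn
  apply h.top_ne_smul
  have : Ideal.ofList rs = ⊤ := by
    have hx : r ∈ Ideal.ofList rs := Ideal.subset_span hr
    refine Ideal.eq_top_of_isUnit_mem _ hx ?_
    simpa using hn
  rw [this, smul_eq_mul, Ideal.mul_top]

theorem GRS_flat {A B : Type u} [CommRing A] [CommRing B] [IsLocalRing A] [IsLocalRing B]
    (φ : A →+* B) [IsLocalHom φ] (hφ : φ.Flat) (I : Ideal A) (h : GeneratedByRegularSequence A I) :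
    GeneratedByRegularSequence B (I.map φ) := by
  obtain ⟨rs, h1, h2⟩ := h
  refine GRS_of (rs.map φ) (wr_flat φ hφ rs h1.1) ?_ _ ?_
  · intro r hr
    obtain ⟨a, ha, rfl⟩ := List.mem_map.1 hr
    have := GRS_mem rs h1 a ha
    rw [mem_maximalIdeal, mem_nonunits_iff] at this ⊢
    exact fun hu => this (isUnit_of_map_unit φ a hu)
  · rw [← h2]
    exact (Ideal.map_ofList φ rs).symm

theorem wr_quot {P P' : Type u} [CommRing P] [CommRing P'] (π : P →+* P')
    (hπ : Function.Surjective π) (rs ts : List P) (hrs : IsWeaklyRegular P rs)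
    (hk : Ideal.span {x | x ∈ rs} = RingHom.ker π) (hts : IsWeaklyRegular P' (ts.map π)) :
    IsWeaklyRegular P (rs ++ ts) := by
  rw [isWeaklyRegular_append_iff]
  refine ⟨hrs, ?_⟩
  let _ := π.toAlgebra
  have h1 : IsWeaklyRegular P' ts := (isWeaklyRegular_map_algebraMap_iff (S := P') (M := P') ts).1 hts
  have hE : (Ideal.ofList rs • ⊤ : Submodule P P) = LinearMap.ker (Algebra.linearMap P P') := by
    rw [smul_eq_mul, Ideal.mul_top]
    exact hk
  let e : (P ⧸ (Ideal.ofList rs • ⊤ : Submodule P P)) ≃ₗ[P] P' :=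
    (Submodule.quotEquivOfEq _ _ hE).trans
      ((Algebra.linearMap P P').quotKerEquivOfSurjective hπ)
  exact (e.isWeaklyRegular_congr ts).2 h1

theorem GRS_comp {P P' C : Type u} [CommRing P] [CommRing P'] [CommRing C] [IsLocalRing P]
    [IsLocalRing P'] (π : P →+* P') (hπ : Function.Surjective π) (ρ : P' →+* C)
    (h1 : GeneratedByRegularSequence P (RingHom.ker π))
    (h2 : GeneratedByRegularSequence P' (RingHom.ker ρ)) :
    GeneratedByRegularSequence P (RingHom.ker (ρ.comp π)) := by
  obtain ⟨rs, hr, hr'⟩ := h1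
  obtain ⟨ts, ht, ht'⟩ := h2
  obtain ⟨ts, rfl⟩ : ∃ l : List P, l.map π = ts := (List.map_surjective_iff.2 hπ) ts
  have hloc : IsLocalHom π := hπ.isLocalHom
  refine GRS_of (rs ++ ts) (wr_quot π hπ rs ts hr.1 hr' ht.1) ?_ _ ?_
  · intro r h
    rcases List.mem_append.1 h with h | h
    · exact GRS_mem rs hr r h
    · have := GRS_mem _ ht (π r) (List.mem_map_of_mem h)
      rw [mem_maximalIdeal, mem_nonunits_iff] at this ⊢
      exact fun hu => this (hu.map π)
  · show Ideal.ofList (rs ++ ts) = _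
    rw [Ideal.ofList_append]
    have e1 : Ideal.ofList rs = RingHom.ker π := hr'
    have e2 : Ideal.ofList (ts.map π) = RingHom.ker ρ := ht'
    rw [e1, ← RingHom.comap_ker, ← e2, ← Ideal.map_ofList, Ideal.comap_map_of_surjective' _ hπ,
      sup_comm]

end

section
open TensorProduct IsLocalRing
open RingTheory.Sequence Pointwise

noncomputable def kZ {C : Type*} {τ : Type*} [Fintype τ] [CommRing C] (y : τ → C) : Submodule C (τ → C) :=
  LinearMap.ker (Fintype.linearCombination C y)

open Classical in
noncomputable def kB {C : Type*} {τ : Type*} [Fintype τ] [CommRing C] (y : τ → C) : Submodule C (τ → C) :=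
  Submodule.span C {w | ∃ i j, w = y i • (Pi.single j (1 : C) : τ → C) - y j • Pi.single i 1}

abbrev kH {C : Type*} {τ : Type*} [Fintype τ] [CommRing C] (y : τ → C) : Type _ :=
  ↥(kZ y) ⧸ (kB y).comap (kZ y).subtype

theorem lc_single {C : Type*} {τ : Type*} [Fintype τ] [DecidableEq τ] [CommRing C] (y : τ → C) (i : τ) :
    Fintype.linearCombination C y (Pi.single i 1) = y i := by
  rw [Fintype.linearCombination_apply_single, one_smul]

theorem kB_le {C : Type*} {τ : Type*} [Fintype τ] [CommRing C] (y : τ → C) : kB y ≤ kZ y := by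
  classical
  unfold kB
  rw [Submodule.span_le]
  rintro w ⟨i, j, rfl⟩
  show _ ∈ LinearMap.ker _
  rw [LinearMap.mem_ker, map_sub, map_smul, map_smul, Fintype.linearCombination_apply_single,
    Fintype.linearCombination_apply_single]
  simp [mul_comm]

theorem kB_map {P C : Type*} {τ : Type*} [Fintype τ] [CommRing P] [CommRing C] [Algebra P C]
    (hs : Function.Surjective (algebraMap P C)) (y : τ → P) (y' : τ → C)
    (hy : ∀ t, y' t = algebraMap P C (y t)) (w : τ → C) :
    w ∈ kB y' ↔ ∃ v ∈ kB y, ∀ t, w t = algebraMap P C (v t) := by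
  classical
  let L : (τ → P) →ₗ[P] (τ → C) := (Algebra.linearMap P C).compLeft τ
  have hL : ∀ i, L (Pi.single i 1) = Pi.single i 1 := by
    intro i; ext t
    simp only [L, LinearMap.compLeft_apply, Function.comp, Algebra.linearMap_apply]
    by_cases h : t = i
    · subst h; simp
    · simp [h]
  have h1 : (kB y').restrictScalars P = (kB y).map L := by
    unfold kB
    rw [Submodule.restrictScalars_span _ _ hs, Submodule.map_span]
    congr 1
    ext w
    constructor
    · rintro ⟨i, j, rfl⟩
      refine ⟨_, ⟨i, j, rfl⟩, ?_⟩
      rw [map_sub, map_smul, map_smul, hL, hL, hy, hy, algebraMap_smul, algebraMap_smul]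
    · rintro ⟨_, ⟨i, j, rfl⟩, rfl⟩
      refine ⟨i, j, ?_⟩
      rw [map_sub, map_smul, map_smul, hL, hL, hy, hy, algebraMap_smul, algebraMap_smul]
  rw [← Submodule.restrictScalars_mem P, h1]
  constructor
  · rintro ⟨v, hv, rfl⟩
    exact ⟨v, hv, fun t => rfl⟩
  · rintro ⟨v, hv, h⟩
    exact ⟨v, hv, funext fun t => (h t).symm⟩

theorem koszul_len {P C : Type u} {τ : Type} [Fintype τ] [CommRing P] [IsLocalRing P] [CommRing C]
    [Algebra P C] (hs : Function.Surjective (algebraMap P C)) (p : τ → Prop) [DecidablePred p]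
    (y : τ → P) (y' : τ → C) (hy : ∀ t, y' t = algebraMap P C (y t))
    (hm : ∀ t, y t ∈ maximalIdeal P)
    (hgen : ∀ r ∈ maximalIdeal P, ∃ c : τ → P, (∀ t, ¬ p t → c t = 0) ∧ ∑ t, c t * y t = r)
    (hsyz : ∀ c : τ → P, (∀ t, ¬ p t → c t = 0) → ∑ t, c t * y t = 0 → c ∈ kB y)
    (J : Ideal P) (hJ : J = RingHom.ker (algebraMap P C)) (hJm : J ≤ maximalIdeal P) :
    Module.length C (kH y') =
      Module.length P (J ⧸ (maximalIdeal P • ⊤ : Submodule P J)) + Fintype.card {t // ¬ p t} := by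
  classical
  set m := maximalIdeal P with hmdef
  let σ : (τ → P) →ₗ[P] P := Fintype.linearCombination P y
  have hσ : ∀ w, σ w = ∑ t, w t * y t := fun w => Fintype.linearCombination_apply P y w
  let Z : Submodule P (τ → P) := Submodule.comap σ J
  let σZ : Z →ₗ[P] J := σ.restrict (fun w hw => hw)
  let F : Z →ₗ[P] (J ⧸ (m • ⊤ : Submodule P J)) × ({t // ¬ p t} → P ⧸ m) :=
    ((Submodule.mkQ _).comp σZ).prod
      (LinearMap.pi fun t => (Submodule.mkQ m).comp ((LinearMap.proj t.1).comp Z.subtype))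
  have hmJ : ∀ j : J, j ∈ (m • ⊤ : Submodule P J) ↔ (j : P) ∈ m * J := by
    intro j
    rw [Submodule.mem_smul_top_iff, smul_eq_mul]
  have hF : ∀ w : Z, F w = 0 ↔ σ w ∈ m * J ∧ ∀ t, ¬ p t → (w : τ → P) t ∈ m := by
    intro w
    show ((Submodule.Quotient.mk (σZ w), fun t : {t // ¬ p t} => Submodule.Quotient.mk ((w : τ → P) t.1)) : (J ⧸ (m • ⊤ : Submodule P J)) × ({t // ¬ p t} → P ⧸ m)) = 0 ↔ _
    rw [Prod.mk_eq_zero, Submodule.Quotient.mk_eq_zero, hmJ, funext_iff]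
    refine and_congr Iff.rfl ?_
    constructor
    · intro h t ht
      exact (Submodule.Quotient.mk_eq_zero m).1 (h ⟨t, ht⟩)
    · intro h t
      exact (Submodule.Quotient.mk_eq_zero m).2 (h t.1 t.2)
  have hFs : Function.Surjective F := by
    rintro ⟨j, b⟩
    obtain ⟨j, rfl⟩ := Submodule.Quotient.mk_surjective _ j
    choose b' hb' using fun t => Submodule.Quotient.mk_surjective m (b t)
    let w0 : τ → P := fun t => if h : ¬ p t then b' ⟨t, h⟩ else 0
    have h0 : (j : P) - σ w0 ∈ m := by
      refine Ideal.sub_mem _ (hJm j.2) ?_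
      rw [hσ]
      exact Ideal.sum_mem _ fun t _ => Ideal.mul_mem_left _ _ (hm t)
    obtain ⟨c, hc, hc'⟩ := hgen _ h0
    have hw : σ (c + w0) = j := by
      rw [map_add, hσ c, hc']; ring
    refine ⟨⟨c + w0, by show σ _ ∈ J; rw [hw]; exact j.2⟩, ?_⟩
    refine Prod.ext ?_ ?_
    · show Submodule.Quotient.mk (σZ _) = _
      congr 1
      exact Subtype.ext hw
    · funext t
      show Submodule.Quotient.mk ((c + w0) t.1) = b t
      rw [← hb' t]
      congr 1
      simp [hc t.1 t.2, w0, t.2]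
  let L : (τ → P) →ₗ[P] (τ → C) := (Algebra.linearMap P C).compLeft τ
  have hLσ : ∀ w : τ → P, Fintype.linearCombination C y' (L w) = algebraMap P C (σ w) := by
    intro w
    rw [Fintype.linearCombination_apply, hσ, map_sum]
    refine Finset.sum_congr rfl fun t _ => ?_
    rw [map_mul, hy]; rfl
  let LZ : Z →ₗ[P] kZ y' := (L.comp Z.subtype).codRestrict ((kZ y').restrictScalars P) (by
    intro w
    show _ ∈ LinearMap.ker _
    rw [LinearMap.mem_ker]
    refine (hLσ w).trans ?_
    have := w.2
    have h3 : σ w ∈ J := w.2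
    rw [hJ] at h3
    exact h3)
  let G : Z →ₗ[P] kH y' := ((Submodule.mkQ _).restrictScalars P).comp LZ
  have hG : ∀ w : Z, G w = 0 ↔ L w ∈ kB y' := by
    intro w
    show Submodule.Quotient.mk (LZ w) = _ ↔ _
    rw [Submodule.Quotient.mk_eq_zero]
    rfl
  have hGs : Function.Surjective G := by
    intro h
    obtain ⟨⟨v, hv⟩, rfl⟩ := Submodule.Quotient.mk_surjective _ h
    choose w hw using fun t => hs (v t)
    have hLw : L w = v := funext hw
    refine ⟨⟨w, ?_⟩, ?_⟩
    · show σ w ∈ J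
      rw [hJ, RingHom.mem_ker, ← hLσ, hLw]
      exact hv
    · show Submodule.Quotient.mk (LZ _) = _
      congr 1
      exact Subtype.ext hLw
  have hker : LinearMap.ker F = LinearMap.ker G := by
    ext w
    rw [LinearMap.mem_ker, LinearMap.mem_ker, hF, hG]
    constructor
    · rintro ⟨h1, h2⟩
      have hj : ∃ j : τ → P, (∀ t, ¬ p t → j t = 0) ∧ (∀ t, j t ∈ J) ∧ σ j = σ w := by
        refine Submodule.smul_induction_on (p := fun s => ∃ j : τ → P, (∀ t, ¬ p t → j t = 0) ∧ (∀ t, j t ∈ J) ∧ σ j = s) h1 ?_ ?_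
        · intro r hr n hn
          obtain ⟨c, hc, hc'⟩ := hgen r hr
          refine ⟨n • c, fun t ht => by simp [hc t ht], fun t => Ideal.mul_mem_right _ _ hn, ?_⟩
          rw [map_smul, hσ, hc', smul_eq_mul, smul_eq_mul, mul_comm]
        · rintro a b ⟨j, h1, h2, rfl⟩ ⟨j', h1', h2', rfl⟩
          exact ⟨j + j', fun t ht => by simp [h1 t ht, h1' t ht], fun t => Ideal.add_mem _ (h2 t) (h2' t),
            map_add _ _ _⟩
      obtain ⟨j, hj1, hj2, hj3⟩ := hj
      have hc : ∀ t, ∃ c : τ → P, (∀ s, ¬ p s → c s = 0) ∧ (¬ p t → σ c = (w : τ → P) t) := by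
        intro t
        by_cases ht : p t
        · exact ⟨0, fun _ _ => rfl, fun h => absurd ht h⟩
        · obtain ⟨c, h, h'⟩ := hgen _ (h2 t ht)
          exact ⟨c, h, fun _ => (hσ c).trans h'⟩
      choose c hc1 hc2 using hc
      -- boundary correction
      let bd : τ → P := ∑ t, if p t then 0 else
        ∑ i, c t i • (y i • (Pi.single t (1 : P) : τ → P) - y t • Pi.single i 1)
      have hbd : bd ∈ kB y := by
        refine Submodule.sum_mem _ fun t _ => ?_
        split_ifs
        · exact zero_mem _
        · refine Submodule.sum_mem _ fun i _ => Submodule.smul_mem _ _ (Submodule.subset_span ?_)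
          exact ⟨i, t, by simp only [Pi.single]⟩
      have hbdσ : σ bd = 0 := kB_le y hbd
      have hbdt : ∀ s, ¬ p s → bd s = (w : τ → P) s := by
        intro s hsp
        rw [← hc2 s hsp, hσ]
        simp only [bd, Finset.sum_apply]
        rw [Finset.sum_eq_single s]
        · rw [if_neg hsp, Finset.sum_apply]
          refine Finset.sum_congr rfl fun i _ => ?_
          by_cases his : i = s
          · subst his
            simp [hc1 _ i hsp]
          · simp [Pi.single_apply, Ne.symm his]
        · intro t _ hts
          split_ifs with h
          · rfl
          · rw [Finset.sum_apply]
            refine Finset.sum_eq_zero fun i _ => ?_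
            by_cases his : i = s
            · subst his
              simp [hc1 t i hsp]
            · simp [Pi.single_apply, Ne.symm his, Ne.symm hts]
        · simp
      have h4 : (w : τ → P) - bd - j ∈ kB y := by
        apply hsyz
        · intro t ht
          simp [hbdt t ht, hj1 t ht]
        · rw [← hσ, map_sub, map_sub, hbdσ, hj3]; ring
      rw [kB_map hs y y' hy]
      refine ⟨((w : τ → P) - bd - j) + bd, Submodule.add_mem _ h4 hbd, fun t => ?_⟩
      have h5 : algebraMap P C (j t) = 0 := by
        have := hj2 t
        rw [hJ] at this; exact this
      show algebraMap P C ((w : τ → P) t) = _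
      simp [h5]
    · intro h
      obtain ⟨v, hv, hv'⟩ := (kB_map hs y y' hy _).1 h
      have hd : ∀ t, (w : τ → P) t - v t ∈ J := by
        intro t
        rw [hJ, RingHom.mem_ker, map_sub, ← hv' t]
        exact sub_self _
      constructor
      · have h0 : σ v = 0 := kB_le y hv
        have h6 : σ w = σ ((w : τ → P) - v) := by rw [map_sub, h0, sub_zero]
        rw [h6, hσ]
        refine Ideal.sum_mem _ fun t _ => ?_
        rw [mul_comm]
        exact Ideal.mul_mem_mul (hd t) (hm t)
      · intro t _
        have h7 : v t ∈ m := by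
          clear hv' hd
          unfold kB at hv
          induction hv using Submodule.span_induction with
          | zero => exact zero_mem _
          | add a b _ _ ha hb => exact Ideal.add_mem _ ha hb
          | smul a b _ hb => exact Ideal.mul_mem_left _ _ hb
          | mem a ha =>
            obtain ⟨i, k, rfl⟩ := ha
            exact Ideal.sub_mem _ (Ideal.mul_mem_right _ _ (hm i)) (Ideal.mul_mem_right _ _ (hm k))
        have := Ideal.add_mem _ (hJm (hd t)) h7
        simpa using this
  let e := (F.quotKerEquivOfSurjective hFs).symm.trans
    ((Submodule.quotEquivOfEq _ _ hker).trans (G.quotKerEquivOfSurjective hGs))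
  have hlen := e.length_eq
  rw [← Module.length_eq_of_surjective hs, ← hlen, Module.length_prod, Module.length_pi]
  have : IsSimpleModule P (P ⧸ m) := isSimpleModule_iff_quot_maximal.2 ⟨m, inferInstance, ⟨LinearEquiv.refl _ _⟩⟩
  simp [Module.length_eq_one]

end

section
open TensorProduct IsLocalRing
open RingTheory.Sequence Pointwise

theorem kB_peiffer {P : Type*} {τ : Type*} [Fintype τ] [CommRing P] (y : τ → P) (v w : τ → P) :
    Fintype.linearCombination P y v • w - Fintype.linearCombination P y w • v ∈ kB y := by
  classical
  have h : Fintype.linearCombination P y v • w - Fintype.linearCombination P y w • v =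
      ∑ i, ∑ j, (v i * w j) • (y i • (Pi.single j (1 : P) : τ → P) - y j • Pi.single i 1) := by
    ext t
    simp only [Fintype.linearCombination_apply, Pi.sub_apply, Pi.smul_apply, Finset.sum_apply,
      smul_eq_mul, mul_sub, Finset.sum_sub_distrib]
    congr 1
    · simp only [Pi.single_apply, mul_ite, mul_one, mul_zero, Finset.sum_ite_eq, Finset.mem_univ,
        if_true, Finset.sum_mul]
      exact Finset.sum_congr rfl fun i _ => by ring
    · rw [Finset.sum_comm]
      simp only [Pi.single_apply, mul_ite, mul_one, mul_zero, Finset.sum_ite_eq, Finset.mem_univ,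
        if_true, Finset.sum_mul]
      exact Finset.sum_congr rfl fun i _ => by ring
  rw [h]
  refine Submodule.sum_mem _ fun i _ => Submodule.sum_mem _ fun j _ => Submodule.smul_mem _ _ ?_
  refine Submodule.subset_span ⟨i, j, ?_⟩
  simp only [Pi.single]

theorem koszul_len' {P C : Type u} {τ : Type} [Fintype τ] [CommRing P] [IsLocalRing P] [CommRing C]
    [IsLocalRing C] (π : P →+* C) (hs : Function.Surjective π)
    (rs : List P) (hrs : IsWeaklyRegular P rs) (hspan : Ideal.span {x | x ∈ rs} = maximalIdeal P)
    (e : Fin rs.length → τ) (he : Function.Injective e) (y' : τ → C)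
    (hy : ∀ i, y' (e i) = π (rs.get i)) (hy'm : ∀ t, y' t ∈ maximalIdeal C) :
    Module.length C (kH y') + rs.length =
      Module.length P (RingHom.ker π ⧸ (maximalIdeal P • ⊤ : Submodule P (RingHom.ker π))) +
        Fintype.card τ := by
  classical
  let _ := π.toAlgebra
  let p : τ → Prop := fun t => t ∈ Set.range e
  have hloc : IsLocalHom π := hs.isLocalHom
  have hlift : ∀ t, ∃ r : P, π r = y' t ∧ (∀ i, e i = t → r = rs.get i) := by
    intro t
    by_cases ht : ∃ i, e i = t
    · obtain ⟨i, rfl⟩ := ht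
      exact ⟨rs.get i, (hy i).symm, fun j hj => by rw [he hj]⟩
    · obtain ⟨r, hr⟩ := hs (y' t)
      exact ⟨r, hr, fun i hi => absurd ⟨i, hi⟩ ht⟩
  choose y hy1 hy2 using hlift
  have hm : ∀ t, y t ∈ maximalIdeal P := by
    intro t
    have := hy'm t
    rw [← hy1, mem_maximalIdeal, mem_nonunits_iff] at this
    rw [mem_maximalIdeal, mem_nonunits_iff]
    exact fun h => this (h.map π)
  have hye : ∀ i, y (e i) = rs.get i := fun i => hy2 _ i rfl
  have hsum : ∀ c : τ → P, (∀ t, ¬ p t → c t = 0) → ∀ {M : Type u} [AddCommGroup M] [Module P M]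
      (f : τ → M), ∑ t, c t • f t = ∑ i, c (e i) • f (e i) := by
    intro c hc M _ _ f
    rw [← Finset.sum_image (s := Finset.univ) (g := e) (f := fun t => c t • f t) (fun _ _ _ _ h => he h)]
    symm
    refine Finset.sum_subset (Finset.subset_univ _) ?_
    intro t _ ht
    rw [hc t (by rintro ⟨i, rfl⟩; exact ht (Finset.mem_image_of_mem _ (Finset.mem_univ _))), zero_smul]
  have hgen : ∀ r ∈ maximalIdeal P, ∃ c : τ → P, (∀ t, ¬ p t → c t = 0) ∧ ∑ t, c t * y t = r := by
    intro r hr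
    rw [← hspan] at hr
    have hset : {x | x ∈ rs} = Set.range rs.get := by
      ext x; simp [List.mem_iff_get]
    rw [hset, Ideal.span, Submodule.mem_span_range_iff_exists_fun] at hr
    obtain ⟨c, hc⟩ := hr
    refine ⟨Function.extend e c (fun _ => 0), fun t ht => Function.extend_apply' c _ t ht, ?_⟩
    refine (hsum _ (fun t ht => Function.extend_apply' c _ t ht) y).trans ?_
    rw [← hc]
    refine Finset.sum_congr rfl fun i _ => ?_
    rw [he.extend_apply, hye]
  have hsyz : ∀ c : τ → P, (∀ t, ¬ p t → c t = 0) → ∑ t, c t * y t = 0 → c ∈ kB y := by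
    intro c hc h0
    let M := (τ → P) ⧸ kB y
    let d : M →ₗ[P] P := (kB y).liftQ (Fintype.linearCombination P y) (kB_le y)
    have hp : ∀ v w : M, d v • w = d w • v := by
      intro v w
      obtain ⟨v, rfl⟩ := Submodule.Quotient.mk_surjective _ v
      obtain ⟨w, rfl⟩ := Submodule.Quotient.mk_surjective _ w
      refine (Submodule.Quotient.eq (kB y)).2 ?_
      exact kB_peiffer y v w
    have key := peiffer_syz_list d hp rs hrs
      (fun i => Submodule.Quotient.mk (Pi.single (e i) (1 : P))) (fun i => by
        show Fintype.linearCombination P y _ = _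
        rw [lc_single, hye]) (fun i => c (e i)) (by
        rw [← h0]
        refine Eq.trans ?_ (hsum c hc y).symm
        exact Finset.sum_congr rfl fun i _ => by rw [hye]; rfl)
    have h2 : c = ∑ i, c (e i) • (Pi.single (e i) (1 : P) : τ → P) := by
      refine Eq.trans ?_ (hsum c hc (fun t => (Pi.single t (1 : P) : τ → P)))
      ext t
      simp [Finset.sum_apply, Pi.single_apply]
    rw [← Submodule.Quotient.mk_eq_zero, ← key]
    conv_lhs => rw [h2]
    exact map_sum (kB y).mkQ _ _
  have hJm : RingHom.ker π ≤ maximalIdeal P := by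
    refine IsLocalRing.le_maximalIdeal ?_
    exact RingHom.ker_ne_top π
  have := koszul_len (P := P) (C := C) hs p y y' (fun t => (hy1 t).symm) hm hgen hsyz (RingHom.ker π) rfl hJm
  rw [this, add_assoc]
  congr 1
  have hcard : Fintype.card {t // ¬ p t} + rs.length = Fintype.card τ := by
    have h3 : Fintype.card {t // p t} = rs.length := by
      have := Fintype.card_congr (Equiv.ofInjective e he)
      rw [Fintype.card_fin] at this
      refine Eq.trans ?_ this.symm
      exact Fintype.card_congr (Equiv.refl _)
    have := Fintype.card_subtype_compl p
    have h4 := Fintype.card_subtype_le p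
    omega
  exact_mod_cast hcard

theorem CI_num {P Q C : Type u} [CommRing P] [IsLocalRing P] [CommRing Q] [IsLocalRing Q] [CommRing C]
    [IsLocalRing C] (π : P →+* C) (hπ : Function.Surjective π) (ρ : Q →+* C) (hρ : Function.Surjective ρ)
    (xs : List P) (hxs : IsWeaklyRegular P xs) (hx : Ideal.span {x | x ∈ xs} = maximalIdeal P)
    (zs : List Q) (hzs : IsWeaklyRegular Q zs) (hz : Ideal.span {x | x ∈ zs} = maximalIdeal Q) :
    Module.length P (RingHom.ker π ⧸ (maximalIdeal P • ⊤ : Submodule P (RingHom.ker π))) + zs.length =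
    Module.length Q (RingHom.ker ρ ⧸ (maximalIdeal Q • ⊤ : Submodule Q (RingHom.ker ρ))) + xs.length := by
  have hmax : ∀ {A : Type u} [CommRing A] [IsLocalRing A] (f : A →+* C) (hf : Function.Surjective f)
      (l : List A) (hl : Ideal.span {x | x ∈ l} = maximalIdeal A) (i : Fin l.length),
      f (l.get i) ∈ maximalIdeal C := by
    intro A _ _ f hf l hl i
    have : IsLocalHom f := hf.isLocalHom
    have h1 : l.get i ∈ maximalIdeal A := by
      rw [← hl]; exact Ideal.subset_span (List.get_mem _ _)
    rw [mem_maximalIdeal, mem_nonunits_iff] at h1 ⊢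
    exact fun h => h1 (isUnit_of_map_unit f _ h)
  let y : Fin xs.length ⊕ Fin zs.length → C :=
    Sum.elim (fun i => π (xs.get i)) (fun i => ρ (zs.get i))
  have hy : ∀ t, y t ∈ maximalIdeal C := by
    rintro (i | i)
    · exact hmax π hπ xs hx i
    · exact hmax ρ hρ zs hz i
  have h1 := koszul_len' π hπ xs hxs hx Sum.inl Sum.inl_injective y (fun i => rfl) hy
  have h2 := koszul_len' ρ hρ zs hzs hz Sum.inr Sum.inr_injective y (fun i => rfl) hy
  rw [Fintype.card_sum, Fintype.card_fin, Fintype.card_fin, Nat.cast_add] at h1 h2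
  generalize Module.length C (kH y) = H at h1 h2
  rw [add_comm (xs.length : ℕ∞), ← add_assoc] at h1
  rw [add_comm (xs.length : ℕ∞), ← add_assoc, add_right_comm] at h2
  exact (WithTop.add_right_cancel (ENat.coe_ne_top xs.length) h1).symm.trans
    (WithTop.add_right_cancel (ENat.coe_ne_top zs.length) h2)

end

section
open TensorProduct IsLocalRing
open RingTheory.Sequence Pointwise

open CategoryTheory Abelian Limits in
theorem dep_exchange {P : Type u} [CommRing P] [IsLocalRing P] [IsNoetherianRing P] {M : Type u}
    [AddCommGroup M] [Module P M] [Module.Finite P M] [Nontrivial M] (n : ℕ) (rs : List P)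
    (hlen : rs.length = n + 1) (hm : ∀ r ∈ rs, r ∈ maximalIdeal P) (hrs : IsRegular M rs)
    (y : P) (hy : y ∈ maximalIdeal P) (hyr : IsSMulRegular M y) :
    ∃ rs' : List P, rs'.length = n ∧ (∀ r ∈ rs', r ∈ maximalIdeal P) ∧
      IsRegular (QuotSMulTop y M) rs' := by
  let N : ModuleCat.{u} P := ModuleCat.of P (P ⧸ maximalIdeal P)
  have hN : Module.support P N = PrimeSpectrum.zeroLocus (maximalIdeal P : Set P) := by
    rw [Module.support_eq_zeroLocus]
    show PrimeSpectrum.zeroLocus (Module.annihilator P (P ⧸ maximalIdeal P) : Set P) = _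
    rw [Ideal.annihilator_quotient]
  have hnt : ∀ {V : Type u} [AddCommGroup V] [Module P V] [Module.Finite P V] [Nontrivial V],
      maximalIdeal P • (⊤ : Submodule P V) < ⊤ := by
    intro V _ _ _ _
    refine lt_top_iff_ne_top.2 fun h => ?_
    have := Submodule.eq_bot_of_le_smul_of_le_jacobson_bot (maximalIdeal P) (⊤ : Submodule P V)
      Module.Finite.fg_top h.ge (IsLocalRing.maximalIdeal_le_jacobson _)
    exact bot_ne_top this.symm
  have hfin : Module.Finite P N := inferInstanceAs (Module.Finite P (P ⧸ maximalIdeal P))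
  have hext := ModuleCat.subsingleton_ext_of_exists_isRegular (maximalIdeal P) N hN.subset
    (ModuleCat.of P M) hnt rs hm hrs
  rw [hlen] at hext
  have : Nontrivial (QuotSMulTop y M) := nontrivial_quotSMulTop_of_mem_maximalIdeal M hy
  refine ModuleCat.exists_isRegular_of_exists_subsingleton_ext (maximalIdeal P) n
    (ModuleCat.of P (QuotSMulTop y M)) hnt N hN ?_
  intro i hi
  have zero1 := AddCommGrpCat.isZero_of_iff_subsingleton.mpr (hext i (by omega))
  have zero2 := AddCommGrpCat.isZero_of_iff_subsingleton.mpr (hext (i + 1) (by omega))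
  have hyr' : IsSMulRegular (ModuleCat.of P M) y := hyr
  exact AddCommGrpCat.subsingleton_of_isZero <| ShortComplex.Exact.isZero_of_both_zeros
    ((Ext.covariant_sequence_exact₃' N hyr'.smulShortComplex_shortExact) i (i + 1) rfl)
    (zero1.eq_zero_of_src _) (zero2.eq_zero_of_tgt _)

theorem dim_quot_list {P : Type u} [CommRing P] [IsLocalRing P] [IsNoetherianRing P] (ys : List P)
    (hm : ∀ r ∈ ys, r ∈ maximalIdeal P) (p : Ideal P) :
    ringKrullDim (P ⧸ p) ≤ ringKrullDim (P ⧸ (p ⊔ Ideal.ofList ys)) + ys.length := by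
  classical
  by_cases hp : p = ⊤
  · subst hp
    have : Subsingleton (P ⧸ (⊤ : Ideal P)) := Ideal.Quotient.subsingleton_iff.2 rfl
    rw [ringKrullDim_eq_bot_of_subsingleton]
    exact bot_le
  have hnt : Nontrivial (P ⧸ p) := Ideal.Quotient.nontrivial_iff.2 hp
  have hloc : IsLocalRing (P ⧸ p) := IsLocalRing.of_surjective' _ Ideal.Quotient.mk_surjective
  have hlh : IsLocalHom (Ideal.Quotient.mk p) := Ideal.Quotient.mk_surjective.isLocalHom
  let s : Finset (P ⧸ p) := (ys.map (Ideal.Quotient.mk p)).toFinset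
  have h1 := ringKrullDim_le_ringKrullDim_quotient_add_card s (by
    rw [IsLocalRing.ringJacobson_eq_maximalIdeal]
    intro x hx
    simp only [s, List.coe_toFinset, List.mem_map, Set.mem_ofPred_eq] at hx
    obtain ⟨a, ha, rfl⟩ := hx
    have := hm a ha
    rw [mem_maximalIdeal, mem_nonunits_iff] at this
    show _ ∈ maximalIdeal _
    rw [mem_maximalIdeal, mem_nonunits_iff]
    exact fun hu => this (isUnit_of_map_unit _ a hu))
  have hsp : Ideal.span (s : Set (P ⧸ p)) = (Ideal.ofList ys).map (Ideal.Quotient.mk p) := by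
    rw [Ideal.map_ofList]
    simp only [s, List.coe_toFinset]
  rw [hsp, ringKrullDim_eq_of_ringEquiv (DoubleQuot.quotQuotEquivQuotSup p (Ideal.ofList ys))] at h1
  refine h1.trans (add_le_add le_rfl ?_)
  have : s.card ≤ ys.length := (List.toFinset_card_le _).trans (by simp)
  exact_mod_cast this

theorem mem_colon_bot {P M : Type u} [CommRing P] [AddCommGroup M] [Module P M] (u : M) (a : P) :
    a ∈ (⊥ : Submodule P M).colon {u} ↔ a • u = 0 := by
  rw [Submodule.mem_colon_singleton, Submodule.mem_bot]

theorem ass_dim {P : Type u} [CommRing P] [IsLocalRing P] [IsNoetherianRing P] (rs : List P)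
    (hm : ∀ r ∈ rs, r ∈ maximalIdeal P) : ∀ {M : Type u}
    [AddCommGroup M] [Module P M] [Module.Finite P M] (_ : IsWeaklyRegular M rs)
    (p : Ideal P) (_ : IsAssociatedPrime p M), (rs.length : WithBot ℕ∞) ≤ ringKrullDim (P ⧸ p) := by
  induction rs with
  | nil =>
    intro M _ _ _ _ p hp
    have := hp.isPrime
    simpa using ringKrullDim_nonneg_of_nontrivial
  | cons x rs ih =>
    intro M _ _ _ h p hp
    have hpp := hp.isPrime
    obtain ⟨-, u, hu⟩ := isAssociatedPrime_iff.1 hp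
    rw [isWeaklyRegular_cons_iff] at h
    let N : Submodule P M :=
      { carrier := {v | ∀ a ∈ p, a • v = 0}
        add_mem' := by intro a b ha hb c hc; rw [smul_add, ha c hc, hb c hc, add_zero]
        zero_mem' := by intro c _; rw [smul_zero]
        smul_mem' := by intro r v hv c hc; rw [smul_comm, hv c hc, smul_zero] }
    have hxm := hm x (by simp)
    have hreg := isSMulRegular_iff_right_eq_zero_of_smul.1 h.1
    have hu' : ∀ a, a ∈ p ↔ a • u = 0 := fun a => by rw [hu, mem_colon_bot]
    have hu0 : u ≠ 0 := by
      rintro rfl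
      exact hpp.ne_top ((Ideal.eq_top_iff_one _).2 ((hu' 1).2 (smul_zero _)))
    have hxp : x ∉ p := fun hx => hu0 (hreg u ((hu' x).1 hx))
    have huN : u ∈ N := fun a ha => (hu' a).1 ha
    have hv : ∃ v ∈ N, v ∉ (x • ⊤ : Submodule P M) := by
      by_contra hcon
      push Not at hcon
      have hle : N ≤ maximalIdeal P • N := by
        intro v hv
        obtain ⟨w, -, rfl⟩ := (Submodule.mem_smul_pointwise_iff_exists _ _ _).1 (hcon v hv)
        refine Submodule.smul_mem_smul hxm ?_
        intro a ha
        apply hreg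
        rw [smul_comm]
        exact hv a ha
      have := Submodule.eq_bot_of_le_smul_of_le_jacobson_bot (maximalIdeal P) N
        (IsNoetherian.noetherian N) hle (IsLocalRing.maximalIdeal_le_jacobson _)
      rw [this] at huN
      exact hu0 huN
    obtain ⟨v, hvN, hv⟩ := hv
    have hv0 : (Submodule.Quotient.mk v : QuotSMulTop x M) ≠ 0 := by
      rwa [Ne, Submodule.Quotient.mk_eq_zero]
    obtain ⟨q, hq, hvq⟩ := exists_le_isAssociatedPrime_of_isNoetherianRing P _ hv0
    have hqp := hq.isPrime
    have hpq : p ≤ q := by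
      intro a ha
      apply hvq
      rw [mem_colon_bot, ← Submodule.Quotient.mk_smul, hvN a ha]
      rfl
    have hxq : x ∈ q := by
      apply hvq
      rw [mem_colon_bot, ← Submodule.Quotient.mk_smul, Submodule.Quotient.mk_eq_zero]
      exact Submodule.smul_mem_pointwise_smul _ _ _ trivial
    have h1 := ih (fun r hr => hm r (List.mem_cons_of_mem _ hr)) h.2 q hq
    have h2 : Ideal.Quotient.mk p x ∈ nonZeroDivisors (P ⧸ p) := by
      rw [mem_nonZeroDivisors_iff_ne_zero, Ne, Ideal.Quotient.eq_zero_iff_mem]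
      exact hxp
    have h3 := ringKrullDim_quotient_succ_le_of_nonZeroDivisor h2
    have h4 : ringKrullDim (P ⧸ q) ≤
        ringKrullDim ((P ⧸ p) ⧸ Ideal.span {Ideal.Quotient.mk p x}) := by
      refine ringKrullDim_le_of_surjective (Ideal.Quotient.lift _ (Ideal.Quotient.factor hpq) ?_) ?_
      · have hle : Ideal.span {Ideal.Quotient.mk p x} ≤ RingHom.ker (Ideal.Quotient.factor hpq) := by
          rw [Ideal.span_le, Set.singleton_subset_iff]
          show Ideal.Quotient.factor hpq _ = 0
          rw [Ideal.Quotient.factor_mk]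
          exact Ideal.Quotient.eq_zero_iff_mem.2 hxq
        exact fun a ha => hle ha
      · exact Ideal.Quotient.lift_surjective_of_surjective _ _ (Ideal.Quotient.factor_surjective hpq)
    refine le_trans ?_ ((add_le_add (h1.trans h4) le_rfl).trans h3)
    simp

theorem CM_regular {P : Type u} [CommRing P] [IsLocalRing P] [IsNoetherianRing P] (ys : List P)
    (hm : ∀ r ∈ ys, r ∈ maximalIdeal P) : ∀ {M : Type u}
    [AddCommGroup M] [Module P M] [Module.Finite P M] [Nontrivial M] (rs : List P)
    (_ : ∀ r ∈ rs, r ∈ maximalIdeal P) (_ : IsRegular M rs)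
    (_ : ringKrullDim (P ⧸ (Module.annihilator P M ⊔ Ideal.ofList ys)) + ys.length ≤ rs.length),
    IsWeaklyRegular M ys := by
  induction ys with
  | nil => intros; exact IsWeaklyRegular.nil _ _
  | cons y ys ih =>
    intro M _ _ _ _ rs hrm hrs hd
    have hym := hm y (by simp)
    have hysm : ∀ r ∈ ys, r ∈ maximalIdeal P := fun r hr => hm r (List.mem_cons_of_mem _ hr)
    have hofl : Ideal.ofList (y :: ys) ≤ maximalIdeal P := Ideal.span_le.2 hm
    have hann : Module.annihilator P M ≤ maximalIdeal P := by
      refine IsLocalRing.le_maximalIdeal fun h => ?_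
      have := Module.annihilator_eq_top_iff.1 h
      exact not_subsingleton M this
    have hmono : ∀ {I K : Ideal P}, I ≤ K → ringKrullDim (P ⧸ K) ≤ ringKrullDim (P ⧸ I) :=
      fun h => ringKrullDim_le_of_surjective _ (Ideal.Quotient.factor_surjective h)
    have hpos : ∀ {I : Ideal P}, I ≤ maximalIdeal P → 0 ≤ ringKrullDim (P ⧸ I) := by
      intro I hI
      have : Nontrivial (P ⧸ I) := Ideal.Quotient.nontrivial_iff.2
        (fun h => (Ideal.IsPrime.ne_top (inferInstance : (maximalIdeal P).IsPrime)) (top_le_iff.1 (h ▸ hI)))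
      exact ringKrullDim_nonneg_of_nontrivial
    have hy : IsSMulRegular M y := by
      rw [isSMulRegular_iff_right_eq_zero_of_smul]
      intro u hu
      by_contra hu0
      obtain ⟨p, hp, hup⟩ := exists_le_isAssociatedPrime_of_isNoetherianRing P _ hu0
      have hyp : y ∈ p := hup ((mem_colon_bot _ _).2 hu)
      have hpp := hp.isPrime
      have h1 := ass_dim rs hrm hrs.1 p hp
      have h2 := dim_quot_list ys hysm p
      have hannp : Module.annihilator P M ≤ p := by
        have := hp.annihilator_le
        rwa [Submodule.annihilator_top] at this
      have h3 : ringKrullDim (P ⧸ (p ⊔ Ideal.ofList ys)) ≤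
          ringKrullDim (P ⧸ (Module.annihilator P M ⊔ Ideal.ofList (y :: ys))) := by
        apply hmono
        rw [Ideal.ofList_cons]
        refine sup_le (hannp.trans le_sup_left) (sup_le ?_ le_sup_right)
        rw [Ideal.span_singleton_le_iff_mem]
        exact Ideal.mem_sup_left hyp
      have h4 := (h1.trans h2).trans (add_le_add h3 le_rfl)
      have h0 := hpos (sup_le hann hofl)
      revert hd h4 h0
      generalize ringKrullDim (P ⧸ (Module.annihilator P M ⊔ Ideal.ofList (y :: ys))) = D
      intro hd h4 h0
      rw [List.length_cons] at hd
      have h5 := hd.trans h4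
      induction D with
      | bot => simp at h0
      | coe D =>
        induction D with
        | top => exact absurd hd (by
                  rw [not_le]; exact_mod_cast (by simp : ((rs.length : ℕ∞)) < ⊤ + ((ys.length + 1 : ℕ) : ℕ∞)))
        | coe D =>
          norm_cast at h5
          have h6 : D + (ys.length + 1) ≤ D + ys.length := by exact_mod_cast h5
          omega
    rw [isWeaklyRegular_cons_iff]
    refine ⟨hy, ?_⟩
    have hnt : Nontrivial (QuotSMulTop y M) := nontrivial_quotSMulTop_of_mem_maximalIdeal M hym
    have hsplit : ringKrullDim (P ⧸ (Module.annihilator P (QuotSMulTop y M) ⊔ Ideal.ofList ys)) ≤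
        ringKrullDim (P ⧸ (Module.annihilator P M ⊔ Ideal.ofList (y :: ys))) := by
      apply hmono
      rw [Ideal.ofList_cons]
      refine sup_le (le_sup_of_le_left ?_) (sup_le (le_sup_of_le_left ?_) le_sup_right)
      · exact (Submodule.mkQ (y • ⊤ : Submodule P M)).annihilator_le_of_surjective (Submodule.mkQ_surjective _)
      · rw [Ideal.span_singleton_le_iff_mem, Module.mem_annihilator]
        intro v
        obtain ⟨v, rfl⟩ := Submodule.Quotient.mk_surjective _ v
        rw [← Submodule.Quotient.mk_smul, Submodule.Quotient.mk_eq_zero]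
        exact Submodule.smul_mem_pointwise_smul _ _ _ trivial
    have h0 := hpos (sup_le hann hofl)
    rw [List.length_cons] at hd
    have hlen : ∃ n, rs.length = n + 1 := by
      have : ((ys.length + 1 : ℕ) : WithBot ℕ∞) ≤ rs.length :=
        le_trans (by simpa using add_le_add h0 (le_refl ((ys.length + 1 : ℕ) : WithBot ℕ∞))) hd
      have h' : ys.length + 1 ≤ rs.length := by exact_mod_cast this
      exact ⟨rs.length - 1, by omega⟩
    obtain ⟨n, hn⟩ := hlen
    obtain ⟨rs', h1, h2, h3⟩ := dep_exchange n rs hn hrm hrs y hym hy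
    refine ih hysm rs' h2 h3 ?_
    rw [hn] at hd
    rw [h1]
    refine le_trans (add_le_add hsplit le_rfl) ?_
    push_cast at hd
    rw [← add_assoc] at hd
    exact ENat.WithBot.add_le_add_one_right_iff.1 hd

end

section
open TensorProduct IsLocalRing
open RingTheory.Sequence Pointwise

theorem len_le_gens {P : Type u} [CommRing P] [IsLocalRing P] (J : Ideal P) (ys : List P)
    (h : Ideal.span {x | x ∈ ys} = J) :
    Module.length P (J ⧸ (maximalIdeal P • ⊤ : Submodule P J)) ≤ ys.length := by
  have hmem : ∀ i, ys.get i ∈ J := fun i => by rw [← h]; exact Ideal.subset_span (List.get_mem _ _)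
  have hset : {x | x ∈ ys} = Set.range ys.get := by
      ext x; simp [List.mem_iff_get]
  let F : (Fin ys.length → P) →ₗ[P] (J ⧸ (maximalIdeal P • ⊤ : Submodule P J)) :=
    (Submodule.mkQ _).comp (Fintype.linearCombination P (fun i => (⟨ys.get i, hmem i⟩ : J)))
  let N : Submodule P (Fin ys.length → P) := Submodule.pi Set.univ (fun _ => maximalIdeal P)
  have hN : N ≤ LinearMap.ker F := by
    intro w hw
    rw [LinearMap.mem_ker]
    show Submodule.Quotient.mk _ = _
    rw [Submodule.Quotient.mk_eq_zero, Fintype.linearCombination_apply]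
    exact Submodule.sum_mem _ fun i _ => Submodule.smul_mem_smul (hw i trivial) trivial
  have hF : Function.Surjective F := by
    refine (Submodule.mkQ_surjective _).comp ?_
    intro j
    have := j.2
    replace this : (j : P) ∈ Ideal.span {x | x ∈ ys} := h.symm ▸ this
    rw [hset, Ideal.span, Submodule.mem_span_range_iff_exists_fun] at this
    obtain ⟨c, hc⟩ := this
    refine ⟨c, Subtype.ext ?_⟩
    rw [Fintype.linearCombination_apply, ← hc]
    simp
  have h1 := Module.length_le_of_surjective (N.liftQ F hN) (by
    intro v; obtain ⟨w, rfl⟩ := hF v; exact ⟨Submodule.Quotient.mk w, rfl⟩)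
  refine h1.trans (le_of_eq ?_)
  rw [(Submodule.quotientPi (fun _ : Fin ys.length => (maximalIdeal P))).length_eq, Module.length_pi]
  have : IsSimpleModule P (P ⧸ maximalIdeal P) := isSimpleModule_iff_quot_maximal.2
    ⟨maximalIdeal P, inferInstance, ⟨LinearEquiv.refl _ _⟩⟩
  simp [Module.length_eq_one]

theorem pick_gens {P : Type u} [CommRing P] [IsLocalRing P] [IsNoetherianRing P] (J : Ideal P)
    (s : Set P) (hs : Ideal.span s = J) : ∃ ys : List P, (∀ y ∈ ys, y ∈ s) ∧
      Ideal.span {x | x ∈ ys} = J ∧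
      (ys.length : ℕ∞) = Module.length P (J ⧸ (maximalIdeal P • ⊤ : Submodule P J)) := by
  let V := J ⧸ (maximalIdeal P • ⊤ : Submodule P J)
  let k := P ⧸ maximalIdeal P
  let _ : Field k := Ideal.Quotient.field _
  have hsJ : s ⊆ J := by rw [← hs]; exact Ideal.subset_span
  let T : Set V := Set.range (fun y : s => (Submodule.Quotient.mk ⟨y.1, hsJ y.2⟩ : V))
  have hfin : Module.Finite P V := inferInstance
  have hfink : Module.Finite k V := Module.Finite.of_restrictScalars_finite P k V
  have hJ' : Submodule.span P (Set.range (fun y : s => (⟨y.1, hsJ y.2⟩ : J))) = ⊤ := by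
    apply Submodule.map_injective_of_injective (f := J.subtype) J.injective_subtype
    rw [Submodule.map_span, Submodule.map_top, Submodule.range_subtype, ← Set.range_comp]
    have : Set.range (J.subtype ∘ fun y : s => (⟨y.1, hsJ y.2⟩ : J)) = s := by
      ext x; simp
    rw [this]; exact hs
  have hsk : Function.Surjective (algebraMap P k) := Ideal.Quotient.mk_surjective
  have hT : Submodule.span k T = ⊤ := by
    rw [← Submodule.restrictScalars_eq_top_iff P, Submodule.restrictScalars_span _ _ hsk]
    have : T = Submodule.mkQ _ '' (Set.range (fun y : s => (⟨y.1, hsJ y.2⟩ : J))) := by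
      rw [← Set.range_comp]; rfl
    rw [this, ← Submodule.map_span, hJ', Submodule.map_top, Submodule.range_mkQ]
  obtain ⟨f, hf1, hf2, hf3⟩ := Submodule.exists_fun_fin_finrank_span_eq k T
  choose g hg using hf1
  have hlen : Module.length P V = (Module.finrank k (Submodule.span k T) : ℕ∞) := by
    rw [Module.length_eq_of_surjective hsk, hT, finrank_top, Module.length_eq_finrank]
  refine ⟨List.ofFn (fun i => (g i).1), ?_, ?_, ?_⟩
  · intro y hy
    obtain ⟨i, rfl⟩ := (List.mem_ofFn' _ _).1 hy
    exact (g i).2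
  · have hset : {x | x ∈ List.ofFn (fun i => (g i).1)} = Set.range (fun i => (g i).1) := by
      ext x; simp [List.mem_ofFn]
    rw [hset]
    apply le_antisymm
    · rw [Ideal.span_le]
      rintro _ ⟨i, rfl⟩
      exact hsJ (g i).2
    · refine Submodule.le_of_le_smul_of_le_jacobson_bot (I := maximalIdeal P) (IsNoetherian.noetherian J)
        (IsLocalRing.maximalIdeal_le_jacobson _) ?_
      intro j hj
      have h1 : (Submodule.Quotient.mk ⟨j, hj⟩ : V) ∈ Submodule.span P (Set.range f) := by
        rw [← Submodule.restrictScalars_span P k hsk, hf2, hT]; trivial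
      rw [Submodule.mem_span_range_iff_exists_fun] at h1
      obtain ⟨c, hc⟩ := h1
      have h2 : (∑ i, c i • (⟨(g i).1, hsJ (g i).2⟩ : J)) - ⟨j, hj⟩ ∈ (maximalIdeal P • ⊤ : Submodule P J) := by
        rw [← Submodule.Quotient.mk_eq_zero]
        rw [Submodule.Quotient.mk_sub, ← hc, sub_eq_zero]
        refine (map_sum (Submodule.mkQ (maximalIdeal P • ⊤ : Submodule P J)) _ _).trans ?_
        refine Finset.sum_congr rfl fun i _ => ?_
        rw [map_smul, ← hg i]; rfl
      rw [Submodule.mem_smul_top_iff] at h2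
      have h3 : j = (∑ i, c i • (g i).1) + (-1 : P) • ((∑ i, c i • (g i).1) - j) := by
        simp
      rw [h3]
      refine Submodule.add_mem_sup (Submodule.sum_mem _ fun i _ => Submodule.smul_mem _ _
        (Submodule.subset_span ⟨i, rfl⟩)) (Submodule.smul_mem _ _ ?_)
      simpa using h2
  · rw [List.length_ofFn]; exact hlen.symm

theorem CI_core {P Q C : Type u} [CommRing P] [IsLocalRing P] [CommRing Q] [IsLocalRing Q] [CommRing C]
    [IsLocalRing C] [IsNoetherianRing P] [IsNoetherianRing Q]
    (π : P →+* C) (hπ : Function.Surjective π) (ρ : Q →+* C) (hρ : Function.Surjective ρ)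
    (hP : GeneratedByRegularSequence P (maximalIdeal P))
    (hQ : GeneratedByRegularSequence Q (maximalIdeal Q))
    (hk : GeneratedByRegularSequence Q (RingHom.ker ρ))
    (s : Set P) (hs : Ideal.span s = RingHom.ker π) : ∃ ys : List P, (∀ y ∈ ys, y ∈ s) ∧
      IsWeaklyRegular P ys ∧ Ideal.span {x | x ∈ ys} = RingHom.ker π := by
  obtain ⟨xs, hxr, hx⟩ := hP
  obtain ⟨zs, hzr, hz⟩ := hQ
  obtain ⟨fs, hfr, hf⟩ := hk
  have hnum := CI_num π hπ ρ hρ xs hxr.1 hx zs hzr.1 hz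
  obtain ⟨ys, hys, hyspan, hylen⟩ := pick_gens (RingHom.ker π) s hs
  refine ⟨ys, hys, ?_, hyspan⟩
  have hJm : RingHom.ker π ≤ maximalIdeal P := IsLocalRing.le_maximalIdeal (RingHom.ker_ne_top π)
  have hym : ∀ r ∈ ys, r ∈ maximalIdeal P := by
    intro r hr
    apply hJm
    rw [← hyspan]; exact Ideal.subset_span hr
  have hfl := len_le_gens (RingHom.ker ρ) fs hf
  have hd1 : ringKrullDim C + fs.length = ringKrullDim Q := by
    have := ringKrullDim_add_length_eq_ringKrullDim_of_isRegular fs hfr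
    rw [← this]
    congr 1
    have hf' : Ideal.ofList fs = RingHom.ker ρ := hf
    rw [hf']
    exact (ringKrullDim_eq_of_ringEquiv (RingHom.quotientKerEquivOfSurjective hρ)).symm
  have hd2 : ringKrullDim Q = zs.length := by
    have := ringKrullDim_add_length_eq_ringKrullDim_of_isRegular zs hzr
    have hz' : Ideal.ofList zs = maximalIdeal Q := hz
    rw [hz'] at this
    let _ : Field (Q ⧸ maximalIdeal Q) := Ideal.Quotient.field _
    rw [← this, ringKrullDim_eq_zero_of_field, zero_add]
  have hle : ringKrullDim C + ys.length ≤ xs.length := by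
    rw [← hylen] at hnum
    rw [hd2] at hd1
    have h1 : (ys.length : ℕ∞) + zs.length ≤ fs.length + xs.length := hnum.le.trans (add_le_add hfl le_rfl)
    have h2 : ys.length + zs.length ≤ fs.length + xs.length := by exact_mod_cast h1
    have h3 : (ringKrullDim C + ys.length) + fs.length ≤ xs.length + fs.length := by
      rw [add_right_comm, hd1]
      have : zs.length + ys.length ≤ xs.length + fs.length := by omega
      exact_mod_cast this
    exact ENat.WithBot.add_le_add_natCast_right_iff.1 h3
  refine CM_regular ys hym xs (GRS_mem xs hxr) hxr ?_
  refine le_trans (add_le_add (le_of_eq ?_) le_rfl) hle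
  have hy' : Ideal.ofList ys = RingHom.ker π := hyspan
  rw [hy', Module.annihilator_eq_bot.2 inferInstance, bot_sup_eq]
  exact ringKrullDim_eq_of_ringEquiv (RingHom.quotientKerEquivOfSurjective hπ)

end

section
open TensorProduct IsLocalRing
open RingTheory.Sequence Pointwise

theorem chain_of_dim {P : Type u} [CommRing P] (J : Ideal P) (n : ℕ)
    (h : (n : WithBot ℕ∞) ≤ ringKrullDim (P ⧸ J)) :
    ∃ l : LTSeries (PrimeSpectrum P), l.length = n ∧ J ≤ l.head.asIdeal := by
  rw [ringKrullDim_quotient, Order.le_krullDim_iff] at h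
  obtain ⟨l, hl⟩ := h
  exact ⟨l.map Subtype.val (fun _ _ ↦ id), hl, l.head.2⟩

theorem dim_of_chain {P : Type u} [CommRing P] (J : Ideal P) (l : LTSeries (PrimeSpectrum P))
    (h : J ≤ l.head.asIdeal) : (l.length : WithBot ℕ∞) ≤ ringKrullDim (P ⧸ J) := by
  rw [ringKrullDim_quotient, Order.le_krullDim_iff]
  refine ⟨⟨l.length, fun i => ⟨l i, h.trans (l.head_le i)⟩, fun i => l.step i⟩, rfl⟩

theorem reg_aux {P : Type u} [CommRing P] [IsLocalRing P] [IsNoetherianRing P] (ys : List P) :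
    ∀ (J : Ideal P), J ⊔ Ideal.ofList ys = maximalIdeal P →
    (ys.length : WithBot ℕ∞) ≤ ringKrullDim (P ⧸ J) →
    J.IsPrime ∧ ∀ i (h : i < ys.length) (a : P),
      ys[i] * a ∈ J ⊔ Ideal.ofList (ys.take i) → a ∈ J ⊔ Ideal.ofList (ys.take i) := by
  induction ys with
  | nil =>
    intro J hJ hd
    simp at hJ
    subst hJ
    exact ⟨inferInstance, fun i h => absurd h (by simp)⟩
  | cons y ys ih =>
    intro J hJ hd
    have hym : ∀ r ∈ y :: ys, r ∈ maximalIdeal P := fun r hr => by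
      rw [← hJ]; exact (le_sup_right : _ ≤ J ⊔ _) (Ideal.subset_span hr)
    have hJm : J ≤ maximalIdeal P := by rw [← hJ]; exact le_sup_left
    have hcons : ∀ (K : Ideal P) (t : List P), K ⊔ Ideal.ofList (y :: t) =
        (K ⊔ Ideal.ofList [y]) ⊔ Ideal.ofList t := by
      intro K t
      rw [Ideal.ofList_cons, Ideal.ofList_singleton, sup_assoc]
    have hd1 : ∀ K : Ideal P, ((ys.length + 1 : ℕ) : WithBot ℕ∞) ≤ ringKrullDim (P ⧸ K) →
        (ys.length : WithBot ℕ∞) ≤ ringKrullDim (P ⧸ (K ⊔ Ideal.ofList [y])) := by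
      intro K hK
      have h1 := dim_quot_list [y] (fun r hr => hym r (by simp at hr; simp [hr])) K
      have h2 := hK.trans h1
      push_cast [List.length_singleton] at h2
      revert h2
      generalize ringKrullDim (P ⧸ (K ⊔ Ideal.ofList [y])) = d
      intro h2
      induction d with
      | bot => simp at h2
      | coe d =>
        have h3 : ((ys.length : ℕ∞) : WithBot ℕ∞) + ((1 : ℕ∞) : WithBot ℕ∞) ≤
          (d : WithBot ℕ∞) + ((1 : ℕ∞) : WithBot ℕ∞) := by simpa using h2
        rw [← WithBot.coe_add, ← WithBot.coe_add, WithBot.coe_le_coe] at h3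
        exact WithBot.coe_le_coe.2 ((ENat.add_le_add_iff_right (by simp)).1 h3)
    obtain ⟨hp1, hr1⟩ := ih (J ⊔ Ideal.ofList [y]) (by rw [← hcons, hJ]) (hd1 J hd)
    have hle : ringKrullDim (P ⧸ (J ⊔ Ideal.ofList [y])) ≤ ys.length := by
      have h1 := dim_quot_list ys (fun r hr => hym r (by simp [hr])) (J ⊔ Ideal.ofList [y])
      rw [← hcons, hJ] at h1
      let _ : Field (P ⧸ maximalIdeal P) := Ideal.Quotient.field _
      rwa [ringKrullDim_eq_zero_of_field, zero_add] at h1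
    have hnot : ∀ K : Ideal P, K = J ⊔ Ideal.ofList [y] →
        ¬ ((ys.length + 1 : ℕ) : WithBot ℕ∞) ≤ ringKrullDim (P ⧸ K) := by
      intro K hK h
      rw [hK] at h
      have := h.trans hle
      have := Nat.cast_le.1 this
      omega
    obtain ⟨l, hl, hlh⟩ := chain_of_dim J _ hd
    have hq : ((ys.length + 1 : ℕ) : WithBot ℕ∞) ≤ ringKrullDim (P ⧸ l.head.asIdeal) := by
      have := dim_of_chain l.head.asIdeal l le_rfl
      rwa [hl] at this
    obtain ⟨⟨q, hqp⟩, heq⟩ : ∃ q, q = l.head := ⟨_, rfl⟩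
    rw [← heq] at hlh hq
    simp only at hlh hq
    have hK : q ⊔ Ideal.ofList [y] = J ⊔ Ideal.ofList [y] := by
      by_contra hne
      obtain ⟨l', hl', hlh'⟩ := chain_of_dim _ _ (hd1 q hq)
      have hlt : J ⊔ Ideal.ofList [y] < l'.head.asIdeal :=
        lt_of_lt_of_le (lt_of_le_of_ne (sup_le_sup_right hlh _) (Ne.symm hne)) hlh'
      have := dim_of_chain (J ⊔ Ideal.ofList [y])
        (l'.cons ⟨_, hp1⟩ hlt) (by simp)
      refine hnot _ rfl ?_
      rw [← hl']
      rwa [RelSeries.cons_length] at this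
    have hyq : y ∉ q := by
      intro hy
      refine hnot q ?_ hq
      rw [← hK, Ideal.ofList_singleton, eq_comm, sup_eq_left, Ideal.span_singleton_le_iff_mem]
      exact hy
    have hqJ : q ≤ J := by
      refine Submodule.le_of_le_smul_of_le_jacobson_bot (I := maximalIdeal P)
        ((isNoetherianRing_iff_ideal_fg P).1 inferInstance q)
        (IsLocalRing.maximalIdeal_le_jacobson _) ?_
      intro a ha
      have : a ∈ J ⊔ Ideal.ofList [y] := by rw [← hK]; exact (le_sup_left : q ≤ _) ha
      rw [Ideal.ofList_singleton] at this
      obtain ⟨j, hj, b, hb, rfl⟩ := Submodule.mem_sup.1 this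
      obtain ⟨c, rfl⟩ := Ideal.mem_span_singleton'.1 hb
      have hc : c * y ∈ q := (Ideal.add_mem_iff_right _ (hlh hj)).1 ha
      have hc : c ∈ q := (hqp.mem_or_mem hc).resolve_right hyq
      refine Submodule.add_mem_sup hj ?_
      rw [mul_comm]
      exact Submodule.smul_mem_smul (hym y (by simp)) hc
    obtain rfl : q = J := le_antisymm hqJ hlh
    refine ⟨hqp, ?_⟩
    intro i hi a ha
    cases i with
    | zero =>
      simp at ha ⊢
      exact (hqp.mem_or_mem ha).resolve_left hyq
    | succ i =>
      rw [List.take_succ_cons, hcons] at ha ⊢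
      exact hr1 i (by simpa using hi) a ha

theorem reg_list {P : Type u} [CommRing P] [IsLocalRing P] [IsNoetherianRing P] (ys : List P)
    (h : Ideal.ofList ys = maximalIdeal P) (hd : (ys.length : WithBot ℕ∞) ≤ ringKrullDim P) :
    IsWeaklyRegular P ys := by
  rw [wr_iff]
  have := (reg_aux ys ⊥ (by simpa using h) (by
    rwa [ringKrullDim_eq_of_ringEquiv (RingEquiv.quotientBot P)])).2
  simpa using this

theorem GRS_of_regular {P : Type u} [CommRing P] [IsRegularLocalRing P] :
    GeneratedByRegularSequence P (maximalIdeal P) := by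
  have hfg : (maximalIdeal P).FG := (isNoetherianRing_iff_ideal_fg P).1 inferInstance _
  have h1 := Submodule.FG.generators_ncard hfg
  have hfin := Submodule.FG.finite_generators hfg
  have hsp := Submodule.span_generators (maximalIdeal P)
  have hset : {x | x ∈ hfin.toFinset.toList} = (maximalIdeal P).generators := by
    ext x; simp
  have hof : Ideal.ofList hfin.toFinset.toList = maximalIdeal P := by
    rw [Ideal.ofList, hset]; exact hsp
  refine GRS_of hfin.toFinset.toList (reg_list _ hof ?_) ?_ _ hof
  · rw [← IsRegularLocalRing.spanFinrank_maximalIdeal, ← h1, Set.ncard_eq_toFinset_card _ hfin]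
    simp
  · intro r hr
    rw [← hof]
    exact Ideal.subset_span hr

end

section
open TensorProduct IsLocalRing
open RingTheory.Sequence Pointwise

theorem fibre_reg {Λ : Type u} [CommRing Λ] [IsLocalRing Λ] [IsNoetherianRing Λ] (n : ℕ)
    (p : Ideal (MvPolynomial (Fin n) Λ)) [p.IsPrime] (hp : p.comap MvPolynomial.C = maximalIdeal Λ) :
    IsRegularLocalRing (Localization.AtPrime p ⧸
      (maximalIdeal Λ).map (algebraMap Λ (Localization.AtPrime p))) := by
  let κ := ResidueField Λ
  let φ : MvPolynomial (Fin n) Λ →+* MvPolynomial (Fin n) κ := MvPolynomial.map (residue Λ)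
  have hφ : Function.Surjective φ := MvPolynomial.map_surjective _ residue_surjective
  have hker : RingHom.ker φ = (maximalIdeal Λ).map MvPolynomial.C := by
    rw [MvPolynomial.ker_map, ker_residue]
  have hkp : RingHom.ker φ ≤ p := by rw [hker, Ideal.map_le_iff_le_comap, hp]
  have hpp : (p.map φ).IsPrime := Ideal.map_isPrime_of_surjective hφ hkp
  have hpc : p = (p.map φ).comap φ := by
    rw [Ideal.comap_map_of_surjective φ hφ, eq_comm, sup_eq_left]
    exact hkp
  let ψ := Localization.localRingHom p (p.map φ) φ hpc
  have hψ : Function.Surjective ψ :=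
    (RingHom.surjectiveOnStalks_of_surjective hφ).localRingHom_surjective _ _ hpc
  have hψk : RingHom.ker ψ = (maximalIdeal Λ).map (algebraMap Λ (Localization.AtPrime p)) := by
    have hC : algebraMap Λ (Localization.AtPrime p) =
        (algebraMap (MvPolynomial (Fin n) Λ) (Localization.AtPrime p)).comp MvPolynomial.C :=
      IsScalarTower.algebraMap_eq Λ (MvPolynomial (Fin n) Λ) _
    rw [hC, ← Ideal.map_map, ← hker]
    refine le_antisymm ?_ ?_
    · intro x hx
      obtain ⟨a, s, rfl⟩ := IsLocalization.exists_mk'_eq p.primeCompl x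
      rw [RingHom.mem_ker, Localization.localRingHom_mk', IsLocalization.mk'_eq_zero_iff] at hx
      obtain ⟨t, ht⟩ := hx
      have ht0 : (t : MvPolynomial (Fin n) κ) ≠ 0 := fun h => t.2 (by rw [h]; exact zero_mem _)
      have : φ a = 0 := (mul_eq_zero.1 ht).resolve_left ht0
      rw [IsLocalization.mk'_eq_mul_mk'_one]
      exact Ideal.mul_mem_right _ _ (Ideal.mem_map_of_mem _ this)
    · rw [Ideal.map_le_iff_le_comap]
      intro a ha
      rw [Ideal.mem_comap, RingHom.mem_ker, Localization.localRingHom_to_map, ha, map_zero]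
  have hreg : IsRegularLocalRing (Localization.AtPrime (p.map φ)) :=
    IsRegularRing.isRegularLocalRing_localization _
  exact IsRegularLocalRing.of_ringEquiv
    ((Ideal.quotEquivOfEq hψk.symm).trans (RingHom.quotientKerEquivOfSurjective hψ)).symm

theorem quot_flat {A B : Type u} [CommRing A] [CommRing B] [Algebra A B] [Module.Flat A B]
    (I : Ideal A) : Module.Flat (A ⧸ I) (B ⧸ I.map (algebraMap A B)) :=
  Module.Flat.of_linearEquiv (Algebra.TensorProduct.quotIdealMapEquivQuotTensor B I).toLinearEquiv

theorem fibre_compl {P : Type u} [CommRing P] [IsLocalRing P] [IsNoetherianRing P] (J : Ideal P)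
    (h : IsRegularLocalRing (P ⧸ J)) :
    IsRegularLocal (AdicCompletion (maximalIdeal P) P ⧸
      J.map (algebraMap P (AdicCompletion (maximalIdeal P) P))) := by
  set C := AdicCompletion (maximalIdeal P) P
  have hJ : J ≤ maximalIdeal P := IsLocalRing.le_maximalIdeal (Ideal.Quotient.nontrivial_iff.1 inferInstance)
  have hCm : maximalIdeal C = (maximalIdeal P).map (algebraMap P C) :=
    AdicCompletion.maximalIdeal_eq_map
  have hJ' : J.map (algebraMap P C) ≤ maximalIdeal C := by
    rw [hCm]; exact Ideal.map_mono hJ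
  have hnt : Nontrivial (C ⧸ J.map (algebraMap P C)) := Ideal.Quotient.nontrivial_iff.2
    (fun h => (Ideal.IsPrime.ne_top' (I := maximalIdeal C)) (top_le_iff.1 (h ▸ hJ')))
  have hloc : IsLocalRing (C ⧸ J.map (algebraMap P C)) :=
    IsLocalRing.of_surjective' _ Ideal.Quotient.mk_surjective
  refine ⟨inferInstance, hloc, ?_⟩
  have hfl : Module.Flat P C := AdicCompletion.flat_of_isNoetherian _
  have hfl2 := quot_flat (B := C) J
  have hm1 : maximalIdeal (P ⧸ J) = (maximalIdeal P).map (Ideal.Quotient.mk J) := by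
    rw [IsLocalRing.map_maximalIdeal_of_surjective _ Ideal.Quotient.mk_surjective]
  have hm2 : maximalIdeal (C ⧸ J.map (algebraMap P C)) =
      (maximalIdeal C).map (Ideal.Quotient.mk (J.map (algebraMap P C))) := by
    rw [IsLocalRing.map_maximalIdeal_of_surjective _ Ideal.Quotient.mk_surjective]
  have hmap : (maximalIdeal (P ⧸ J)).map (algebraMap (P ⧸ J) (C ⧸ J.map (algebraMap P C))) =
      maximalIdeal (C ⧸ J.map (algebraMap P C)) := by
    rw [hm1, hm2, hCm, Ideal.map_map, Ideal.map_map]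
    rfl
  have : IsLocalHom (algebraMap (P ⧸ J) (C ⧸ J.map (algebraMap P C))) :=
    ((IsLocalRing.local_hom_TFAE _).out 0 2).2 hmap.le
  rw [← hmap]
  exact GRS_flat _ (RingHom.flat_algebraMap_iff.2 hfl2) _ GRS_of_regular

end

section
open TensorProduct IsLocalRing
open RingTheory.Sequence Pointwise

theorem inf_fibre {R A S : Type u} [CommRing R] [CommRing A] [CommRing S] [Algebra R A] [Algebra R S]
    [Module.Flat R S] (π : A →ₐ[R] S) (hπ : Function.Surjective π) (m : Ideal R) (x : A)
    (hx : x ∈ m.map (algebraMap R A)) (hx0 : π x = 0) :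
    x ∈ m.map (algebraMap R A) * RingHom.ker π := by
  rw [Ideal.map, Ideal.span, Submodule.mem_span_set'] at hx
  obtain ⟨n, f, g, rfl⟩ := hx
  choose r hr hrg using fun i => (g i).2
  have h0 : ∑ i, r i • π (f i) = 0 := by
    rw [← hx0, map_sum]
    refine Finset.sum_congr rfl fun i _ => ?_
    rw [← hrg, smul_eq_mul, map_mul, AlgHom.commutes, Algebra.smul_def, mul_comm]
  obtain ⟨k, a, y, h1, h2⟩ := Module.Flat.isTrivialRelation_of_sum_smul_eq_zero (R := R) (M := S)
    (f := r) (x := fun i => π (f i)) h0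
  choose b hb using fun j => hπ (y j)
  have key : ∑ i, f i • (g i : A) = ∑ i, algebraMap R A (r i) * (f i - ∑ j, a i j • b j) := by
    simp only [mul_sub, Finset.sum_sub_distrib]
    have : ∑ i, algebraMap R A (r i) * ∑ j, a i j • b j = 0 := by
      simp only [Finset.mul_sum]
      rw [Finset.sum_comm]
      refine Finset.sum_eq_zero fun j _ => ?_
      have : ∑ i, algebraMap R A (r i) * a i j • b j = algebraMap R A (∑ i, r i * a i j) * b j := by
        rw [map_sum, Finset.sum_mul]
        refine Finset.sum_congr rfl fun i _ => ?_
        rw [map_mul, Algebra.smul_def, mul_assoc]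
      rw [this, h2, map_zero, zero_mul]
    rw [this, sub_zero]
    refine Finset.sum_congr rfl fun i _ => ?_
    rw [← hrg, smul_eq_mul, mul_comm]
  rw [key]
  refine Ideal.sum_mem _ fun i _ => Ideal.mul_mem_mul (Ideal.mem_map_of_mem _ (hr i)) ?_
  rw [RingHom.mem_ker, map_sub, show π (f i) = _ from h1 i, map_sum, sub_eq_zero]
  refine Finset.sum_congr rfl fun j _ => ?_
  rw [map_smul, hb]

theorem list_lift {A B : Type u} (f : A → B) (s : Set A) (ys : List B) (h : ∀ y ∈ ys, y ∈ f '' s) :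
    ∃ xs : List A, (∀ x ∈ xs, x ∈ s) ∧ xs.map f = ys := by
  induction ys with
  | nil => exact ⟨[], by simp, rfl⟩
  | cons y ys ih =>
    obtain ⟨xs, h1, h2⟩ := ih fun z hz => h z (by simp [hz])
    obtain ⟨x, hx, rfl⟩ := h y (by simp)
    exact ⟨x :: xs, by simpa using ⟨hx, h1⟩, by simp [h2]⟩

theorem span_list_map {A B : Type u} [CommRing A] [CommRing B] (f : A →+* B) (xs : List A) :
    Ideal.span {x | x ∈ xs.map f} = (Ideal.span {x | x ∈ xs}).map f :=
  (Ideal.map_ofList f xs).symm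

theorem lift_regular {R A S : Type u} [CommRing R] [CommRing A] [CommRing S] [IsLocalRing R]
    [IsNoetherianRing R] [IsLocalRing A] [IsNoetherianRing A] [IsLocalRing S] [IsNoetherianRing S]
    [Algebra R A] [Algebra R S] [IsLocalHom (algebraMap R A)] [IsLocalHom (algebraMap R S)]
    [Module.Flat R A] [Module.Flat R S]
    (hreg : IsRegularLocalRing (A ⧸ (maximalIdeal R).map (algebraMap R A)))
    (π : A →ₐ[R] S) (hπ : Function.Surjective π)
    (hfib : IsCompleteIntersectionRing (S ⧸ Ideal.map (algebraMap R S) (maximalIdeal R))) :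
    ∃ fs : List A, IsWeaklyRegular A fs ∧ Ideal.span {x | x ∈ fs} = RingHom.ker π := by
  obtain ⟨hCn, hCl, Q, _, ρ, hQ, -, hρ, hρk⟩ := hfib
  obtain ⟨hQn, hQl, hQm⟩ := hQ
  set mA := (maximalIdeal R).map (algebraMap R A) with hmA
  set mS := (maximalIdeal R).map (algebraMap R S) with hmS
  have hmap : mA.map π.toRingHom = mS := by
    rw [hmA, hmS, Ideal.map_map]
    congr 1
    exact π.comp_algebraMap
  let πk : A ⧸ mA →+* S ⧸ mS := Ideal.quotientMap mS π.toRingHom (by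
    rw [← hmap]; exact Ideal.le_comap_map)
  have hπk : Function.Surjective πk := Ideal.quotientMap_surjective hπ
  have hkk : RingHom.ker πk = (RingHom.ker π).map (Ideal.Quotient.mk mA) := by
    refine le_antisymm ?_ ?_
    · intro x hx
      obtain ⟨x, rfl⟩ := Ideal.Quotient.mk_surjective x
      rw [RingHom.mem_ker, Ideal.quotientMap_mk, Ideal.Quotient.eq_zero_iff_mem, ← hmap] at hx
      obtain ⟨y, hy, hxy⟩ := (Ideal.mem_map_iff_of_surjective π.toRingHom hπ).1 hx
      have : Ideal.Quotient.mk mA x = Ideal.Quotient.mk mA (x - y) := by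
        rw [map_sub, Ideal.Quotient.eq_zero_iff_mem.2 hy, sub_zero]
      rw [this]
      refine Ideal.mem_map_of_mem _ ?_
      rw [RingHom.mem_ker, map_sub, sub_eq_zero]
      exact hxy.symm
    · rw [Ideal.map_le_iff_le_comap]
      intro x hx
      rw [Ideal.mem_comap, RingHom.mem_ker, Ideal.quotientMap_mk]
      have : π.toRingHom x = 0 := hx
      rw [this, map_zero]
  have hmm : (maximalIdeal (A ⧸ mA)).map πk = maximalIdeal (S ⧸ mS) :=
    IsLocalRing.map_maximalIdeal_of_surjective _ hπk
  let Pc := AdicCompletion (maximalIdeal (A ⧸ mA)) (A ⧸ mA)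
  let πc := compMap _ _ πk hmm.le
  have hπc : Function.Surjective πc := compMap_surj _ _ πk (IsNoetherian.noetherian _)
    (Ideal.Quotient.mk_surjective.comp hπk) hmm
  have hkc : RingHom.ker πc = (RingHom.ker πk).map (algebraMap _ Pc) := compMap_ker _ πk hπk hmm
  have hfl : Module.Flat (A ⧸ mA) Pc := AdicCompletion.flat_of_isNoetherian _
  have hff : Module.FaithfullyFlat (A ⧸ mA) Pc := Module.FaithfullyFlat.of_flat_of_isLocalHom
  have hPc : GeneratedByRegularSequence Pc (maximalIdeal Pc) := by
    have : maximalIdeal Pc = (maximalIdeal (A ⧸ mA)).map (algebraMap _ Pc) :=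
      AdicCompletion.maximalIdeal_eq_map
    rw [this]
    exact GRS_flat _ (RingHom.flat_algebraMap_iff.2 hfl) _ GRS_of_regular
  let F : A →+* Pc := (algebraMap (A ⧸ mA) Pc).comp (Ideal.Quotient.mk mA)
  obtain ⟨ys, hys, hyr, hyk⟩ := CI_core πc hπc ρ hρ hPc hQm hρk (F '' (RingHom.ker π : Set A)) (by
    rw [hkc, hkk, Ideal.map_map]; rfl)
  obtain ⟨fs, hfs, rfl⟩ := list_lift F _ ys hys
  have hfk : Ideal.span {x | x ∈ fs.map (Ideal.Quotient.mk mA)} = RingHom.ker πk := by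
    rw [← Ideal.comap_map_eq_self_of_faithfullyFlat (B := Pc) (RingHom.ker πk), ← hkc, ← hyk,
      ← Ideal.comap_map_eq_self_of_faithfullyFlat (B := Pc)
        (Ideal.span {x | x ∈ fs.map (Ideal.Quotient.mk mA)}), ← span_list_map, List.map_map]
    rfl
  have hfr : IsWeaklyRegular (A ⧸ mA) (fs.map (Ideal.Quotient.mk mA)) := by
    refine wr_descend (algebraMap _ Pc) ?_ _ (by rw [List.map_map]; exact hyr)
    exact (RingHom.faithfullyFlat_algebraMap_iff).2 hff
  have hkm : RingHom.ker π ≤ maximalIdeal A := by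
    refine IsLocalRing.le_maximalIdeal ?_
    exact RingHom.ker_ne_top π.toRingHom
  have hmAm : mA ≤ maximalIdeal A := by
    rw [hmA]
    exact ((IsLocalRing.local_hom_TFAE (algebraMap R A)).out 0 2).1 ‹_›
  refine ⟨fs, ?_, ?_⟩
  · refine wreg_lift (R := R) fs (fun r hr => hkm (hfs r hr)) ?_
    rw [← (Algebra.TensorProduct.quotIdealMapEquivTensorQuot A
      (maximalIdeal R)).toLinearEquiv.isWeaklyRegular_congr]
    exact (isWeaklyRegular_map_algebraMap_iff (S := A ⧸ mA) (M := A ⧸ mA) fs).1 hfr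
  · refine le_antisymm (Ideal.span_le.2 hfs) ?_
    refine Submodule.le_of_le_smul_of_le_jacobson_bot (I := maximalIdeal A)
        (IsNoetherian.noetherian _)
        (IsLocalRing.maximalIdeal_le_jacobson _) ?_
    intro x hx
    have h1 : Ideal.Quotient.mk mA x ∈ (Ideal.span {x | x ∈ fs}).map (Ideal.Quotient.mk mA) := by
      rw [← span_list_map, hfk, hkk]; exact Ideal.mem_map_of_mem _ hx
    obtain ⟨y, hy, hxy⟩ := (Ideal.mem_map_iff_of_surjective _ Ideal.Quotient.mk_surjective).1 h1
    have h2 : x - y ∈ mA := Ideal.Quotient.eq.1 hxy.symm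
    have hy' : y ∈ RingHom.ker π := (Ideal.span_le.2 hfs) hy
    have h3 := inf_fibre π hπ (maximalIdeal R) (x - y) h2 (by
      rw [map_sub, (RingHom.mem_ker).1 hx, (RingHom.mem_ker).1 hy', sub_zero])
    have : x = y + (x - y) := by ring
    rw [this]
    exact Submodule.add_mem_sup hy (Ideal.mul_mono_left hmAm h3)

end

section
open TensorProduct IsLocalRing
open RingTheory.Sequence Pointwise

theorem pres_S (R S : Type u) [CommRing R] [CommRing S] [Algebra R S] [Algebra.EssFiniteType R S] :
    ∃ (n : ℕ) (θ : MvPolynomial (Fin n) R →ₐ[R] S),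
      ∀ s, ∃ a b, IsUnit (θ b) ∧ θ b * s = θ a := by
  obtain ⟨σ, hσ⟩ := (Algebra.essFiniteType_iff R S).1 inferInstance
  let e := σ.equivFin
  let θ : MvPolynomial (Fin σ.card) R →ₐ[R] S := MvPolynomial.aeval (fun i => ((e.symm i : σ) : S))
  have hr : θ.range = Algebra.adjoin R (σ : Set S) := by
    rw [← Algebra.adjoin_range_eq_range_aeval]
    congr 1
    ext x
    constructor
    · rintro ⟨i, rfl⟩; exact (e.symm i).2
    · intro hx; exact ⟨e ⟨x, hx⟩, by simp⟩
  refine ⟨σ.card, θ, fun s => ?_⟩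
  obtain ⟨t, ht, htu, hst⟩ := hσ s
  rw [← hr] at ht hst
  obtain ⟨b, rfl⟩ := ht
  obtain ⟨a, ha⟩ := hst
  exact ⟨a, b, htu, by rw [mul_comm]; exact ha.symm⟩

theorem map_flat {R R' : Type u} [CommRing R] [CommRing R'] [Algebra R R'] [Module.Flat R R'] (n : ℕ) :
    (MvPolynomial.map (algebraMap R R') : MvPolynomial (Fin n) R →+* MvPolynomial (Fin n) R').Flat := by
  have h1 : (Algebra.TensorProduct.includeRight :
      MvPolynomial (Fin n) R →ₐ[R] R' ⊗[R] MvPolynomial (Fin n) R).toRingHom.Flat := by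
    have : (algebraMap R R').Flat := RingHom.flat_algebraMap_iff.2 inferInstance
    let _ : Algebra (MvPolynomial (Fin n) R) (R' ⊗[R] MvPolynomial (Fin n) R) :=
      Algebra.TensorProduct.rightAlgebra
    have : Module.Flat (MvPolynomial (Fin n) R) (R' ⊗[R] MvPolynomial (Fin n) R) := by
      refine Module.Flat.of_linearEquiv (M := MvPolynomial (Fin n) R ⊗[R] R') ?_
      exact { (TensorProduct.comm R R' (MvPolynomial (Fin n) R)) with
        map_smul' := by
          intro r x
          induction x with
          | zero => simp
          | add x y hx hy =>
            change TensorProduct.comm R R' (MvPolynomial (Fin n) R) (r • x) =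
              r • TensorProduct.comm R R' (MvPolynomial (Fin n) R) x at hx
            change TensorProduct.comm R R' (MvPolynomial (Fin n) R) (r • y) =
              r • TensorProduct.comm R R' (MvPolynomial (Fin n) R) y at hy
            change TensorProduct.comm R R' (MvPolynomial (Fin n) R) (r • (x + y)) =
              r • TensorProduct.comm R R' (MvPolynomial (Fin n) R) (x + y)
            refine (congrArg _ (smul_add r x y)).trans ?_
            rw [map_add, map_add, hx, hy]
            exact (smul_add r _ _).symm
          | tmul x y =>
            have : r • (x ⊗ₜ[R] y) = x ⊗ₜ[R] (r * y) := by
              rw [Algebra.smul_def]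
              exact (Algebra.TensorProduct.tmul_mul_tmul _ _ _ _).trans (by rw [one_mul])
            rw [this]
            rfl }
    exact this
  have h2 := h1.comp (RingHom.Flat.of_bijective
    (MvPolynomial.algebraTensorAlgEquiv (σ := Fin n) R R').bijective
      (f := (MvPolynomial.algebraTensorAlgEquiv (σ := Fin n) R R').toRingEquiv.toRingHom))
  convert h2 using 1
  refine RingHom.ext fun x => ?_
  change _ = MvPolynomial.algebraTensorAlgEquiv R R' (1 ⊗ₜ x)
  rw [MvPolynomial.algebraTensorAlgEquiv_tmul, one_smul]

theorem ker_loc {A B : Type u} [CommRing A] [CommRing B] (φ : A →+* B)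
    (p : Ideal A) [p.IsPrime] (M : Ideal B) [M.IsPrime] (h : p = M.comap φ)
    (hφ : ∀ b, ∃ a s, IsUnit (φ s) ∧ φ s * b = φ a) :
    RingHom.ker (Localization.localRingHom p M φ h) =
      (RingHom.ker φ).map (algebraMap A (Localization.AtPrime p)) := by
  refine le_antisymm ?_ ?_
  · intro x hx
    obtain ⟨a, s, rfl⟩ := IsLocalization.exists_mk'_eq p.primeCompl x
    rw [RingHom.mem_ker, Localization.localRingHom_mk', IsLocalization.mk'_eq_zero_iff] at hx
    obtain ⟨t, ht⟩ := hx
    obtain ⟨c, d, hd, hdc⟩ := hφ t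
    have hc : c ∈ p.primeCompl := by
      intro hc
      replace hc : φ c ∈ M := by rw [h] at hc; exact hc
      rw [← hdc] at hc
      exact t.2 ((Ideal.IsPrime.mem_or_mem ‹_› hc).resolve_left
        fun h' => Ideal.IsPrime.ne_top ‹_› (Ideal.eq_top_of_isUnit_mem _ h' hd))
    have h0 : φ (c * a) = 0 := by
      rw [map_mul, ← hdc, mul_assoc, ht, mul_zero]
    rw [IsLocalization.mk'_eq_mul_mk'_one]
    refine Ideal.mul_mem_right _ _ ?_
    refine (Ideal.unit_mul_mem_iff_mem _ (IsLocalization.map_units (Localization.AtPrime p)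
      (⟨c, hc⟩ : p.primeCompl))).1 ?_
    rw [← map_mul]
    exact Ideal.mem_map_of_mem _ h0
  · rw [Ideal.map_le_iff_le_comap]
    intro a ha
    rw [Ideal.mem_comap, RingHom.mem_ker, Localization.localRingHom_to_map, ha, map_zero]

theorem surj_loc {A B : Type u} [CommRing A] [CommRing B] (φ : A →+* B)
    (p : Ideal A) [p.IsPrime] (M : Ideal B) [M.IsPrime] (h : p = M.comap φ)
    (hφ : ∀ b, ∃ a s, IsUnit (φ s) ∧ φ s * b = φ a) :
    Function.Surjective (Localization.localRingHom p M φ h) :=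
  (RingHom.surjectiveOnStalks_of_exists_div hφ).localRingHom_surjective _ _ h

end

section
open TensorProduct IsLocalRing
open RingTheory.Sequence Pointwise

theorem pres_A (R S : Type u) [CommRing R] [CommRing S] [IsLocalRing R] [IsLocalRing S]
    [IsNoetherianRing R] [IsNoetherianRing S]
    [Algebra R S] [IsLocalHom (algebraMap R S)] [Module.Flat R S]
    (hfib : IsCompleteIntersectionRing (S ⧸ Ideal.map (algebraMap R S) (maximalIdeal R)))
    (n : ℕ) (θ : MvPolynomial (Fin n) R →ₐ[R] S) (hθ : ∀ s, ∃ a b, IsUnit (θ b) ∧ θ b * s = θ a)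
    (q : Ideal (MvPolynomial (Fin n) R)) [q.IsPrime] (hq : q = (maximalIdeal S).comap θ) :
    ∃ π : Localization.AtPrime q →ₐ[R] S, Function.Surjective π ∧
      (∀ a, π (algebraMap _ _ a) = θ a) ∧
      GeneratedByRegularSequence (Localization.AtPrime q) (RingHom.ker π) := by
  have hmq : ∀ w, w ∈ q ↔ θ w ∈ maximalIdeal S := fun w => by rw [hq]; exact Iff.rfl
  have hu : ∀ y : q.primeCompl, IsUnit (θ y) := by
    intro y
    by_contra h
    exact y.2 ((hmq _).2 ((IsLocalRing.mem_maximalIdeal _).2 h))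
  let π : Localization.AtPrime q →ₐ[R] S := IsLocalization.liftAlgHom (M := q.primeCompl) (f := θ) hu
  have hπa : ∀ a, π (algebraMap _ _ a) = θ a := fun a => by
    simp [π]
  have hπ : Function.Surjective π := by
    intro s
    obtain ⟨a, b, hb, hs⟩ := hθ s
    have hbq : b ∈ q.primeCompl := by
      intro h
      exact (IsLocalRing.mem_maximalIdeal _).1 ((hmq _).1 h) hb
    refine ⟨IsLocalization.mk' _ a (⟨b, hbq⟩ : q.primeCompl), ?_⟩
    have h2 := congrArg π (IsLocalization.mk'_spec (Localization.AtPrime q) a (⟨b, hbq⟩ : q.primeCompl))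
    rw [map_mul, hπa, hπa, ← hs, mul_comm] at h2
    exact hb.mul_left_cancel h2
  have hqC : q.comap MvPolynomial.C = maximalIdeal R := by
    have h1 : q.comap (MvPolynomial.C : R →+* MvPolynomial (Fin n) R) =
      (maximalIdeal S).comap (algebraMap R S) := by
      rw [hq]
      ext x
      rw [Ideal.mem_comap, Ideal.mem_comap, Ideal.mem_comap]
      have : θ (MvPolynomial.C x) = algebraMap R S x := θ.commutes x
      rw [this]
    rw [h1]
    exact ((IsLocalRing.local_hom_TFAE (algebraMap R S)).out 0 4).1 ‹_›
  have : Module.Flat (MvPolynomial (Fin n) R) (Localization.AtPrime q) :=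
    IsLocalization.flat _ q.primeCompl
  have hfl : Module.Flat R (Localization.AtPrime q) :=
    Module.Flat.trans R (MvPolynomial (Fin n) R) (Localization.AtPrime q)
  have hloc : IsLocalHom (algebraMap R (Localization.AtPrime q)) := by
    refine ((IsLocalRing.local_hom_TFAE _).out 0 4).2 ?_
    rw [IsScalarTower.algebraMap_eq R (MvPolynomial (Fin n) R), ← Ideal.comap_comap]
    exact (congrArg (Ideal.comap _)
      (IsLocalization.AtPrime.comap_maximalIdeal (Localization.AtPrime q) q)).trans hqC
  obtain ⟨fs, h1, h2⟩ := lift_regular (fibre_reg n q hqC) π hπ hfib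
  refine ⟨π, hπ, hπa, GRS_of fs h1 ?_ _ h2⟩
  intro r hr
  have : RingHom.ker π ≤ maximalIdeal (Localization.AtPrime q) :=
    IsLocalRing.le_maximalIdeal (RingHom.ker_ne_top π.toRingHom)
  exact this (by rw [← h2]; exact Ideal.subset_span hr)

theorem pres_T (R S R' : Type u) [CommRing R] [CommRing S] [CommRing R']
    [IsLocalRing R] [IsLocalRing S]
    [IsNoetherianRing R] [IsNoetherianRing S]
    [Algebra R S] [IsLocalHom (algebraMap R S)] [Module.Flat R S] [Algebra.EssFiniteType R S]
    (hfib : IsCompleteIntersectionRing (S ⧸ Ideal.map (algebraMap R S) (maximalIdeal R)))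
    [Algebra R R'] [Module.Flat R R']
    (M : Ideal (R' ⊗[R] S)) [M.IsPrime]
    (h2 : Ideal.comap (Algebra.TensorProduct.includeRight : S →ₐ[R] R' ⊗[R] S).toRingHom M =
      maximalIdeal S) :
    ∃ (n : ℕ) (ω : MvPolynomial (Fin n) R' →+* R' ⊗[R] S),
      (∀ a, ω (MvPolynomial.C a) = a ⊗ₜ 1) ∧
      (∀ t, ∃ a s, IsUnit (ω s) ∧ ω s * t = ω a) ∧
      GeneratedByRegularSequence (Localization.AtPrime (M.comap ω))
        (RingHom.ker (Localization.localRingHom (M.comap ω) M ω rfl)) := by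
  obtain ⟨n, θ, hθ⟩ := pres_S R S
  let e := MvPolynomial.algebraTensorAlgEquiv (σ := Fin n) R R'
  let ω : MvPolynomial (Fin n) R' →+* R' ⊗[R] S :=
    (Algebra.TensorProduct.map (AlgHom.id R R') θ).toRingHom.comp e.symm.toRingEquiv.toRingHom
  have hωe : ∀ z, ω (e z) = Algebra.TensorProduct.map (AlgHom.id R R') θ z := by
    intro z
    change Algebra.TensorProduct.map (AlgHom.id R R') θ (e.symm (e z)) = _
    rw [e.symm_apply_apply]
  let μ : MvPolynomial (Fin n) R →+* MvPolynomial (Fin n) R' := MvPolynomial.map (algebraMap R R')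
  have hωμ : ∀ w, ω (μ w) = 1 ⊗ₜ θ w := by
    intro w
    have : μ w = e (1 ⊗ₜ w) := by
      rw [MvPolynomial.algebraTensorAlgEquiv_tmul, one_smul]
    rw [this, hωe, Algebra.TensorProduct.map_tmul]
    rfl
  have hωC : ∀ a, ω (MvPolynomial.C a) = a ⊗ₜ 1 := by
    intro a
    have : MvPolynomial.C a = e (a ⊗ₜ 1) := by
      rw [MvPolynomial.algebraTensorAlgEquiv_tmul, map_one, MvPolynomial.smul_eq_C_mul, mul_one]
    rw [this, hωe, Algebra.TensorProduct.map_tmul, map_one]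
    rfl
  have hω : ∀ t, ∃ a s, IsUnit (ω s) ∧ ω s * t = ω a := by
    intro t
    induction t with
    | zero => exact ⟨0, 1, by simp, by simp⟩
    | tmul r s =>
      obtain ⟨a, b, hb, hs⟩ := hθ s
      refine ⟨MvPolynomial.C r * μ a, μ b, ?_, ?_⟩
      · rw [hωμ]
        exact hb.map (Algebra.TensorProduct.includeRight : S →ₐ[R] R' ⊗[R] S)
      · rw [map_mul, hωμ, hωμ, hωC, Algebra.TensorProduct.tmul_mul_tmul,
          Algebra.TensorProduct.tmul_mul_tmul, hs, one_mul, mul_one, one_mul]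
    | add x y hx hy =>
      obtain ⟨a, s, hs, h⟩ := hx
      obtain ⟨b, t, ht, h'⟩ := hy
      refine ⟨a * t + b * s, s * t, by rw [map_mul]; exact hs.mul ht, ?_⟩
      rw [map_add, map_mul, map_mul, map_mul, ← h, ← h']
      ring
  refine ⟨n, ω, hωC, hω, ?_⟩
  let p := M.comap ω
  let q := (maximalIdeal S).comap θ
  have hqp : q = p.comap μ := by
    ext w
    change θ w ∈ maximalIdeal S ↔ ω (μ w) ∈ M
    rw [hωμ, ← h2]
    rfl
  obtain ⟨π, hπ, hπa, hG⟩ := pres_A R S hfib n θ hθ q rfl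
  let j := Localization.localRingHom q p μ hqp
  have hjl : IsLocalHom j := Localization.isLocalHom_localRingHom q p μ hqp
  have hjf : j.Flat := (map_flat n).localRingHom p q hqp
  have hG' := GRS_flat j hjf _ hG
  convert hG' using 1
  refine le_antisymm ?_ ?_
  · rw [ker_loc ω _ M rfl hω, Ideal.map_le_iff_le_comap]
    intro w hw
    have hcomm : ∀ r, j (algebraMap R (Localization.AtPrime q) r) =
        algebraMap R (Localization.AtPrime p) r := by
      intro r
      rw [IsScalarTower.algebraMap_apply R (MvPolynomial (Fin n) R) (Localization.AtPrime q),
        Localization.localRingHom_to_map,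
        IsScalarTower.algebraMap_apply R R' (Localization.AtPrime p),
        IsScalarTower.algebraMap_apply R' (MvPolynomial (Fin n) R') (Localization.AtPrime p)]
      congr 1
      exact MvPolynomial.map_C _ _
    let jA : Localization.AtPrime q →ₐ[R] Localization.AtPrime p := { j with commutes' := hcomm }
    let η : R' ⊗[R] Localization.AtPrime q →+* Localization.AtPrime p :=
      (Algebra.TensorProduct.lift (Algebra.ofId R' (Localization.AtPrime p)) jA
        (fun _ _ => Commute.all _ _)).toRingHom
    let ι : R' ⊗[R] MvPolynomial (Fin n) R →ₐ[R] R' ⊗[R] Localization.AtPrime q :=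
      Algebra.TensorProduct.map (AlgHom.id R R') (IsScalarTower.toAlgHom R _ _)
    have hηι : ∀ z, η (ι z) = algebraMap _ (Localization.AtPrime p) (e z) := by
      intro z
      induction z with
      | zero => simp
      | add x y hx hy => simp only [map_add, hx, hy]
      | tmul r w =>
        have h3 : η (ι (r ⊗ₜ w)) = algebraMap R' (Localization.AtPrime p) r * j (algebraMap _ _ w) := by
          rfl
        rw [h3, Localization.localRingHom_to_map, MvPolynomial.algebraTensorAlgEquiv_tmul,
          Algebra.smul_def, map_mul, ← IsScalarTower.algebraMap_apply]
    have hker := Algebra.TensorProduct.lTensor_ker (A := R') π hπ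
    have hmem : ι (e.symm w) ∈ RingHom.ker (Algebra.TensorProduct.map (AlgHom.id R R') π) := by
      rw [RingHom.mem_ker]
      have : (Algebra.TensorProduct.map (AlgHom.id R R') π).comp ι =
        Algebra.TensorProduct.map (AlgHom.id R R') θ := by
        rw [← Algebra.TensorProduct.map_comp]
        congr 1
        ext i
        exact hπa _
      have h4 := congrArg (fun f => f (e.symm w)) this
      exact h4.trans hw
    rw [hker] at hmem
    have h5 := Ideal.mem_map_of_mem η hmem
    rw [hηι, e.apply_symm_apply] at h5
    rw [Ideal.mem_comap]
    refine (?_ : Ideal.map η _ ≤ _) h5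
    rw [Ideal.map_le_iff_le_comap]
    refine Ideal.map_le_iff_le_comap.2 ?_
    intro x hx
    rw [Ideal.mem_comap, Ideal.mem_comap]
    have : η (Algebra.TensorProduct.includeRight x) = j x := by
      change algebraMap R' (Localization.AtPrime p) 1 * j x = j x
      rw [map_one, one_mul]
    rw [this]
    exact Ideal.mem_map_of_mem _ hx
  · rw [Ideal.map_le_iff_le_comap]
    intro x hx
    rw [Ideal.mem_comap, RingHom.mem_ker]
    have : (Localization.localRingHom p M ω rfl).comp j =
      ((algebraMap _ (Localization.AtPrime M)).comp
        (Algebra.TensorProduct.includeRight : S →ₐ[R] R' ⊗[R] S).toRingHom).comp π.toRingHom := by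
      refine IsLocalization.ringHom_ext q.primeCompl ?_
      refine RingHom.ext fun w => ?_
      change Localization.localRingHom p M ω rfl (j (algebraMap _ _ w)) =
        algebraMap (R' ⊗[R] S) _ ((1 : R') ⊗ₜ[R] (π (algebraMap _ _ w)))
      rw [Localization.localRingHom_to_map, Localization.localRingHom_to_map, hωμ, hπa]
    have h6 := congrArg (fun f => f x) this
    refine h6.trans ?_
    change algebraMap (R' ⊗[R] S) (Localization.AtPrime M) ((1 : R') ⊗ₜ[R] (π x)) = 0
    rw [(RingHom.mem_ker).1 hx, TensorProduct.tmul_zero, map_zero]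

end

section
open TensorProduct IsLocalRing
open RingTheory.Sequence Pointwise

theorem loc_C {Λ : Type u} [CommRing Λ] [IsLocalRing Λ] {n : ℕ}
    (p : Ideal (MvPolynomial (Fin n) Λ)) [p.IsPrime]
    (hp : p.comap MvPolynomial.C = maximalIdeal Λ) :
    IsLocalHom (algebraMap Λ (Localization.AtPrime p)) ∧
      (algebraMap Λ (Localization.AtPrime p)).Flat := by
  constructor
  · refine ((IsLocalRing.local_hom_TFAE _).out 0 4).2 ?_
    rw [IsScalarTower.algebraMap_eq Λ (MvPolynomial (Fin n) Λ), ← Ideal.comap_comap]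
    exact (congrArg (Ideal.comap _)
      (IsLocalization.AtPrime.comap_maximalIdeal (Localization.AtPrime p) p)).trans hp
  · have : Module.Flat (MvPolynomial (Fin n) Λ) (Localization.AtPrime p) :=
      IsLocalization.flat _ p.primeCompl
    have hfl : Module.Flat Λ (Localization.AtPrime p) :=
      Module.Flat.trans Λ (MvPolynomial (Fin n) Λ) (Localization.AtPrime p)
    rw [RingHom.flat_algebraMap_iff]
    exact hfl

theorem pres_Q {R' Q : Type u} [CommRing R'] [CommRing Q] [IsLocalRing R'] [IsLocalRing Q]
    (g : Q →+* R') (hgl : IsLocalHom g) (hg : Function.Surjective g)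
    (hk : GeneratedByRegularSequence Q (RingHom.ker g)) {n : ℕ}
    (p : Ideal (MvPolynomial (Fin n) R')) [p.IsPrime]
    (hp : p.comap MvPolynomial.C = maximalIdeal R')
    (q : Ideal (MvPolynomial (Fin n) Q)) [q.IsPrime] (hq : q = p.comap (MvPolynomial.map g)) :
    q.comap MvPolynomial.C = maximalIdeal Q ∧
    Function.Surjective (Localization.localRingHom q p (MvPolynomial.map g) hq) ∧
    GeneratedByRegularSequence (Localization.AtPrime q)
      (RingHom.ker (Localization.localRingHom q p (MvPolynomial.map g) hq)) := by
  have hqC : q.comap MvPolynomial.C = maximalIdeal Q := by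
    rw [hq, Ideal.comap_comap]
    have : (MvPolynomial.map g).comp (MvPolynomial.C (σ := Fin n)) = MvPolynomial.C.comp g := by
      refine RingHom.ext fun x => ?_
      simp
    rw [this, ← Ideal.comap_comap, hp]
    exact ((IsLocalRing.local_hom_TFAE g).out 0 4).1 hgl
  have hs : ∀ b, ∃ a s, IsUnit (MvPolynomial.map (σ := Fin n) g s) ∧
      MvPolynomial.map g s * b = MvPolynomial.map g a := by
    intro b
    obtain ⟨a, ha⟩ := MvPolynomial.map_surjective (σ := Fin n) g hg b
    exact ⟨a, 1, by simp, by simp [ha]⟩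
  refine ⟨hqC, surj_loc _ _ _ hq hs, ?_⟩
  obtain ⟨h1, h2⟩ := loc_C q hqC
  have := GRS_flat _ h2 _ hk
  rw [ker_loc _ _ _ hq hs, MvPolynomial.ker_map, Ideal.map_map]
  exact this

end

section
open TensorProduct IsLocalRing
open RingTheory.Sequence Pointwise

theorem surj_max {P C : Type u} [CommRing P] [CommRing C] [IsLocalRing P] [IsLocalRing C]
    (φ : P →+* C) (hφ : Function.Surjective φ) : (maximalIdeal P).map φ = maximalIdeal C := by
  have hl : IsLocalHom φ := hφ.isLocalHom
  refine le_antisymm (((IsLocalRing.local_hom_TFAE φ).out 0 2).1 hl) ?_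
  intro y hy
  obtain ⟨x, rfl⟩ := hφ y
  refine Ideal.mem_map_of_mem φ ((IsLocalRing.mem_maximalIdeal _).2 fun h => ?_)
  exact (IsLocalRing.mem_maximalIdeal _).1 hy (h.map φ)

theorem compl_surj {P C : Type u} [CommRing P] [CommRing C] [IsLocalRing P] [IsLocalRing C]
    [IsNoetherianRing P] (φ : P →+* C) (hφ : Function.Surjective φ) :
    Function.Surjective (compMap (maximalIdeal P) (maximalIdeal C) φ (surj_max φ hφ).le) :=
  compMap_surj _ _ φ (maximalIdeal P).fg_of_isNoetherianRing
    (Ideal.Quotient.mk_surjective.comp hφ) (surj_max φ hφ)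

theorem compl_flat (P : Type u) [CommRing P] [IsNoetherianRing P] (I : Ideal P) :
    (algebraMap P (AdicCompletion I P)).Flat := by
  rw [RingHom.flat_algebraMap_iff]
  infer_instance

theorem compl_grs {P C : Type u} [CommRing P] [CommRing C] [IsLocalRing P] [IsLocalRing C]
    [IsNoetherianRing P] (φ : P →+* C) (hφ : Function.Surjective φ)
    (hk : GeneratedByRegularSequence P (RingHom.ker φ)) :
    GeneratedByRegularSequence (AdicCompletion (maximalIdeal P) P)
      (RingHom.ker (compMap (maximalIdeal P) (maximalIdeal C) φ (surj_max φ hφ).le)) := by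
  rw [compMap_ker (maximalIdeal C) φ hφ (surj_max φ hφ)]
  exact GRS_flat _ (compl_flat P _) _ hk

theorem ci_final {Λ : Type u} [CommRing Λ] [IsLocalRing Λ] [IsNoetherianRing Λ] {n : ℕ}
    (p : Ideal (MvPolynomial (Fin n) Λ)) [p.IsPrime]
    (hp : p.comap MvPolynomial.C = maximalIdeal Λ)
    {C : Type u} [CommRing C] [IsLocalRing C] [IsNoetherianRing C]
    (φ : Localization.AtPrime p →+* C) (hφ : Function.Surjective φ)
    (hk : GeneratedByRegularSequence (Localization.AtPrime p) (RingHom.ker φ))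
    (ψ : Λ →+* AdicCompletion (maximalIdeal C) C)
    (hψ : ∀ a, ψ a = algebraMap C _ (φ (algebraMap Λ _ a))) :
    IsCIAt Λ (AdicCompletion (maximalIdeal C) C) ψ
      ((maximalIdeal C).map (algebraMap C (AdicCompletion (maximalIdeal C) C))) := by
  let P := Localization.AtPrime p
  have : IsNoetherianRing P := IsLocalization.isNoetherianRing p.primeCompl _ inferInstance
  let Ph := AdicCompletion (maximalIdeal P) P
  let Ch := AdicCompletion (maximalIdeal C) C
  let MT : Ideal Ch := (maximalIdeal C).map (algebraMap C Ch)
  have hMT : IsAdicComplete MT Ch :=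
    AdicCompletion.isAdicComplete_self _ (maximalIdeal C).fg_of_isNoetherianRing
  have hbij : Function.Bijective (algebraMap Ch (AdicCompletion MT Ch)) :=
    (AdicCompletion.ofAlgEquiv MT).bijective
  let γ : Ph →+* Ch := compMap (maximalIdeal P) (maximalIdeal C) φ (surj_max φ hφ).le
  have hγ : Function.Surjective γ := compl_surj φ hφ
  have hnt : Nontrivial (AdicCompletion MT Ch) := hbij.1.nontrivial
  have hg : Function.Surjective ((algebraMap Ch (AdicCompletion MT Ch)).comp γ) := hbij.2.comp hγ
  obtain ⟨hl, hf⟩ := loc_C p hp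
  refine ⟨Ph, inferInstance, (algebraMap P Ph).comp (algebraMap Λ P),
    (algebraMap Ch (AdicCompletion MT Ch)).comp γ,
    ⟨?_, inferInstance, ⟨inferInstance, inferInstance⟩, ⟨?_, ?_, ?_⟩, hg, hg.isLocalHom⟩, ?_⟩
  · refine RingHom.ext fun a => ?_
    change algebraMap Ch _ (γ (algebraMap P Ph (algebraMap Λ P a))) = algebraMap Ch _ (ψ a)
    rw [hψ, compMap_algebraMap]
  · exact RingHom.isLocalHom_comp _ _
  · exact RingHom.Flat.comp hf (compl_flat P _)
  · rw [← Ideal.map_map]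
    exact fibre_compl _ (fibre_reg n p hp)
  · have : RingHom.ker ((algebraMap Ch (AdicCompletion MT Ch)).comp γ) = RingHom.ker γ :=
      RingHom.ker_comp_of_injective _ hbij.1
    rw [this]
    exact compl_grs φ hφ hk

end

section
open TensorProduct IsLocalRing
open RingTheory.Sequence Pointwise

theorem aq_final {Λ : Type u} [CommRing Λ] [IsLocalRing Λ] [IsNoetherianRing Λ] {n : ℕ}
    (p : Ideal (MvPolynomial (Fin n) Λ)) [p.IsPrime]
    {C : Type u} [CommRing C] [IsLocalRing C] [IsNoetherianRing C]
    (φ : Localization.AtPrime p →+* C) (hφ : Function.Surjective φ)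
    (hk : GeneratedByRegularSequence (Localization.AtPrime p) (RingHom.ker φ))
    [Algebra Λ (AdicCompletion (maximalIdeal C) C)]
    (hψ : ∀ a, algebraMap Λ (AdicCompletion (maximalIdeal C) C) a =
      algebraMap C _ (φ (algebraMap Λ _ a))) :
    Subsingleton (AQH Λ (AdicCompletion (maximalIdeal C) C) ((AdicCompletion (maximalIdeal C) C) ⧸
      ((maximalIdeal C).map (algebraMap C (AdicCompletion (maximalIdeal C) C)))) 2) := by
  let P := Localization.AtPrime p
  have : IsNoetherianRing P := IsLocalization.isNoetherianRing p.primeCompl _ inferInstance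
  let Ph := AdicCompletion (maximalIdeal P) P
  let Ch := AdicCompletion (maximalIdeal C) C
  let γ : Ph →+* Ch := compMap (maximalIdeal P) (maximalIdeal C) φ (surj_max φ hφ).le
  have hγ : Function.Surjective γ := compl_surj φ hφ
  let MT : Ideal Ch := (maximalIdeal C).map (algebraMap C Ch)
  have hMTe : MT = maximalIdeal Ch := AdicCompletion.maximalIdeal_eq_map.symm
  have hMT : MT.IsMaximal := by rw [hMTe]; infer_instance
  have hlφ : IsLocalHom φ := hφ.isLocalHom
  let ι : MvPolynomial (Fin n) Λ →+* Ph := (algebraMap P Ph).comp (algebraMap _ P)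
  have hι : algebraMap (MvPolynomial (Fin n) Λ) Ph = ι := rfl
  have hγι : ∀ s, γ (ι s) = algebraMap C Ch (φ (algebraMap _ P s)) := fun s =>
    compMap_algebraMap _ _ _ _ _
  have hflat : Module.Flat (MvPolynomial (Fin n) Λ) Ph := by
    have h : (algebraMap (MvPolynomial (Fin n) Λ) P).Flat := by
      rw [RingHom.flat_algebraMap_iff]
      exact IsLocalization.flat _ p.primeCompl
    have h2 : ι.Flat := RingHom.Flat.comp h (compl_flat P _)
    rw [← RingHom.flat_algebraMap_iff, hι]
    exact h2
  have hmem : ∀ s, γ (ι s) ∈ MT → s ∈ p := by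
    intro s hs
    by_contra hn
    have hu : IsUnit (algebraMap _ P s) := IsLocalization.map_units P (⟨s, hn⟩ : p.primeCompl)
    rw [hγι] at hs
    exact hMT.ne_top (Ideal.eq_top_of_isUnit_mem _ hs ((hu.map φ).map _))
  have hmem' : ∀ s ∈ p, γ (ι s) ∈ MT := by
    intro s hs
    rw [hγι]
    refine Ideal.mem_map_of_mem _ ?_
    rw [← surj_max φ hφ]
    refine Ideal.mem_map_of_mem _ ?_
    rw [← Localization.AtPrime.map_eq_maximalIdeal]
    exact Ideal.mem_map_of_mem _ hs
  refine AQ_main n γ hγ ?_ (compl_grs φ hφ hk) MT hMT ?_ ?_ ?_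
  · intro a
    rw [hψ]
    exact hγι _
  · intro b
    have hres : ∃ c : C, b - algebraMap C Ch c ∈ MT := by
      obtain ⟨z, hz⟩ := (AdicCompletion.residueField_map_bijective_of_fg
        (maximalIdeal C).fg_of_isNoetherianRing).2 (IsLocalRing.residue Ch b)
      obtain ⟨c, rfl⟩ := IsLocalRing.residue_surjective z
      refine ⟨c, ?_⟩
      rw [hMTe]
      refine (Ideal.Quotient.eq).1 hz.symm
    obtain ⟨c, hc⟩ := hres
    obtain ⟨x, rfl⟩ := hφ c
    obtain ⟨a, s, rfl⟩ := IsLocalization.exists_mk'_eq p.primeCompl x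
    refine ⟨a, s, fun h => s.2 (hmem _ h), ?_⟩
    have h2 := congrArg (fun z => algebraMap C Ch (φ z)) (IsLocalization.mk'_spec P a s)
    simp only [map_mul] at h2
    change b * γ (ι s) - γ (ι a) ∈ MT
    rw [hγι, hγι, ← h2, ← sub_mul]
    exact MT.mul_mem_right _ hc
  · intro s hs
    have hn : s ∉ p := fun h => hs (hmem' s h)
    exact (IsLocalization.map_units P (⟨s, hn⟩ : p.primeCompl)).map (algebraMap P Ph)
  · have h3 : (MT.comap γ).comap ι = p := by
      ext s
      exact ⟨hmem s, hmem' s⟩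
    change MT.comap γ ≤ ((MT.comap γ).comap ι).map ι
    rw [h3, ← Ideal.map_map, Localization.AtPrime.map_eq_maximalIdeal,
      ← AdicCompletion.maximalIdeal_eq_map]
    have : (MT.comap γ).IsPrime := Ideal.IsPrime.comap γ
    exact IsLocalRing.le_maximalIdeal this.ne_top

end

section
open TensorProduct IsLocalRing
open RingTheory.Sequence Pointwise

theorem inclR_flat (R S R' : Type u) [CommRing R] [CommRing S] [CommRing R'] [Algebra R S]
    [Algebra R R'] [Module.Flat R R'] :
    (Algebra.TensorProduct.includeRight : S →ₐ[R] R' ⊗[R] S).toRingHom.Flat := by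
  have : (algebraMap R R').Flat := RingHom.flat_algebraMap_iff.2 inferInstance
  let _ : Algebra S (R' ⊗[R] S) :=
    Algebra.TensorProduct.rightAlgebra
  have : Module.Flat S (R' ⊗[R] S) := by
    refine Module.Flat.of_linearEquiv (M := S ⊗[R] R') ?_
    exact { (TensorProduct.comm R R' S) with
      map_smul' := by
        intro r x
        induction x with
        | zero => simp
        | add x y hx hy =>
          change TensorProduct.comm R R' S (r • x) =
            r • TensorProduct.comm R R' S x at hx
          change TensorProduct.comm R R' S (r • y) =
            r • TensorProduct.comm R R' S y at hy
          change TensorProduct.comm R R' S (r • (x + y)) =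
            r • TensorProduct.comm R R' S (x + y)
          refine (congrArg _ (smul_add r x y)).trans ?_
          rw [map_add, map_add, hx, hy]
          exact (smul_add r _ _).symm
        | tmul x y =>
          have : r • (x ⊗ₜ[R] y) = x ⊗ₜ[R] (r * y) := by
            rw [Algebra.smul_def]
            exact (Algebra.TensorProduct.tmul_mul_tmul _ _ _ _).trans (by rw [one_mul])
          rw [this]
          rfl }
  exact this

end

set_option maxHeartbeats 2000000 in
set_option synthInstance.maxHeartbeats 400000 in
/-- The key construction in the proof of Theorem 3.1: base change of a
quasi-deformation along a flat, essentially of finite type map with complete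
intersection closed fibre, via completion of a suitable localization of
`T = R' ⊗_R S`. -/
theorem quasiDeformation_of_flat_ci_fibre
    (R S R' Q : Type u) [CommRing R] [CommRing S] [CommRing R'] [CommRing Q]
    [IsLocalRing R] [IsLocalRing S] [IsLocalRing R'] [IsLocalRing Q]
    [IsNoetherianRing R] [IsNoetherianRing S] [IsNoetherianRing R'] [IsNoetherianRing Q]
    [Algebra R S] [IsLocalHom (algebraMap R S)] [Module.Flat R S] [Algebra.EssFiniteType R S]
    (hfib : IsCompleteIntersectionRing (S ⧸ Ideal.map (algebraMap R S) (maximalIdeal R)))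
    [Algebra R R'] [IsLocalHom (algebraMap R R')] [Module.Flat R R']
    (g : Q →+* R') (hgl : IsLocalHom g) (hgsur : Function.Surjective g)
    (hgker : GeneratedByRegularSequence Q (RingHom.ker g))
    (𝔐 : Ideal (R' ⊗[R] S)) (h𝔐 : 𝔐.IsMaximal)
    (h1 : Ideal.comap (Algebra.TensorProduct.includeLeftRingHom : R' →+* R' ⊗[R] S) 𝔐 =
      maximalIdeal R')
    (h2 : Ideal.comap (Algebra.TensorProduct.includeRight : S →ₐ[R] R' ⊗[R] S).toRingHom 𝔐 =
      maximalIdeal S) :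
    letI : 𝔐.IsPrime := h𝔐.isPrime
    let TL := Localization.AtPrime 𝔐
    let That := AdicCompletion (maximalIdeal TL) TL
    let β : R' →+* That :=
      (algebraMap TL That).comp
        ((algebraMap (R' ⊗[R] S) TL).comp Algebra.TensorProduct.includeLeftRingHom)
    let α : S →+* That :=
      (algebraMap TL That).comp
        ((algebraMap (R' ⊗[R] S) TL).comp
          (Algebra.TensorProduct.includeRight : S →ₐ[R] R' ⊗[R] S).toRingHom)
    let MT : Ideal That := Ideal.map (algebraMap TL That) (maximalIdeal TL)
    let E := That ⧸ MT
    (letI := β.toAlgebra; Subsingleton (AQH R' That E 2)) ∧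
    IsCIAt R' That β MT ∧
    IsCIAt Q That (β.comp g) MT ∧
    (∃ (Q' : Type u) (_ : CommRing Q') (g' : Q' →+* That),
      IsQuasiDeformation S That Q' α g') := by
  have hPr : 𝔐.IsPrime := h𝔐.isPrime
  obtain ⟨n, ω, hωC, hω, hG⟩ := pres_T R S R' hfib 𝔐 h2
  intro TL That β α MT E
  have hp : (𝔐.comap ω).comap MvPolynomial.C = maximalIdeal R' := by
    rw [← h1, Ideal.comap_comap]
    congr 1
    exact RingHom.ext hωC
  let P := Localization.AtPrime (𝔐.comap ω)
  have hPn : IsNoetherianRing P :=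
    IsLocalization.isNoetherianRing (𝔐.comap ω).primeCompl _ inferInstance
  let φ : P →+* TL := Localization.localRingHom (𝔐.comap ω) 𝔐 ω rfl
  have hφ : Function.Surjective φ := surj_loc ω _ 𝔐 rfl hω
  have hTL : IsNoetherianRing TL := isNoetherianRing_of_surjective _ _ φ hφ
  have hφC : ∀ a, φ (algebraMap R' P a) = algebraMap (R' ⊗[R] S) TL (a ⊗ₜ 1) := by
    intro a
    have h3 : algebraMap R' P a = algebraMap (MvPolynomial (Fin n) R') P (MvPolynomial.C a) := rfl
    rw [h3, Localization.localRingHom_to_map, hωC]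
  have hβ : ∀ a, β a = algebraMap TL That (φ (algebraMap R' P a)) := by
    intro a
    rw [hφC]
    rfl
  let q := (𝔐.comap ω).comap (MvPolynomial.map (σ := Fin n) g)
  obtain ⟨hq, hqs, hqG⟩ := pres_Q g hgl hgsur hgker (𝔐.comap ω) hp q rfl
  let PQ := Localization.AtPrime q
  have hPQn : IsNoetherianRing PQ :=
    IsLocalization.isNoetherianRing q.primeCompl _ inferInstance
  let π : PQ →+* P := Localization.localRingHom q (𝔐.comap ω) (MvPolynomial.map g) rfl
  have hρ : Function.Surjective (φ.comp π) := hφ.comp hqs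
  have hρG := GRS_comp π hqs φ hqG hG
  refine ⟨?_, ci_final _ hp φ hφ hG β hβ, ci_final q hq (φ.comp π) hρ hρG (β.comp g) ?_, ?_⟩
  · let _ := β.toAlgebra
    exact aq_final _ φ hφ hG hβ
  · intro a
    rw [RingHom.comp_apply, hβ]
    have h3 : algebraMap Q PQ a = algebraMap (MvPolynomial (Fin n) Q) PQ (MvPolynomial.C a) := rfl
    have h4 : π (algebraMap Q PQ a) = algebraMap R' P (g a) := by
      rw [h3, Localization.localRingHom_to_map, MvPolynomial.map_C]
      rfl
    rw [RingHom.comp_apply, h4]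
  · let Q' := AdicCompletion (maximalIdeal PQ) PQ
    let g' : Q' →+* That := compMap (maximalIdeal PQ) (maximalIdeal TL) (φ.comp π) (surj_max _ hρ).le
    have hg' : Function.Surjective g' := compl_surj _ hρ
    refine ⟨Q', inferInstance, g', inferInstance, inferInstance, inferInstance, inferInstance, ?_,
      hg'.isLocalHom, ?_, hg', compl_grs _ hρ hρG⟩
    · have hl : IsLocalHom ((algebraMap (R' ⊗[R] S) TL).comp
          (Algebra.TensorProduct.includeRight : S →ₐ[R] R' ⊗[R] S).toRingHom) := by
        refine ((IsLocalRing.local_hom_TFAE _).out 0 4).2 ?_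
        rw [← Ideal.comap_comap]
        exact (congrArg (Ideal.comap _)
          (IsLocalization.AtPrime.comap_maximalIdeal TL 𝔐)).trans h2
      exact RingHom.isLocalHom_comp _ _
    · have hf1 : (Algebra.TensorProduct.includeRight : S →ₐ[R] R' ⊗[R] S).toRingHom.Flat :=
        inclR_flat R S R'
      have hf2 : (algebraMap (R' ⊗[R] S) TL).Flat := by
        rw [RingHom.flat_algebraMap_iff]
        exact IsLocalization.flat _ 𝔐.primeCompl
      exact RingHom.Flat.comp (RingHom.Flat.comp hf1 hf2) (compl_flat TL _)
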